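/- arXiv:math/0610988 — 3 statements merged into one kernel-verified Lean document; each statement's English description precedes it below -/
import Mathlib

section
/- Let I be a nontrivial ideal on ℕ. The following are equivalent: (1) there is a lower semicontinuous submeasure φ on ℕ such that I = Exh_φ; (2) I is analytic (as a subset of Cantor space, identifying subsets of ℕ with characteristic functions) and I is a P-ideal; (3) I is analytic and E₁ is not Borel reducible to E_I. -/
open MeasureTheory Filter

/-- Borel reducibility: a Borel-measurable map `θ` with `E x x' ↔ F (θ x) (θ x')`. -/
def BorelReducible {X Y : Type*} [TopologicalSpace X] [TopologicalSpace Y]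
    (E : X → X → Prop) (F : Y → Y → Prop) : Prop :=
  ∃ θ : X → Y, @Measurable X Y (borel X) (borel Y) θ ∧
    ∀ x x' : X, E x x' ↔ F (θ x) (θ x')

/-- `E₁`: eventual equality on `(2^ℕ)^ℕ`. -/
def E1 (x y : ℕ → ℕ → Bool) : Prop := {k : ℕ | x k ≠ y k}.Finite

/-- An ideal on `ℕ`, with subsets of `ℕ` identified with their characteristic
functions in Cantor space: contains `∅`, closed under subsets and (finite) unions. -/
def IsIdeal (I : Set (ℕ → Bool)) : Prop :=
  (fun _ => false) ∈ I ∧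
  (∀ x y : ℕ → Bool, y ∈ I → (∀ n, x n = true → y n = true) → x ∈ I) ∧
  (∀ x y : ℕ → Bool, x ∈ I → y ∈ I → (fun n => x n || y n) ∈ I)

/-- Nontrivial ideal: contains all singletons and does not contain `ℕ`. -/
def NontrivialIdeal (I : Set (ℕ → Bool)) : Prop :=
  IsIdeal I ∧ (∀ k : ℕ, (fun n => decide (n = k)) ∈ I) ∧ (fun _ => true) ∉ I

/-- The equivalence relation induced by an ideal: `x ∼ y` iff `x Δ y ∈ I`. -/
def EI (I : Set (ℕ → Bool)) (x y : ℕ → Bool) : Prop := (fun n => x n != y n) ∈ I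

/-- A lower semicontinuous submeasure on `ℕ`. -/
def IsLSCSubmeasure (φ : Set ℕ → ENNReal) : Prop :=
  φ ∅ = 0 ∧ (∀ n : ℕ, φ {n} < ⊤) ∧
  (∀ x y : Set ℕ, φ x ≤ φ (x ∪ y)) ∧
  (∀ x y : Set ℕ, φ (x ∪ y) ≤ φ x + φ y) ∧
  (∀ x : Set ℕ, φ x = ⨆ n : ℕ, φ (x ∩ Set.Iio n))

/-- `I = Exh_φ`, i.e. `x ∈ I` iff `φ(x ∩ [n,∞)) → 0` as `n → ∞`. -/
def IsExh (φ : Set ℕ → ENNReal) (I : Set (ℕ → Bool)) : Prop :=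
  ∀ x : ℕ → Bool, x ∈ I ↔
    Tendsto (fun n : ℕ => φ ({m : ℕ | x m = true} ∩ Set.Ici n)) atTop (nhds 0)

/-- The P-ideal property: every countable subfamily of `I` has a pseudo-union in `I`. -/
def PIdealProperty (I : Set (ℕ → Bool)) : Prop :=
  ∀ f : ℕ → ℕ → Bool, (∀ k, f k ∈ I) →
    ∃ x ∈ I, ∀ k, {m : ℕ | f k m = true ∧ x m = false}.Finite

section AnalyticPIdeals

open Topology Set

/-! ### The Baire property of analytic sets -/

section BaireProperty

variable {X : Type*} [TopologicalSpace X]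

/-- The set of points at which `B` is locally nonmeagre. -/
def nonmeagreLocus (B : Set X) : Set X :=
  {x | ∀ U, IsOpen U → x ∈ U → ¬ IsMeagre (B ∩ U)}

theorem isClosed_nonmeagreLocus (B : Set X) : IsClosed (nonmeagreLocus B) := by
  rw [← isOpen_compl_iff, isOpen_iff_forall_mem_open]
  intro x hx
  simp only [nonmeagreLocus, mem_compl_iff, mem_ofPred_eq, not_forall, not_not] at hx
  obtain ⟨U, hU, hxU, hm⟩ := hx
  exact ⟨U, fun y hy h => h U hU hy hm, hU, hxU⟩

theorem nonmeagreLocus_subset_closure (B : Set X) : nonmeagreLocus B ⊆ closure B := by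
  intro x hx
  by_contra h
  refine hx (closure B)ᶜ isClosed_closure.isOpen_compl h ?_
  have : B ∩ (closure B)ᶜ = ∅ := by
    ext y
    simp only [mem_inter_iff, mem_compl_iff, mem_empty_iff_false, iff_false, not_and, not_not]
    exact fun hy => subset_closure hy
  rw [this]
  exact IsMeagre.empty

theorem isMeagre_diff_nonmeagreLocus [SecondCountableTopology X] (B : Set X) :
    IsMeagre (B \ nonmeagreLocus B) := by
  let S := {U ∈ TopologicalSpace.countableBasis X | IsMeagre (B ∩ U)}
  have hS : S.Countable := (TopologicalSpace.countable_countableBasis X).mono fun _ h => h.1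
  refine (isMeagre_biUnion hS (f := fun U => B ∩ U) fun U hU => hU.2).mono ?_
  rintro x ⟨hxB, hx⟩
  simp only [nonmeagreLocus, mem_ofPred_eq, not_forall, not_not] at hx
  obtain ⟨U, hU, hxU, hm⟩ := hx
  obtain ⟨V, hV, hxV, hVU⟩ :=
    (TopologicalSpace.isBasis_countableBasis X).exists_subset_of_mem_open hxU hU
  simp only [mem_iUnion]
  exact ⟨V, ⟨hV, hm.mono (inter_subset_inter_right _ hVU)⟩, hxB, hxV⟩

theorem isMeagre_nonmeagreLocus_diff [SecondCountableTopology X] {B : Set X} {C : ℕ → Set X}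
    (h : B ⊆ ⋃ n, C n) : IsMeagre (nonmeagreLocus B \ ⋃ n, nonmeagreLocus (C n)) := by
  set W := ⋃ n, interior (nonmeagreLocus (C n)) with hW
  have hWo : IsOpen W := isOpen_iUnion fun n => isOpen_interior
  have hfr : IsMeagre (frontier W) :=
    ((isClosed_isNowhereDense_iff_compl.2 (by
      refine ⟨isClosed_frontier.isOpen_compl, ?_⟩
      rw [← interior_eq_empty_iff_dense_compl]
      exact interior_frontier hWo.isClosed_compl ▸ frontier_compl W ▸ rfl)).2).isMeagre
  refine hfr.mono ?_
  rintro x ⟨hx, hxn⟩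
  rw [hWo.frontier_eq]
  refine ⟨?_, fun hxW => hxn (iUnion_mono (fun n => interior_subset) hxW)⟩
  by_contra hxc
  set U := (closure W)ᶜ with hU
  have hUo : IsOpen U := isClosed_closure.isOpen_compl
  refine hx U hUo hxc ?_
  refine (isMeagre_iUnion (f := fun n => C n ∩ U) fun n => ?_).mono
    ((inter_subset_inter_left U h).trans (iUnion_inter U C).subset)
  have hcl := isClosed_nonmeagreLocus (C n)
  have hfr' : IsMeagre (frontier (nonmeagreLocus (C n))) :=
    ((isClosed_isNowhereDense_iff_compl.2 (by
      refine ⟨isClosed_frontier.isOpen_compl, ?_⟩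
      rw [← interior_eq_empty_iff_dense_compl]
      exact interior_frontier hcl)).2).isMeagre
  refine ((isMeagre_diff_nonmeagreLocus (C n)).union hfr').mono ?_
  rintro y ⟨hyC, hyU⟩
  by_cases hy : y ∈ nonmeagreLocus (C n)
  · right
    rw [hcl.frontier_eq]
    exact ⟨hy, fun hyi => hyU (subset_closure (mem_iUnion.2 ⟨n, hyi⟩))⟩
  · exact Or.inl ⟨hyC, hy⟩

open PiNat in
/-- Analytic sets have the property of Baire. -/
theorem MeasureTheory.AnalyticSet.baireMeasurableSet [T2Space X] [SecondCountableTopology X]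
    {s : Set X} (hs : AnalyticSet s) : BaireMeasurableSet s := by
  rw [AnalyticSet] at hs
  rcases hs with rfl | ⟨f, hf, rfl⟩
  · exact isOpen_empty.baireMeasurableSet
  let B : List ℕ → Set X := fun l => f '' {α | res α l.length = l}
  have hB : ∀ l, B l ⊆ ⋃ n, B (n :: l) := by
    rintro l _ ⟨α, hα, rfl⟩
    refine mem_iUnion.2 ⟨α l.length, α, ?_, rfl⟩
    simp only [mem_ofPred_eq] at hα ⊢
    rw [List.length_cons, res_succ, hα]
  have hB0 : B [] = range f := by simp [B]
  have hE : IsMeagre ((range f \ nonmeagreLocus (range f)) ∪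
      ⋃ l, (nonmeagreLocus (B l) \ ⋃ n, nonmeagreLocus (B (n :: l)))) :=
    (isMeagre_diff_nonmeagreLocus _).union
      (isMeagre_iUnion fun l => isMeagre_nonmeagreLocus_diff (hB l))
  have key : range f =ᶠ[residual X] nonmeagreLocus (range f) := by
    rw [Filter.eventuallyEq_set]
    filter_upwards [hE] with x hx
    simp only [mem_compl_iff, mem_union, mem_iUnion, Set.mem_sdiff, not_or, not_and, not_not,
      not_exists] at hx
    obtain ⟨hx1, hx2⟩ := hx
    refine ⟨hx1, fun hx3 => ?_⟩
    have hstep : ∀ l : List ℕ, ∃ n, x ∈ nonmeagreLocus (B l) → x ∈ nonmeagreLocus (B (n :: l)) := by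
      intro l
      by_cases hl : x ∈ nonmeagreLocus (B l)
      · obtain ⟨n, hn⟩ := not_forall.1 (hx2 l hl)
        exact ⟨n, fun _ => not_not.1 hn⟩
      · exact ⟨0, fun h => (hl h).elim⟩
    choose a ha using hstep
    let l : ℕ → List ℕ := fun k => Nat.rec [] (fun _ l => a l :: l) k
    let α : ℕ → ℕ := fun k => a (l k)
    have hl : ∀ k, res α k = l k := by
      intro k
      induction k with
      | zero => rfl
      | succ k ih => rw [res_succ, ih]
    have hlx : ∀ k, x ∈ nonmeagreLocus (B (l k)) := by
      intro k
      induction k with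
      | zero => exact hB0.symm ▸ hx3
      | succ k ih => exact ha _ ih
    by_contra hne
    have hne' : x ≠ f α := fun h => hne ⟨α, h.symm⟩
    obtain ⟨U, V, hU, hV, hxU, hαV, hUV⟩ := t2_separation hne'
    obtain ⟨_, ⟨β, k, rfl⟩, hαβ, hsub⟩ :=
      (isTopologicalBasis_cylinders fun _ => ℕ).exists_subset_of_mem_open
        (show α ∈ f ⁻¹' V from hαV) (hV.preimage hf)
    have hxc := nonmeagreLocus_subset_closure _ (hlx k)
    obtain ⟨_, hyU, γ, hγ, rfl⟩ := mem_closure_iff.1 hxc U hU hxU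
    refine hUV.le_bot ⟨hyU, hsub ?_⟩
    have hlen : (l k).length = k := by rw [← hl, res_length]
    simp only [mem_ofPred_eq] at hγ
    rw [hlen, ← hl, res_eq_res] at hγ
    intro i hi
    rw [hγ hi, hαβ i hi]
  exact (isClosed_nonmeagreLocus _).isOpen_compl.baireMeasurableSet.of_compl.congr key.symm

end BaireProperty

/-! ### Category in Cantor space -/

theorem exists_eqOn_Iio_subset {ι : Type*} {U : Set (ℕ → ι)} [TopologicalSpace ι]
    [DiscreteTopology ι] (hU : IsOpen U) {x : ℕ → ι} (hx : x ∈ U) :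
    ∃ n, ∀ y, EqOn y x (Iio n) → y ∈ U := by
  obtain ⟨_, ⟨β, k, rfl⟩, hxβ, hsub⟩ :=
    (PiNat.isTopologicalBasis_cylinders fun _ => ι).exists_subset_of_mem_open hx hU
  exact ⟨k, fun y hy => hsub fun i hi => (hy hi).trans (hxβ i hi)⟩

theorem isOpen_eqOn_Iio (x : ℕ → Bool) (n : ℕ) : IsOpen {y : ℕ → Bool | EqOn y x (Iio n)} :=
  PiNat.isOpen_cylinder (fun _ => Bool) x n

open Classical in
/-- Negate the bits of `x` whose index lies in `F`. -/
noncomputable def flipBits (F : Set ℕ) (x : ℕ → Bool) : ℕ → Bool :=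
  fun n => if n ∈ F then !x n else x n

theorem flipBits_of_mem {F : Set ℕ} {n : ℕ} (h : n ∈ F) (x : ℕ → Bool) :
    flipBits F x n = !x n := by simp [flipBits, h]

theorem flipBits_of_notMem {F : Set ℕ} {n : ℕ} (h : n ∉ F) (x : ℕ → Bool) :
    flipBits F x n = x n := by simp [flipBits, h]

theorem flipBits_involutive (F : Set ℕ) : Function.Involutive (flipBits F) := by
  intro x
  ext n
  by_cases h : n ∈ F <;> simp [flipBits, h]

theorem continuous_flipBits (F : Set ℕ) : Continuous (flipBits F) := by
  refine continuous_pi fun n => ?_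
  by_cases h : n ∈ F
  · simp only [flipBits, h, if_true]
    exact (continuous_of_discreteTopology (f := not)).comp (continuous_apply n)
  · simp only [flipBits, h, if_false]
    exact continuous_apply n

theorem isOpenMap_flipBits (F : Set ℕ) : IsOpenMap (flipBits F) :=
  (show (ℕ → Bool) ≃ₜ (ℕ → Bool) from
    { (flipBits_involutive F).toPerm with
      continuous_toFun := continuous_flipBits F
      continuous_invFun := continuous_flipBits F }).isOpenMap

theorem flipBits_preimage_mem_residual (F : Set ℕ) {G : Set (ℕ → Bool)}
    (hG : G ∈ residual (ℕ → Bool)) : flipBits F ⁻¹' G ∈ residual (ℕ → Bool) :=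
  tendsto_residual_of_isOpenMap (continuous_flipBits F) (isOpenMap_flipBits F) hG

theorem exists_pattern_of_isOpen_dense {O : Set (ℕ → Bool)} (ho : IsOpen O) (hd : Dense O)
    (a g : ℕ) : ∃ b, a < b ∧ g ≤ b ∧ ∃ p : ℕ → Bool, ∀ x, EqOn x p (Ico a b) → x ∈ O := by
  classical
  let O' : Set (ℕ → Bool) := ⋂ F ∈ (Finset.range a).powerset, flipBits (F : Set ℕ) ⁻¹' O
  have hO' : IsOpen O' :=
    isOpen_biInter_finset fun F _ => ho.preimage (continuous_flipBits _)
  have hres : O' ∈ residual (ℕ → Bool) :=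
    (biInter_finset_mem _).2 fun F _ =>
      flipBits_preimage_mem_residual _ (residual_of_dense_open ho hd)
  obtain ⟨p, hp⟩ := (dense_of_mem_residual hres).nonempty
  obtain ⟨n, hn⟩ := exists_eqOn_Iio_subset hO' hp
  refine ⟨max n (max g (a + 1)), by omega, by omega, p, fun x hx => ?_⟩
  let x' : ℕ → Bool := fun j => if j < a then p j else x j
  have hx' : x' ∈ O' := by
    refine hn x' fun j hj => ?_
    by_cases hja : j < a
    · simp [x', hja]
    · simp only [x', hja, if_false]
      exact hx ⟨by omega, lt_of_lt_of_le hj (le_max_left _ _)⟩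
  let F := (Finset.range a).filter fun j => x j ≠ p j
  have hF : flipBits (F : Set ℕ) x' ∈ O :=
    mem_iInter₂.1 hx' F (Finset.mem_powerset.2 (Finset.filter_subset _ _))
  convert hF using 1
  ext j
  by_cases hja : j < a
  · by_cases hj : x j = p j
    · rw [flipBits_of_notMem (by simp [F, hj])]
      simp [x', hja, hj]
    · rw [flipBits_of_mem (by simp [F, hja, hj])]
      simp only [x', hja, if_true]
      cases h1 : x j <;> cases h2 : p j <;> simp_all
  · rw [flipBits_of_notMem (by simp [F, hja])]
    simp [x', hja]

theorem exists_pattern_of_mem_residual {G : Set (ℕ → Bool)} (hG : G ∈ residual (ℕ → Bool))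
    (g : ℕ → ℕ) : ∃ (a : ℕ → ℕ) (p : ℕ → Bool), StrictMono a ∧ (∀ i, g (a i) ≤ a (i + 1)) ∧
      ∀ x, (∃ᶠ i in atTop, EqOn x p (Ico (a i) (a (i + 1)))) → x ∈ G := by
  classical
  obtain ⟨t, htG, ht, htd⟩ := mem_residual.1 hG
  obtain ⟨f, hfo, rfl⟩ := ht.eq_iInter_nat
  let O : ℕ → Set (ℕ → Bool) := fun n => ⋂ k ∈ Finset.range (n + 1), f k
  have hO : ∀ n, IsOpen (O n) := fun n => isOpen_biInter_finset fun k _ => hfo k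
  have hOd : ∀ n, Dense (O n) := fun n =>
    htd.mono (subset_iInter₂ fun k _ => iInter_subset f k)
  choose B hB1 hB2 P hP using fun n a => exists_pattern_of_isOpen_dense (hO n) (hOd n) a (g a)
  let a : ℕ → ℕ := fun i => Nat.rec 0 (fun i a => B i a) i
  have ha : ∀ i, a (i + 1) = B i (a i) := fun i => rfl
  have hmono : StrictMono a := strictMono_nat_of_lt_succ fun i => by rw [ha]; exact hB1 _ _
  obtain ⟨p, hp⟩ : ∃ p : ℕ → Bool, ∀ i, EqOn p (P i (a i)) (Ico (a i) (a (i + 1))) := by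
    have key : ∀ j : ℕ, ∃ b : Bool, ∀ i, j ∈ Ico (a i) (a (i + 1)) → b = P i (a i) j := by
      intro j
      by_cases h : ∃ i : ℕ, j ∈ Ico (a i) (a (i + 1))
      · obtain ⟨i, hi⟩ := h
        refine ⟨P i (a i) j, fun i' hi' => ?_⟩
        obtain rfl : i = i' := by
          by_contra hne
          exact disjoint_left.1 (hmono.monotone.pairwise_disjoint_on_Ico_succ hne) hi hi'
        rfl
      · exact ⟨false, fun i hi => (h ⟨i, hi⟩).elim⟩
    choose p hp using key
    exact ⟨p, fun i j hj => hp j i hj⟩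
  refine ⟨a, p, hmono, fun i => by rw [ha]; exact hB2 _ _, fun x hx => htG ?_⟩
  refine mem_iInter.2 fun k => ?_
  obtain ⟨i, hki, hi⟩ := frequently_atTop.1 hx k
  have : x ∈ O i := hP i (a i) x fun j hj => (hi hj).trans (hp i hj)
  exact mem_iInter₂.1 this k (Finset.mem_range.2 (by omega))

/-- Jalali-Naini and Talagrand: a proper ideal with the property of Baire which contains the
finite sets admits a partition of `ℕ` into finite intervals such that no member of the ideal
contains infinitely many of them. -/
theorem exists_intervals_of_baireMeasurable_ideal {J : Set (ℕ → Bool)} (hJ : BaireMeasurableSet J)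
    (mono : ∀ x y, y ∈ J → x ≤ y → x ∈ J) (sup : ∀ x y, x ∈ J → y ∈ J → x ⊔ y ∈ J)
    (fin : ∀ x : ℕ → Bool, {n | x n = true}.Finite → x ∈ J) (top : ⊤ ∉ J) :
    ∃ a : ℕ → ℕ, StrictMono a ∧
      ∀ x, (∃ᶠ i in atTop, ∀ j ∈ Ico (a i) (a (i + 1)), x j = true) → x ∉ J := by
  classical
  have hmeagre : Jᶜ ∈ residual (ℕ → Bool) := by
    obtain ⟨U, hU, hJU⟩ := hJ.residualEq_isOpen
    rw [Filter.eventuallyEq_set] at hJU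
    rcases U.eq_empty_or_nonempty with rfl | ⟨q, hq⟩
    · filter_upwards [hJU] with x hx
      simpa using hx
    exfalso
    obtain ⟨n, hn⟩ := exists_eqOn_Iio_subset hU hq
    obtain ⟨x, ⟨hx1, hx2⟩, hx3⟩ := (dense_of_mem_residual (inter_mem hJU
      (flipBits_preimage_mem_residual (Ici n) hJU))).exists_mem_open (isOpen_eqOn_Iio q n)
      ⟨q, fun _ _ => rfl⟩
    have hxJ : x ∈ J := hx1.2 (hn x hx3)
    have hyJ : flipBits (Ici n) x ∈ J := by
      refine hx2.2 (hn _ fun j hj => ?_)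
      rw [flipBits_of_notMem (by simpa using hj), hx3 hj]
    refine top (mono _ _ (sup _ _ (sup _ _ hxJ hyJ) (fin (fun j => decide (j < n)) ?_)) ?_)
    · simpa using finite_lt_nat n
    · intro j
      by_cases hj : j < n
      · simp [hj]
      · simp only [Pi.sup_apply, flipBits_of_mem (show j ∈ Ici n by simpa using hj)]
        cases x j <;> simp
  obtain ⟨a, p, ha, -, hap⟩ := exists_pattern_of_mem_residual hmeagre id
  refine ⟨a, ha, fun x hx hxJ => ?_⟩
  let y : ℕ → Bool := fun j => x j && p j
  refine hap y (hx.mono fun i hi j hj => by simp [y, hi j hj]) (mono y x hxJ fun j => ?_)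
  simp only [y]
  cases x j <;> simp

instance polishSpace_cantor : PolishSpace (ℕ → Bool) := by
  have : TopologicalSpace.IsCompletelyMetrizableSpace (ℕ → Bool) := inferInstance
  exact instPolishSpaceOfSeparableSpaceOfIsCompletelyMetrizableSpace

/-! ### Lower semicontinuous submeasures and their exhaustive ideals -/

/-- The subset of `ℕ` with characteristic function `x`. -/
def trueSet (x : ℕ → Bool) : Set ℕ := {m | x m = true}

@[simp] theorem mem_trueSet {x : ℕ → Bool} {m : ℕ} : m ∈ trueSet x ↔ x m = true := Iff.rfl

theorem isClosed_setOf_of_locally {P : (ℕ → Bool) → Prop} {n : ℕ}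
    (h : ∀ x y, EqOn x y (Iio n) → P y → P x) : IsClosed {x | P x} := by
  rw [← isOpen_compl_iff, isOpen_iff_mem_nhds]
  intro x hx
  refine mem_of_superset ((isOpen_eqOn_Iio x n).mem_nhds fun _ _ => rfl) fun y hy hPy => ?_
  exact hx (h x y (fun i hi => (hy hi).symm) hPy)

namespace IsLSCSubmeasure

variable {φ : Set ℕ → ENNReal}

theorem mono (hφ : IsLSCSubmeasure φ) {x y : Set ℕ} (h : x ⊆ y) : φ x ≤ φ y := by
  have := hφ.2.2.1 x y
  rwa [union_eq_self_of_subset_left h] at this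

theorem union_le (hφ : IsLSCSubmeasure φ) (x y : Set ℕ) : φ (x ∪ y) ≤ φ x + φ y :=
  hφ.2.2.2.1 x y

theorem le_of_forall_inter_Iio (hφ : IsLSCSubmeasure φ) {x : Set ℕ} {c : ENNReal}
    (h : ∀ n, φ (x ∩ Iio n) ≤ c) : φ x ≤ c := by
  rw [hφ.2.2.2.2 x]
  exact iSup_le h

theorem biUnion_range_le (hφ : IsLSCSubmeasure φ) (x : ℕ → Set ℕ) (n : ℕ) :
    φ (⋃ k ∈ Finset.range n, x k) ≤ ∑ k ∈ Finset.range n, φ (x k) := by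
  induction n with
  | zero => simp [hφ.1]
  | succ n ih =>
    rw [Finset.range_add_one, Finset.set_biUnion_insert, Finset.sum_insert (by simp)]
    exact (hφ.union_le _ _).trans (by gcongr)

theorem iUnion_le_tsum (hφ : IsLSCSubmeasure φ) (x : ℕ → Set ℕ) :
    φ (⋃ k, x k) ≤ ∑' k, φ (x k) := by
  refine hφ.le_of_forall_inter_Iio fun n => ?_
  have : ∃ K, (⋃ k, x k) ∩ Iio n ⊆ ⋃ k ∈ Finset.range K, x k := by
    induction n with
    | zero => exact ⟨0, by simp⟩
    | succ n ih =>
      obtain ⟨K, hK⟩ := ih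
      by_cases hn : n ∈ ⋃ k, x k
      · obtain ⟨k, hk⟩ := mem_iUnion.1 hn
        refine ⟨max K (k + 1), fun m ⟨hm, hmn⟩ => ?_⟩
        rcases Nat.lt_succ_iff_lt_or_eq.1 hmn with h | rfl
        · obtain ⟨i, hi, hi'⟩ := mem_iUnion₂.1 (hK ⟨hm, h⟩)
          exact mem_iUnion₂.2 ⟨i, by simp at hi ⊢; omega, hi'⟩
        · exact mem_iUnion₂.2 ⟨k, by simp, hk⟩
      · refine ⟨K, fun m ⟨hm, hmn⟩ => ?_⟩
        rcases Nat.lt_succ_iff_lt_or_eq.1 hmn with h | rfl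
        · exact hK ⟨hm, h⟩
        · exact (hn hm).elim
  obtain ⟨K, hK⟩ := this
  exact (hφ.mono hK).trans ((hφ.biUnion_range_le x K).trans (ENNReal.sum_le_tsum _))

theorem isClosed_le (hφ : IsLSCSubmeasure φ) (c : ENNReal) :
    IsClosed {x | φ (trueSet x) ≤ c} := by
  have : {x | φ (trueSet x) ≤ c} = ⋂ n : ℕ, {x | φ (trueSet x ∩ Iio n) ≤ c} := by
    ext x
    simp only [mem_ofPred_eq, mem_iInter]
    exact ⟨fun h n => (hφ.mono inter_subset_left).trans h, hφ.le_of_forall_inter_Iio⟩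
  rw [this]
  refine isClosed_iInter fun n => isClosed_setOf_of_locally (n := n) fun x y hxy h => ?_
  convert h using 2
  ext m
  simp only [mem_inter_iff, mem_trueSet, and_congr_left_iff]
  intro hm
  rw [hxy hm]

end IsLSCSubmeasure

theorem isExh_iff {φ : Set ℕ → ENNReal} (hφ : IsLSCSubmeasure φ) {I : Set (ℕ → Bool)} :
    IsExh φ I ↔ ∀ x, x ∈ I ↔ ∀ ε > 0, ∃ n, φ (trueSet x ∩ Ici n) ≤ ε := by
  refine forall_congr' fun x => ?_
  rw [ENNReal.tendsto_nhds_zero]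
  refine iff_congr Iff.rfl (forall₂_congr fun ε _ => ⟨fun h => h.exists, fun ⟨n, hn⟩ => ?_⟩)
  refine eventually_atTop.2 ⟨n, fun m hm => (hφ.mono ?_).trans hn⟩
  exact inter_subset_inter_right _ (Ici_subset_Ici.2 hm)

theorem continuous_and_const (s : ℕ → Bool) : Continuous fun (x : ℕ → Bool) m => x m && s m :=
  continuous_pi fun m =>
    (continuous_of_discreteTopology (f := fun b => b && s m)).comp (continuous_apply m)

theorem analyticSet_of_isExh {φ : Set ℕ → ENNReal} (hφ : IsLSCSubmeasure φ)
    {I : Set (ℕ → Bool)} (hI : IsExh φ I) : AnalyticSet I := by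
  have : I = ⋂ k : ℕ, ⋃ n : ℕ, {x | φ (trueSet x ∩ Ici n) ≤ ((k : ENNReal) + 1)⁻¹} := by
    ext x
    rw [(isExh_iff hφ).1 hI x]
    simp only [mem_iInter, mem_iUnion, mem_ofPred_eq]
    refine ⟨fun h k => h _ (by simp), fun h ε hε => ?_⟩
    obtain ⟨k, hk⟩ := ENNReal.exists_inv_nat_lt hε.ne'
    obtain ⟨n, hn⟩ := h k
    refine ⟨n, hn.trans ((ENNReal.inv_le_inv.2 ?_).trans hk.le)⟩
    exact le_self_add
  rw [this]
  refine MeasureTheory.AnalyticSet.iInter fun k => MeasureTheory.AnalyticSet.iUnion fun n => ?_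
  have hc : IsClosed {x | φ (trueSet x ∩ Ici n) ≤ ((k : ENNReal) + 1)⁻¹} := by
    convert (hφ.isClosed_le ((k : ENNReal) + 1)⁻¹).preimage
      (continuous_and_const fun m => decide (n ≤ m)) using 1
    ext x
    simp only [mem_ofPred_eq, mem_preimage]
    rw [iff_iff_eq]
    congr 2
    ext m
    simp
  exact hc.analyticSet

theorem pIdealProperty_of_isExh {φ : Set ℕ → ENNReal} (hφ : IsLSCSubmeasure φ)
    {I : Set (ℕ → Bool)} (hI : IsExh φ I) : PIdealProperty I := by
  classical
  rw [isExh_iff hφ] at hI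
  intro f hf
  obtain ⟨δ, hδ, hδs⟩ := ENNReal.exists_pos_tsum_mul_lt_of_countable
    (ι := ℕ) (ε := 1) one_ne_zero (fun _ => 1) (by simp)
  have hδ' : ∑' i, (δ i : ENNReal) ≠ ⊤ := by
    simp only [one_mul] at hδs
    exact (hδs.trans ENNReal.one_lt_top).ne
  choose n hn using fun k => (hI (f k)).1 (hf k) (δ k) (by exact_mod_cast hδ k)
  let x : ℕ → Bool := fun m => decide (∃ k, f k m = true ∧ n k ≤ m)
  have hx : trueSet x = ⋃ k, trueSet (f k) ∩ Ici (n k) := by ext m; simp [x]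
  refine ⟨x, (hI x).2 fun ε hε => ?_, fun k => (finite_lt_nat (n k)).subset fun m ⟨h1, h2⟩ => ?_⟩
  · have hε2 : 0 < ε / 2 := ENNReal.half_pos hε.ne'
    obtain ⟨K, hK⟩ := ((ENNReal.tendsto_nhds_zero.1
      (ENNReal.tendsto_sum_nat_add (fun i => (δ i : ENNReal)) hδ')) _ hε2).exists
    have hfin : ∀ K : ℕ, ∀ ε > 0, ∃ N, φ ((⋃ k ∈ Finset.range K, trueSet (f k)) ∩ Ici N) ≤ ε := by
      intro K
      induction K with
      | zero => intro ε hε; exact ⟨0, by simp [hφ.1]⟩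
      | succ K ih =>
        intro ε hε
        have hε2 : 0 < ε / 2 := ENNReal.half_pos hε.ne'
        obtain ⟨N, hN⟩ := ih _ hε2
        obtain ⟨N', hN'⟩ := (hI (f K)).1 (hf K) _ hε2
        refine ⟨max N N', ?_⟩
        rw [Finset.range_add_one, Finset.set_biUnion_insert, union_inter_distrib_right,
          ← ENNReal.add_halves ε]
        refine (hφ.union_le _ _).trans (add_le_add ((hφ.mono ?_).trans hN')
          ((hφ.mono ?_).trans hN))
        · exact inter_subset_inter_right _ (Ici_subset_Ici.2 (le_max_right _ _))
        · exact inter_subset_inter_right _ (Ici_subset_Ici.2 (le_max_left _ _))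
    obtain ⟨N, hN⟩ := hfin K _ hε2
    refine ⟨N, ?_⟩
    have hsub : trueSet x ∩ Ici N ⊆ ((⋃ k ∈ Finset.range K, trueSet (f k)) ∩ Ici N) ∪
        ⋃ k, trueSet (f (k + K)) ∩ Ici (n (k + K)) := by
      rw [hx]
      rintro m ⟨hm, hmN⟩
      obtain ⟨k, hk⟩ := mem_iUnion.1 hm
      by_cases hkK : k < K
      · exact Or.inl ⟨mem_iUnion₂.2 ⟨k, by simpa using hkK, hk.1⟩, hmN⟩
      · refine Or.inr (mem_iUnion.2 ⟨k - K, ?_⟩)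
        rwa [Nat.sub_add_cancel (not_lt.1 hkK)]
    rw [← ENNReal.add_halves ε]
    refine (hφ.mono hsub).trans ((hφ.union_le _ _).trans (add_le_add hN ?_))
    exact (hφ.iUnion_le_tsum _).trans ((ENNReal.tsum_le_tsum fun k => hn (k + K)).trans hK)
  · by_contra h
    have : x m = true := by simpa [x] using ⟨k, h1, not_lt.1 h⟩
    simp [this] at h2

/-! ### Analytic ideals which are not P-ideals -/

theorem IsIdeal.mono {I : Set (ℕ → Bool)} (hI : IsIdeal I) {x y : ℕ → Bool} (hy : y ∈ I)
    (h : ∀ n, x n = true → y n = true) : x ∈ I := hI.2.1 x y hy h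

theorem IsIdeal.sup {I : Set (ℕ → Bool)} (hI : IsIdeal I) {x y : ℕ → Bool} (hx : x ∈ I)
    (hy : y ∈ I) : x ⊔ y ∈ I := hI.2.2 x y hx hy

theorem NontrivialIdeal.mem_of_finite {I : Set (ℕ → Bool)} (hI : NontrivialIdeal I)
    {x : ℕ → Bool} (hx : (trueSet x).Finite) : x ∈ I := by
  obtain ⟨N, hN⟩ := hx.bddAbove
  have key : ∀ n : ℕ, (fun m => decide (m < n)) ∈ I := by
    intro n
    induction n with
    | zero => simpa using hI.1.1
    | succ n ih =>
      refine hI.1.mono (hI.1.sup ih (hI.2.1 n)) fun m hm => ?_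
      simp only [decide_eq_true_eq] at hm
      simp only [Pi.sup_apply, Bool.max_eq_or, Bool.or_eq_true, decide_eq_true_eq]
      omega
  refine hI.1.mono (key (N + 1)) fun m hm => ?_
  simpa using Nat.lt_succ_of_le (hN hm)

theorem continuous_of_finset_dependence {X ι γ δ : Type*} [TopologicalSpace X]
    [TopologicalSpace γ] [DiscreteTopology γ] [TopologicalSpace δ] {e : ι → X → γ}
    (he : ∀ i, Continuous (e i)) (s : Finset ι) {F : X → δ}
    (h : ∀ x y, (∀ i ∈ s, e i x = e i y) → F x = F y) : Continuous F := by
  refine (IsLocallyConstant.iff_eventually_eq F).2 (fun x => ?_) |>.continuous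
  have : ∀ᶠ y in 𝓝 x, ∀ i ∈ s, e i y = e i x :=
    (eventually_all_finset s).2 fun i _ =>
      ((isOpen_discrete {e i x}).preimage (he i)).mem_nhds rfl
  exact this.mono fun y hy => h y x hy

section

variable (X : ℕ → ℕ → Bool)

open Classical in
/-- The union of the sets `X k`, each with a finite initial part controlled by `h k` removed. -/
noncomputable def diagonalUnion (h : ℕ → ℕ) : ℕ → Bool :=
  fun m => decide (∃ k ≤ m, h k ≤ m ∧ X k m = true)

theorem diagonalUnion_eq_true {h : ℕ → ℕ} {m : ℕ} :
    diagonalUnion X h m = true ↔ ∃ k ≤ m, h k ≤ m ∧ X k m = true := by simp [diagonalUnion]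

/-- The sets whose trace on some diagonal union of `X` lies in `I`. -/
def diagonalIdeal (I : Set (ℕ → Bool)) : Set (ℕ → Bool) :=
  {B | ∃ h : ℕ → ℕ, (fun m => B m && diagonalUnion X h m) ∈ I}

variable {X} {I : Set (ℕ → Bool)}

theorem diagonalIdeal_mono (hI : IsIdeal I) {x y : ℕ → Bool} (hy : y ∈ diagonalIdeal X I)
    (h : x ≤ y) : x ∈ diagonalIdeal X I := by
  obtain ⟨g, hg⟩ := hy
  refine ⟨g, hI.mono hg fun m hm => ?_⟩
  simp only [Bool.and_eq_true] at hm ⊢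
  exact ⟨h m hm.1, hm.2⟩

theorem diagonalIdeal_sup (hI : IsIdeal I) {x y : ℕ → Bool} (hx : x ∈ diagonalIdeal X I)
    (hy : y ∈ diagonalIdeal X I) : x ⊔ y ∈ diagonalIdeal X I := by
  obtain ⟨g, hg⟩ := hx
  obtain ⟨g', hg'⟩ := hy
  refine ⟨fun k => max (g k) (g' k), hI.mono (hI.sup hg hg') fun m hm => ?_⟩
  simp only [Bool.and_eq_true, Pi.sup_apply, Bool.max_eq_or, Bool.or_eq_true,
    diagonalUnion_eq_true] at hm ⊢
  obtain ⟨h, k, hk, hkm, hX⟩ := hm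
  have h1 : g k ≤ m := (le_max_left _ _).trans hkm
  have h2 : g' k ≤ m := (le_max_right _ _).trans hkm
  exact h.imp (fun h => ⟨h, k, hk, h1, hX⟩) (fun h => ⟨h, k, hk, h2, hX⟩)

theorem analyticSet_diagonalIdeal (hI : AnalyticSet I) : AnalyticSet (diagonalIdeal X I) := by
  let F : (ℕ → Bool) × (ℕ → ℕ) → ℕ → Bool := fun p m => p.1 m && diagonalUnion X p.2 m
  have hF : Continuous F := by
    refine continuous_pi fun m => ?_
    refine continuous_of_finset_dependence
      (e := fun k (p : (ℕ → Bool) × (ℕ → ℕ)) => (p.1 k, p.2 k)) (fun k => by fun_prop)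
      (Finset.range (m + 1)) fun p q hpq => ?_
    have h : ∀ k ≤ m, p.1 k = q.1 k ∧ p.2 k = q.2 k := fun k hk => by
      simpa using hpq k (by simpa using Nat.lt_succ_of_le hk)
    simp only [F, (h m le_rfl).1]
    congr 1
    rw [Bool.eq_iff_iff, diagonalUnion_eq_true, diagonalUnion_eq_true]
    refine exists_congr fun k => and_congr_right fun hk => ?_
    rw [(h k hk).2]
  have : diagonalIdeal X I = Prod.fst '' (F ⁻¹' I) := by
    ext B
    simp [diagonalIdeal, F]
  rw [this]
  exact (hI.preimage hF).image_of_continuous continuous_fst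

end

theorem borelReducible_E1_of_not_pIdeal {I : Set (ℕ → Bool)} (hI : NontrivialIdeal I)
    (hA : AnalyticSet I) (hP : ¬ PIdealProperty I) : BorelReducible E1 (EI I) := by
  classical
  simp only [PIdealProperty, not_forall, not_exists, not_and] at hP
  obtain ⟨f, hf, hfI⟩ := hP
  let X : ℕ → ℕ → Bool := fun k m => decide (∃ i ≤ k, f i m = true)
  have hX : ∀ k, X k ∈ I := by
    intro k
    induction k with
    | zero => exact hI.1.mono (hf 0) fun m hm => by simpa [X] using hm
    | succ k ih =>
      refine hI.1.mono (hI.1.sup ih (hf (k + 1))) fun m hm => ?_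
      simp only [X, decide_eq_true_eq, Pi.sup_apply, Bool.max_eq_or, Bool.or_eq_true] at hm ⊢
      obtain ⟨i, hi, hm⟩ := hm
      rcases Nat.le_succ_iff.1 hi with h | rfl
      exacts [Or.inl ⟨i, h, hm⟩, Or.inr hm]
  have hXmono : ∀ k l m, k ≤ l → X k m = true → X l m = true := by
    intro k l m hkl
    simp only [X, decide_eq_true_eq]
    rintro ⟨i, hi, h⟩
    exact ⟨i, hi.trans hkl, h⟩
  have hJtop : ⊤ ∉ diagonalIdeal X I := by
    rintro ⟨h, hh⟩
    obtain ⟨k, hk⟩ := hfI _ hh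
    refine hk ((finite_lt_nat (max k (h k))).subset fun m ⟨h1, h2⟩ => ?_)
    by_contra hm
    simp only [mem_ofPred_eq, lt_max_iff, not_or, not_lt] at hm
    have : diagonalUnion X h m = true :=
      (diagonalUnion_eq_true X).2 ⟨k, hm.1, hm.2, by simpa [X] using ⟨k, le_rfl, h1⟩⟩
    simp [this] at h2
  obtain ⟨a, ha, haJ⟩ := exists_intervals_of_baireMeasurable_ideal
    (analyticSet_diagonalIdeal hA).baireMeasurableSet
    (fun x y hy hxy => diagonalIdeal_mono (X := X) hI.1 hy hxy)
    (fun x y hx hy => diagonalIdeal_sup hI.1 hx hy)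
    (fun x hx => ⟨id, hI.mem_of_finite (hx.subset fun m hm => by
      simp only [mem_trueSet, Bool.and_eq_true] at hm
      exact hm.1)⟩) hJtop
  let θ : (ℕ → ℕ → Bool) → ℕ → Bool := fun x m =>
    decide (∃ i, m ∈ Ico (a i) (a (i + 1)) ∧ x i.unpair.1 i.unpair.2 = true ∧
      X i.unpair.1 m = true)
  have hθ : ∀ x i m, m ∈ Ico (a i) (a (i + 1)) →
      θ x m = (x i.unpair.1 i.unpair.2 && X i.unpair.1 m) := by
    intro x i m hm
    rw [Bool.eq_iff_iff]
    simp only [θ, decide_eq_true_eq, Bool.and_eq_true]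
    refine ⟨fun ⟨i', hi', h⟩ => ?_, fun h => ⟨i, hm, h⟩⟩
    obtain rfl : i' = i := by
      by_contra hne
      exact disjoint_left.1 (ha.monotone.pairwise_disjoint_on_Ico_succ hne) hi' hm
    exact h
  refine ⟨θ, Continuous.borel_measurable (continuous_pi fun m => ?_), fun x y => ⟨?_, ?_⟩⟩
  · refine continuous_of_finset_dependence
      (e := fun i (x : ℕ → ℕ → Bool) => x (Nat.unpair i).1 (Nat.unpair i).2)
      (fun i => by fun_prop) (Finset.range (m + 1)) fun x y hxy => ?_
    rw [Bool.eq_iff_iff]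
    simp only [θ, decide_eq_true_eq]
    refine exists_congr fun i => and_congr_right fun hi => ?_
    rw [hxy i (by simpa using Nat.lt_succ_of_le ((ha.id_le i).trans hi.1))]
  · intro h
    obtain ⟨K, hK⟩ := h.bddAbove
    refine hI.1.mono (hX K) fun m hm => ?_
    have hne : θ x m ≠ θ y m := by simpa using hm
    by_contra hXK
    have key : ∀ i, m ∈ Ico (a i) (a (i + 1)) → X i.unpair.1 m = true →
        x i.unpair.1 = y i.unpair.1 := by
      intro i _ hXi
      by_contra hxy
      exact hXK (hXmono _ _ _ (hK hxy) hXi)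
    apply hne
    rw [Bool.eq_iff_iff]
    simp only [θ, decide_eq_true_eq]
    refine exists_congr fun i => and_congr_right fun hi => and_congr_left fun hXi => ?_
    rw [key i hi hXi]
  · intro hD
    by_contra hinf
    have hex : ∀ k, ∃ n, x k ≠ y k → x k n ≠ y k n := by
      intro k
      by_cases h : x k = y k
      · exact ⟨0, fun h' => (h' h).elim⟩
      · obtain ⟨n, hn⟩ := Function.ne_iff.1 h
        exact ⟨n, fun _ => hn⟩
    choose n hn using hex
    let B : ℕ → Bool := fun m => decide (∃ k, x k ≠ y k ∧
      m ∈ Ico (a (Nat.pair k (n k))) (a (Nat.pair k (n k) + 1)))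
    refine haJ B (frequently_atTop.2 fun N => ?_) ?_
    · obtain ⟨k, hk, hkN⟩ := Set.Infinite.exists_gt hinf N
      refine ⟨Nat.pair k (n k), hkN.le.trans (Nat.left_le_pair _ _), fun j hj => ?_⟩
      simpa only [B, decide_eq_true_eq] using ⟨k, hk, hj⟩
    · refine ⟨fun k' => ∑ k ∈ Finset.range k', a (Nat.pair k (n k) + 1),
        hI.1.mono hD fun m hm => ?_⟩
      simp only [Bool.and_eq_true, B, decide_eq_true_eq, diagonalUnion_eq_true] at hm
      obtain ⟨⟨k, hk, hmk⟩, k', -, hk'm, hXk'⟩ := hm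
      have hkk' : k' ≤ k := by
        by_contra! hlt
        have := Finset.single_le_sum (f := fun k => a (Nat.pair k (n k) + 1))
          (fun _ _ => Nat.zero_le _) (Finset.mem_range.2 hlt)
        exact absurd hmk.2 (not_lt.2 (this.trans hk'm))
      have hXk : X k m = true := hXmono _ _ _ hkk' hXk'
      have h1 := hθ x _ m hmk
      have h2 := hθ y _ m hmk
      simp only [Nat.unpair_pair, hXk, Bool.and_true] at h1 h2
      simpa [h1, h2] using hn k hk

/-! ### `E₁` does not reduce to exhaustive ideals -/

theorem exists_residual_continuous_comp {f : (ℕ → Bool) → ℕ → Bool}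
    (hf : Measurable f) : ∃ G ∈ residual (ℕ → Bool),
      ∀ e : (ℕ → Bool) → ℕ → Bool, Continuous e → (∀ x, e x ∈ G) → Continuous (f ∘ e) := by
  have hS : ∀ n b, BaireMeasurableSet {x | f x n = b} := fun n b =>
    (((measurable_pi_apply n).comp hf) (measurableSet_singleton b)).baireMeasurableSet
  choose U hU hSU using fun n b => (hS n b).residualEq_isOpen
  simp only [Filter.eventuallyEq_set] at hSU
  refine ⟨{x | ∀ n b, x ∈ {x | f x n = b} ↔ x ∈ U n b},
    eventually_countable_forall.2 fun n => eventually_countable_forall.2 (hSU n), ?_⟩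
  refine fun e he heG => continuous_pi fun n => (continuous_discrete_rng).2 fun b => ?_
  have : (fun x => (f ∘ e) x n) ⁻¹' {b} = e ⁻¹' U n b := by
    ext x
    exact heG x n b
  rw [this]
  exact (hU n b).preimage he

namespace IsLSCSubmeasure

variable {φ : Set ℕ → ENNReal}

theorem isClosed_diff_le (hφ : IsLSCSubmeasure φ) {Y : Type*} [TopologicalSpace Y]
    {u v : Y → ℕ → Bool} (hu : Continuous u) (hv : Continuous v) (n : ℕ) (c : ENNReal) :
    IsClosed {y | φ ({m | u y m ≠ v y m} ∩ Ici n) ≤ c} := by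
  have hc : Continuous fun y m => (u y m != v y m) && decide (n ≤ m) := by
    refine continuous_pi fun m => ?_
    exact (continuous_of_discreteTopology
      (f := fun b : Bool × Bool => (b.1 != b.2) && decide (n ≤ m))).comp
      (((continuous_apply m).comp hu).prodMk ((continuous_apply m).comp hv))
  convert (hφ.isClosed_le c).preimage hc using 1
  ext y
  simp only [mem_ofPred_eq, mem_preimage]
  rw [iff_iff_eq]
  congr 2
  ext m
  simp

theorem diff_le_add (hφ : IsLSCSubmeasure φ) (u v w : ℕ → Bool) (s : Set ℕ) :
    φ ({m | u m ≠ v m} ∩ s) ≤ φ ({m | u m ≠ w m} ∩ s) + φ ({m | w m ≠ v m} ∩ s) := by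
  refine (hφ.mono ?_).trans (hφ.union_le _ _)
  rintro m ⟨hm, hms⟩
  by_cases h : u m = w m
  · exact Or.inr ⟨fun h' => hm (h.trans h'), hms⟩
  · exact Or.inl ⟨h, hms⟩

/-- Some coordinate `j` of the `k`-th column has arbitrarily small influence on `ψ`, locally and
on a dense open set. -/
theorem dense_iUnion_interior_flipBits (hφ : IsLSCSubmeasure φ) {ψ : (ℕ → Bool) → ℕ → Bool}
    (hψ : Continuous ψ) {col : ℕ → ℕ} {R : Set ℕ} {k : ℕ}
    (hcol : ∀ x y, (∀ j, x j ≠ y j → col j = k) →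
      ∀ ε > 0, ∃ n, φ ({m | ψ x m ≠ ψ y m} ∩ Ici n) ≤ ε)
    (hR : ∀ N, ∃ j ∈ R, N ≤ j ∧ col j = k) {ε : ENNReal} (hε : 0 < ε) :
    Dense (⋃ j ∈ {j | j ∈ R ∧ col j = k},
      interior {x | φ {m | ψ x m ≠ ψ (flipBits {j} x) m} ≤ ε}) := by
  classical
  rw [dense_iff_inter_open]
  rintro U hU ⟨x₀, hx₀⟩
  obtain ⟨N, hN⟩ := exists_eqOn_Iio_subset hU hx₀
  let mix : (ℕ → Bool) → (ℕ → Bool) → ℕ → Bool := fun z y j =>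
    if j < N then x₀ j else if col j = k then z j else y j
  have hmixc : Continuous fun p : (ℕ → Bool) × (ℕ → Bool) => mix p.1 p.2 := by
    refine continuous_pi fun j => ?_
    simp only [mix]
    split_ifs <;> fun_prop
  have hmix1 : ∀ y, Continuous fun z => mix z y := fun y =>
    hmixc.comp (continuous_id.prodMk continuous_const)
  have hmix2 : ∀ z, Continuous fun y => mix z y := fun z =>
    hmixc.comp (continuous_const.prodMk continuous_id)
  let b : Finset ℕ → ℕ → Bool := fun Q j => decide (j ∈ Q)
  have step : ∀ y, ∃ p : Finset ℕ × ℕ, ∀ z z', EqOn z (b p.1) (Iio p.2) →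
      EqOn z' (b p.1) (Iio p.2) → φ {m | ψ (mix z y) m ≠ ψ (mix z' y) m} ≤ ε := by
    intro y
    let A : ℕ → Set (ℕ → Bool) := fun n =>
      {z | φ ({m | ψ (mix z y) m ≠ ψ (mix x₀ y) m} ∩ Ici n) ≤ ε / 2}
    have hAc : ∀ n, IsClosed (A n) := fun n =>
      hφ.isClosed_diff_le (hψ.comp (hmix1 y)) continuous_const n _
    have hAu : ⋃ n, A n = univ := by
      refine eq_univ_of_forall fun z => mem_iUnion.2 ?_
      refine hcol _ _ (fun j hj => ?_) _ (ENNReal.half_pos hε.ne')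
      by_contra hjk
      simp [mix, hjk] at hj
    obtain ⟨n, z₁, hz₁⟩ := nonempty_interior_of_iUnion_of_closed hAc hAu
    have hO : IsOpen (interior (A n) ∩
        (fun z => ψ (mix z y)) ⁻¹' {w | EqOn w (ψ (mix z₁ y)) (Iio n)}) :=
      isOpen_interior.inter ((isOpen_eqOn_Iio _ n).preimage (hψ.comp (hmix1 y)))
    obtain ⟨L, hL⟩ := exists_eqOn_Iio_subset hO ⟨hz₁, fun _ _ => rfl⟩
    refine ⟨((Finset.range L).filter fun j => z₁ j = true, L), fun z z' hz hz' => ?_⟩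
    have hbz : ∀ z : ℕ → Bool,
        EqOn z (b ((Finset.range L).filter fun j => z₁ j = true)) (Iio L) → EqOn z z₁ (Iio L) := by
      intro z hz j hj
      have := hz hj
      simpa [b, show j < L from hj] using this
    obtain ⟨h1, h2⟩ := hL z (hbz z hz)
    obtain ⟨h1', h2'⟩ := hL z' (hbz z' hz')
    have hsub : {m | ψ (mix z y) m ≠ ψ (mix z' y) m} ⊆
        {m | ψ (mix z y) m ≠ ψ (mix z' y) m} ∩ Ici n := by
      refine fun m hm => ⟨hm, ?_⟩
      by_contra hmn
      have hmn' : m ∈ Iio n := lt_of_not_ge (mt mem_Ici.2 hmn)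
      exact hm ((h2 hmn').trans (h2' hmn').symm)
    refine (hφ.mono hsub).trans ((hφ.diff_le_add _ _ (ψ (mix x₀ y)) _).trans ?_)
    rw [← ENNReal.add_halves ε]
    refine add_le_add (show z ∈ A n from interior_subset h1) ?_
    have h3 : φ ({m | ψ (mix z' y) m ≠ ψ (mix x₀ y) m} ∩ Ici n) ≤ ε / 2 :=
      show z' ∈ A n from interior_subset h1'
    simpa only [ne_comm] using h3
  let E : Finset ℕ × ℕ → Set (ℕ → Bool) := fun p => {y | ∀ z z', EqOn z (b p.1) (Iio p.2) →
      EqOn z' (b p.1) (Iio p.2) → φ {m | ψ (mix z y) m ≠ ψ (mix z' y) m} ≤ ε}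
  have hEc : ∀ p, IsClosed (E p) := by
    intro p
    simp only [E, Set.ofPred_forall]
    refine isClosed_iInter fun z => isClosed_iInter fun z' => isClosed_iInter fun _ =>
      isClosed_iInter fun _ => ?_
    have := hφ.isClosed_diff_le (hψ.comp (hmix2 z)) (hψ.comp (hmix2 z')) 0 ε
    simpa using this
  obtain ⟨⟨Q, L⟩, y₀, hy₀⟩ := nonempty_interior_of_iUnion_of_closed hEc
    (eq_univ_of_forall fun y => mem_iUnion.2 (step y))
  obtain ⟨M, hM⟩ := exists_eqOn_Iio_subset isOpen_interior hy₀
  obtain ⟨j, hjR, hj, hjk⟩ := hR (max L N)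
  have hjL : L ≤ j := (le_max_left _ _).trans hj
  have hjN : N ≤ j := (le_max_right _ _).trans hj
  let u := mix (b Q) y₀
  refine ⟨u, hN u fun i hi => if_pos hi, mem_iUnion₂.2 ⟨j, ⟨hjR, hjk⟩, ?_⟩⟩
  refine mem_interior.2 ⟨_, fun x hx => ?_, isOpen_eqOn_Iio u (max N (max L M)), fun _ _ => rfl⟩
  have hxu : ∀ i, i < N ∨ i < L ∨ i < M → x i = u i := fun i hi => hx (by simp; tauto)
  let z : ℕ → Bool := fun i => if N ≤ i ∧ col i = k then x i else b Q i
  let y : ℕ → Bool := fun i => if N ≤ i ∧ col i ≠ k then x i else y₀ i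
  have hxz : mix z y = x := by
    ext i
    by_cases hi : i < N
    · simp [mix, hi, hxu i (Or.inl hi), u]
    · by_cases hk : col i = k <;> simp [mix, hi, hk, z, y, not_lt.1 hi]
  have hxz' : mix (flipBits {j} z) y = flipBits {j} x := by
    rw [← hxz]
    ext i
    by_cases hij : i = j
    · subst hij
      rw [flipBits_of_mem (mem_singleton i)]
      simp [mix, not_lt.2 hjN, hjk, flipBits_of_mem]
    · rw [flipBits_of_notMem (by simpa using hij)]
      simp only [mix, flipBits_of_notMem (F := {j}) (n := i) (by simpa using hij)]
  have hz : EqOn z (b Q) (Iio L) := by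
    intro i hi
    by_cases h : N ≤ i ∧ col i = k
    · simp [z, h, hxu i (Or.inr (Or.inl hi)), u, mix, not_lt.2 h.1]
    · simp [z, h]
  have hy : EqOn y y₀ (Iio M) := by
    intro i hi
    by_cases h : N ≤ i ∧ col i ≠ k
    · simp [y, h, hxu i (Or.inr (Or.inr hi)), u, mix, not_lt.2 h.1]
    · simp only [y, if_neg h]
  have := interior_subset (hM y hy) z (flipBits {j} z) hz fun i hi => by
    rw [flipBits_of_notMem (by simp; rintro rfl; exact absurd hi (not_lt.2 hjL)), hz hi]
  rwa [hxz, hxz'] at this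

/-- There is no continuous map under which changing finitely many columns is negligible modulo
`Exh φ` while changing infinitely many columns on `R` is not. -/
theorem not_column_reduction (hφ : IsLSCSubmeasure φ) {ψ : (ℕ → Bool) → ℕ → Bool}
    (hψ : Continuous ψ) {col : ℕ → ℕ} {R : Set ℕ}
    (hfin : ∀ x y, (col '' {j | x j ≠ y j}).Finite →
      ∀ ε > 0, ∃ n, φ ({m | ψ x m ≠ ψ y m} ∩ Ici n) ≤ ε)
    (hR : ∀ k N, ∃ j ∈ R, N ≤ j ∧ col j = k) :
    ∃ x y, (col '' {j | j ∈ R ∧ x j ≠ y j}).Infinite ∧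
      ∀ ε > 0, ∃ n, φ ({m | ψ x m ≠ ψ y m} ∩ Ici n) ≤ ε := by
  classical
  obtain ⟨δ, hδ, hδs⟩ := ENNReal.exists_pos_tsum_mul_lt_of_countable
    (ι := ℕ) (ε := 1) one_ne_zero (fun _ => 1) (by simp)
  have hδ' : ∑' i, (δ i : ENNReal) ≠ ⊤ := by
    simp only [one_mul] at hδs
    exact (hδs.trans ENNReal.one_lt_top).ne
  let O : ℕ → Set (ℕ → Bool) := fun k => ⋃ j ∈ {j | j ∈ R ∧ col j = k},
    interior {x | φ {m | ψ x m ≠ ψ (flipBits {j} x) m} ≤ δ k}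
  have hOres : ∀ k, O k ∈ residual (ℕ → Bool) := by
    refine fun k => residual_of_dense_open
      (isOpen_biUnion fun _ _ => isOpen_interior) ?_
    refine hφ.dense_iUnion_interior_flipBits hψ (fun x y hxy => hfin x y ?_) (hR k)
      (by exact_mod_cast hδ k)
    refine (finite_singleton k).subset ?_
    rintro _ ⟨j, hj, rfl⟩
    exact hxy j hj
  have hall : ∀ᶠ x in residual (ℕ → Bool), ∀ (k : ℕ) (F : Finset ℕ), flipBits F x ∈ O k :=
    eventually_countable_forall.2 fun k => eventually_countable_forall.2 fun F =>
      flipBits_preimage_mem_residual _ (hOres k)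
  obtain ⟨x, hx⟩ := (dense_of_mem_residual hall).nonempty
  have hstep : ∀ k (F : Finset ℕ), ∃ j, j ∈ R ∧ col j = k ∧
      φ {m | ψ (flipBits F x) m ≠ ψ (flipBits {j} (flipBits F x)) m} ≤ δ k := by
    intro k F
    obtain ⟨j, hj, h⟩ := mem_iUnion₂.1 (hx k F)
    have h' : flipBits F x ∈ {x | φ {m | ψ x m ≠ ψ (flipBits {j} x) m} ≤ δ k} := interior_subset h
    exact ⟨j, hj.1, hj.2, h'⟩
  choose J hJR hJcol hJ using hstep
  obtain ⟨F, hF0, hF⟩ : ∃ F : ℕ → Finset ℕ, F 0 = ∅ ∧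
      ∀ k, F (k + 1) = insert (J k (F k)) (F k) :=
    ⟨fun k => Nat.rec ∅ (fun k F => insert (J k F) F) k, rfl, fun k => rfl⟩
  have hFmem : ∀ k i, i ∈ F k ↔ ∃ l < k, i = J l (F l) := by
    intro k i
    induction k with
    | zero => simp [hF0]
    | succ k ih =>
      rw [hF, Finset.mem_insert, ih]
      constructor
      · rintro (h | ⟨l, hl, h⟩)
        exacts [⟨k, by omega, h⟩, ⟨l, by omega, h⟩]
      · rintro ⟨l, hl, h⟩
        rcases Nat.lt_succ_iff_lt_or_eq.1 hl with h' | rfl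
        exacts [Or.inr ⟨l, h', h⟩, Or.inl h]
  let S : Set ℕ := range fun k => J k (F k)
  have hsucc : ∀ k : ℕ, flipBits {J k (F k)} (flipBits (F k : Set ℕ) x) =
      flipBits (F (k + 1) : Set ℕ) x := by
    intro k
    have hnot : J k (F k) ∉ F k := by
      rw [hFmem]
      rintro ⟨l, hl, h⟩
      have := congrArg col h
      rw [hJcol, hJcol] at this
      omega
    ext i
    by_cases hi : i = J k (F k)
    · subst hi
      rw [flipBits_of_mem (mem_singleton _),
        flipBits_of_notMem (F := F k) (by simpa using hnot),
        flipBits_of_mem (F := F (k + 1)) (by simp [hF])]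
    · rw [flipBits_of_notMem (F := {J k (F k)}) (by simpa using hi)]
      by_cases hiF : i ∈ F k
      · rw [flipBits_of_mem (by simpa using hiF), flipBits_of_mem (by simp [hF, hiF])]
      · rw [flipBits_of_notMem (by simpa using hiF), flipBits_of_notMem (by simp [hF, hi, hiF])]
  have hlim : Tendsto (fun k => flipBits (F k : Set ℕ) x) atTop (𝓝 (flipBits S x)) := by
    refine tendsto_pi_nhds.2 fun i => tendsto_const_nhds.congr' ?_
    by_cases hi : i ∈ S
    · obtain ⟨l, rfl⟩ := hi
      filter_upwards [eventually_gt_atTop l] with k hk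
      have hl : J l (F l) ∈ S := mem_range_self l
      rw [flipBits_of_mem hl, flipBits_of_mem (by simpa using (hFmem _ _).2 ⟨l, hk, rfl⟩)]
    · refine Eventually.of_forall fun k => ?_
      dsimp only
      rw [flipBits_of_notMem hi, flipBits_of_notMem]
      intro h
      obtain ⟨l, -, rfl⟩ := (hFmem _ _).1 (by simpa using h)
      exact hi ⟨l, rfl⟩
  have htail : ∀ n, φ {m | ψ (flipBits (F n : Set ℕ) x) m ≠ ψ (flipBits S x) m} ≤
      ∑' k, (δ (k + n) : ENNReal) := by
    intro n
    refine (hφ.mono ?_).trans ((hφ.iUnion_le_tsum fun k =>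
      {m | ψ (flipBits (F (k + n) : Set ℕ) x) m ≠ ψ (flipBits (F (k + n + 1) : Set ℕ) x) m}).trans
      (ENNReal.tsum_le_tsum fun k => ?_))
    · intro m hm
      by_contra hnot
      simp only [mem_iUnion, mem_ofPred_eq, not_exists, not_not] at hnot
      have hconst : ∀ k, ψ (flipBits (F (k + n) : Set ℕ) x) m = ψ (flipBits (F n : Set ℕ) x) m := by
        intro k
        induction k with
        | zero => simp
        | succ k ih => rw [← ih, hnot k, Nat.add_right_comm]
      have ht : Tendsto (fun k => ψ (flipBits (F k : Set ℕ) x) m) atTop (𝓝 (ψ (flipBits S x) m)) :=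
        (((continuous_apply m).comp hψ).tendsto _).comp hlim
      have := (tendsto_add_atTop_iff_nat n).2 ht
      simp only [hconst] at this
      exact hm (tendsto_nhds_unique tendsto_const_nhds this)
    · have := hJ (k + n) (F (k + n))
      rwa [hsucc] at this
  refine ⟨x, flipBits S x, ?_, fun ε hε => ?_⟩
  · refine infinite_univ.mono fun k _ => ⟨J k (F k), ⟨hJR _ _, ?_⟩, hJcol _ _⟩
    rw [flipBits_of_mem (mem_range_self (f := fun k => J k (F k)) k)]
    simp
  · have hε2 : 0 < ε / 2 := ENNReal.half_pos hε.ne'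
    obtain ⟨n, hn⟩ := ((ENNReal.tendsto_nhds_zero.1
      (ENNReal.tendsto_sum_nat_add (fun i => (δ i : ENNReal)) hδ')) _ hε2).exists
    obtain ⟨N, hN⟩ := hfin x (flipBits (F n : Set ℕ) x)
      (((F n).finite_toSet.image col).subset (image_mono fun j hj => by
        by_contra h
        exact hj (flipBits_of_notMem h x).symm)) _ hε2
    refine ⟨N, (hφ.diff_le_add _ _ (ψ (flipBits (F n : Set ℕ) x)) _).trans ?_⟩
    rw [← ENNReal.add_halves ε]
    exact add_le_add hN ((hφ.mono inter_subset_left).trans ((htail n).trans hn))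

end IsLSCSubmeasure

theorem not_borelReducible_E1_of_isExh {φ : Set ℕ → ENNReal} (hφ : IsLSCSubmeasure φ)
    {I : Set (ℕ → Bool)} (hI : IsExh φ I) : ¬ BorelReducible E1 (EI I) := by
  classical
  rintro ⟨θ, hθm, hθ⟩
  rw [isExh_iff hφ] at hI
  have hEI : ∀ x y, EI I x y ↔ ∀ ε > 0, ∃ n, φ ({m | x m ≠ y m} ∩ Ici n) ≤ ε := by
    intro x y
    have : trueSet (fun n => x n != y n) = {m | x m ≠ y m} := by ext; simp
    rw [EI, hI, this]
  let Φ : (ℕ → Bool) → ℕ → ℕ → Bool := fun x k j => x (Nat.pair k j)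
  have hΦ : Continuous Φ := continuous_pi fun k => continuous_pi fun j => continuous_apply _
  have hm : Measurable (θ ∘ Φ) := by
    have h1 := hΦ.borel_measurable
    have h2 := hθm.comp h1
    rwa [← BorelSpace.measurable_eq (α := ℕ → Bool)] at h2
  obtain ⟨G, hG, hGc⟩ := exists_residual_continuous_comp hm
  obtain ⟨a, p, ha, hag, hap⟩ := exists_pattern_of_mem_residual hG fun n => (n + 1) ^ 2
  let R : Set ℕ := {j | ∃ i, j ∈ Ico (a (2 * i + 1)) (a (2 * i + 2))}
  let e : (ℕ → Bool) → ℕ → Bool := fun x j => if j ∈ R then x j else p j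
  have heR : ∀ x j, j ∈ R → e x j = x j := fun x j hj => if_pos hj
  have heR' : ∀ x j, j ∉ R → e x j = p j := fun x j hj => if_neg hj
  have hec : Continuous e := by
    refine continuous_pi fun j => ?_
    by_cases hj : j ∈ R
    · simpa only [e, if_pos hj] using continuous_apply j
    · simpa only [e, if_neg hj] using continuous_const
  have heG : ∀ x, e x ∈ G := by
    refine fun x => hap _ (frequently_atTop.2 fun N => ⟨2 * N, by omega, fun j hj => heR' _ _ ?_⟩)
    rintro ⟨i, hi⟩
    exact disjoint_left.1 (ha.monotone.pairwise_disjoint_on_Ico_succ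
      (show 2 * N ≠ 2 * i + 1 by omega)) hj hi
  have hψ := hGc e hec heG
  have hE : ∀ x y, EI I ((θ ∘ Φ ∘ e) x) ((θ ∘ Φ ∘ e) y) ↔
      ((fun j => (Nat.unpair j).1) '' {j | e x j ≠ e y j}).Finite := by
    intro x y
    change EI I (θ (Φ (e x))) (θ (Φ (e y))) ↔ _
    rw [← hθ, E1, iff_iff_eq]
    congr 1
    ext k
    simp only [Φ, mem_ofPred_eq, Function.ne_iff, mem_image]
    constructor
    · rintro ⟨j, hj⟩
      exact ⟨Nat.pair k j, hj, by simp⟩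
    · rintro ⟨j, hj, rfl⟩
      exact ⟨j.unpair.2, by simpa using hj⟩
  have hfin : ∀ x y, ((fun j => (Nat.unpair j).1) '' {j | x j ≠ y j}).Finite →
      ∀ ε > 0, ∃ n, φ ({m | (θ ∘ Φ ∘ e) x m ≠ (θ ∘ Φ ∘ e) y m} ∩ Ici n) ≤ ε := by
    intro x y hfin
    refine (hEI _ _).1 ((hE x y).2 (hfin.subset (image_mono fun j hj => ?_)))
    rw [mem_ofPred_eq] at hj ⊢
    contrapose! hj
    by_cases hjR : j ∈ R
    · rw [heR _ _ hjR, heR _ _ hjR, hj]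
    · rw [heR' _ _ hjR, heR' _ _ hjR]
  have hR : ∀ k N, ∃ j ∈ R, N ≤ j ∧ (Nat.unpair j).1 = k := by
    intro k N
    set i := max N (k + 1)
    have hi : i ≤ a (2 * i + 1) := by have := ha.id_le (2 * i + 1); simp at this; omega
    have hN : N ≤ i := le_max_left _ _
    have hk : k + 1 ≤ i := le_max_right _ _
    refine ⟨Nat.pair k (a (2 * i + 1)), ⟨i, Nat.right_le_pair _ _, ?_⟩,
      (hN.trans hi).trans (Nat.right_le_pair _ _), by simp⟩
    refine (Nat.pair_lt_max_add_one_sq _ _).trans_le ?_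
    rw [max_eq_right (by omega)]
    exact hag _
  obtain ⟨x, y, hinf, hxy⟩ := hφ.not_column_reduction (R := R) hψ hfin hR
  refine hinf (((hE x y).1 ((hEI _ _).2 hxy)).subset (image_mono fun j hj => ?_))
  rw [mem_ofPred_eq, heR _ _ hj.1, heR _ _ hj.1]
  exact hj.2

/-! ### A submeasure from a decreasing sequence of hereditary families -/

theorem PseudoMetricSpace.dist_ofPreNNDist_map_le {X : Type*} (d : X → X → NNReal)
    (dist_self : ∀ x, d x x = 0) (dist_comm : ∀ x y, d x y = d y x) (g : X → X)
    (hg : ∀ a b, d (g a) (g b) ≤ d a b) (x y : X) :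
    (PseudoMetricSpace.ofPreNNDist d dist_self dist_comm).dist (g x) (g y) ≤
      (PseudoMetricSpace.ofPreNNDist d dist_self dist_comm).dist x y := by
  change ((⨅ l : List X, ((g x :: l).zipWith d (l ++ [g y])).sum : NNReal) : ℝ) ≤
    ((⨅ l : List X, ((x :: l).zipWith d (l ++ [y])).sum : NNReal) : ℝ)
  rw [NNReal.coe_le_coe]
  refine le_ciInf fun l => (ciInf_le (OrderBot.bddBelow _) (l.map g)).trans ?_
  have : ∀ l₁ l₂ : List X,
      (List.zipWith d (l₁.map g) (l₂.map g)).sum ≤ (List.zipWith d l₁ l₂).sum := by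
    intro l₁
    induction l₁ with
    | nil => simp
    | cons a l₁ ih =>
      intro l₂
      cases l₂ with
      | nil => simp
      | cons b l₂ => simpa using add_le_add (hg a b) (ih l₂)
  simpa using this (x :: l) (l ++ [y])

open Classical in
/-- The gauge of `x` with respect to a sequence of families `V`: `2⁻ⁿ` for the least `n` with
`x ∉ V n`, and `0` if there is no such `n`. -/
noncomputable def familyGauge (V : ℕ → Set (Set ℕ)) (x : Set ℕ) : NNReal :=
  if h : ∃ n, x ∉ V n then (1 / 2) ^ Nat.find h else 0

section Gauge

variable {V : ℕ → Set (Set ℕ)}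

theorem pow_le_gauge_iff (hV : Antitone V) {x : Set ℕ} {n : ℕ} :
    (1 / 2) ^ n ≤ familyGauge V x ↔ x ∉ V n := by
  classical
  have hr : (1 / 2 : NNReal) < 1 := NNReal.half_lt_self one_ne_zero
  rw [familyGauge]
  split_ifs with h
  · rw [pow_le_pow_iff_right_of_lt_one₀ (by positivity) hr, Nat.find_le_iff]
    exact ⟨fun ⟨m, hm, hx⟩ hn => hx (hV hm hn), fun hn => ⟨n, le_rfl, hn⟩⟩
  · push Not at h
    simp [h]

theorem gauge_le_of_subset (hher : ∀ n x y, x ⊆ y → y ∈ V n → x ∈ V n) (hV : Antitone V)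
    {x y : Set ℕ} (hxy : x ⊆ y) : familyGauge V x ≤ familyGauge V y := by
  classical
  by_cases h : ∃ n, x ∉ V n
  · have : familyGauge V x = (1 / 2) ^ Nat.find h := by rw [familyGauge, dif_pos h]
    rw [this, pow_le_gauge_iff hV]
    exact fun hy => Nat.find_spec h (hher _ _ _ hxy hy)
  · rw [familyGauge, dif_neg h]
    exact zero_le

theorem gauge_le_two_mul_max (hher : ∀ n x y, x ⊆ y → y ∈ V n → x ∈ V n) (hV : Antitone V)
    (hadd : ∀ n x y z, x ∈ V (n + 1) → y ∈ V (n + 1) → z ∈ V (n + 1) → x ∪ y ∪ z ∈ V n)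
    {w x y z : Set ℕ} (hw : w ⊆ x ∪ y ∪ z) :
    familyGauge V w ≤ 2 * max (familyGauge V x) (max (familyGauge V y) (familyGauge V z)) := by
  classical
  by_cases h : ∃ n, w ∉ V n
  · have hgw : familyGauge V w = (1 / 2) ^ Nat.find h := by rw [familyGauge, dif_pos h]
    by_contra! hlt
    have hpow : (1 / 2 : NNReal) ^ Nat.find h = 2 * (1 / 2) ^ (Nat.find h + 1) := by
      rw [pow_succ, mul_comm, mul_assoc]; norm_num
    rw [hgw, hpow] at hlt
    have hlt' := lt_of_mul_lt_mul_left hlt (zero_le)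
    simp only [max_lt_iff] at hlt'
    have key : ∀ s, familyGauge V s < (1 / 2) ^ (Nat.find h + 1) → s ∈ V (Nat.find h + 1) := by
      intro s hs
      by_contra hn
      exact hs.not_ge ((pow_le_gauge_iff hV).2 hn)
    exact Nat.find_spec h (hher _ _ _ hw
      (hadd _ _ _ _ (key _ hlt'.1) (key _ hlt'.2.1) (key _ hlt'.2.2)))
  · rw [familyGauge, dif_neg h]
    exact zero_le

theorem exists_submeasure_equiv_gauge (hher : ∀ n x y, x ⊆ y → y ∈ V n → x ∈ V n)
    (hV : Antitone V) (hempty : ∀ n, ∅ ∈ V n)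
    (hadd : ∀ n x y z, x ∈ V (n + 1) → y ∈ V (n + 1) → z ∈ V (n + 1) → x ∪ y ∪ z ∈ V n) :
    ∃ ψ : Set ℕ → NNReal, ψ ∅ = 0 ∧ (∀ x y, x ⊆ y → ψ x ≤ ψ y) ∧
      (∀ x y, ψ (x ∪ y) ≤ ψ x + ψ y) ∧ (∀ x, ψ x ≤ familyGauge V x) ∧
      ∀ x, familyGauge V x ≤ 2 * ψ x := by
  have hmono {x y : Set ℕ} (h : x ⊆ y) := gauge_le_of_subset hher hV h
  have h0 : familyGauge V ∅ = 0 := by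
    rw [familyGauge, dif_neg]
    simpa using hempty
  let d : Set ℕ → Set ℕ → NNReal := fun x y => familyGauge V (symmDiff x y)
  have hself : ∀ x, d x x = 0 := fun x => by simpa [d] using h0
  have hcomm : ∀ x y, d x y = d y x := fun x y => by simp only [d, symmDiff_comm]
  let _ := PseudoMetricSpace.ofPreNNDist d hself hcomm
  have hle : ∀ x y : Set ℕ, dist x y ≤ d x y := PseudoMetricSpace.dist_ofPreNNDist_le d hself hcomm
  have hge : ∀ x y : Set ℕ, d x y ≤ 2 * dist x y := by
    refine PseudoMetricSpace.le_two_mul_dist_ofPreNNDist d hself hcomm fun x₁ x₂ x₃ x₄ => ?_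
    refine gauge_le_two_mul_max hher hV hadd fun m hm => ?_
    simp only [mem_union, mem_symmDiff] at hm ⊢
    tauto
  have hmap : ∀ g : Set ℕ → Set ℕ, (∀ a b, symmDiff (g a) (g b) ⊆ symmDiff a b) →
      ∀ x y, dist (g x) (g y) ≤ dist x y := fun g hg =>
    PseudoMetricSpace.dist_ofPreNNDist_map_le d hself hcomm g fun a b => hmono (hg a b)
  have hsymm : ∀ x : Set ℕ, symmDiff ∅ x = x := bot_symmDiff
  refine ⟨fun x => nndist ∅ x, by simp, fun x y hxy => ?_, fun x y => ?_, fun x => ?_, fun x => ?_⟩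
  · have := hmap (· ∩ x) (fun a b m hm => by
      simp only [mem_inter_iff, mem_symmDiff] at hm ⊢; tauto) ∅ y
    rw [← NNReal.coe_le_coe, coe_nndist, coe_nndist]
    simpa [inter_eq_self_of_subset_right hxy] using this
  · have := hmap (· ∪ x) (fun a b m hm => by
      simp only [mem_union, mem_symmDiff] at hm ⊢; tauto) ∅ y
    rw [← NNReal.coe_le_coe, NNReal.coe_add, coe_nndist, coe_nndist, coe_nndist]
    simp only [empty_union, union_comm y x] at this
    exact (dist_triangle _ x _).trans (by gcongr)
  · have := hle ∅ x
    simp only [d, hsymm] at this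
    rw [← NNReal.coe_le_coe, coe_nndist]
    exact this
  · have := hge ∅ x
    simp only [d, hsymm] at this
    rw [← NNReal.coe_le_coe, NNReal.coe_mul, coe_nndist]
    exact this

theorem exists_isLSCSubmeasure_of_families (hher : ∀ n x y, x ⊆ y → y ∈ V n → x ∈ V n)
    (hempty : ∀ n, ∅ ∈ V n)
    (hadd : ∀ n x y z, x ∈ V (n + 1) → y ∈ V (n + 1) → z ∈ V (n + 1) → x ∪ y ∪ z ∈ V n)
    (hclosed : ∀ n x, (∀ N, x ∩ Iio N ∈ V n) → x ∈ V n) :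
    ∃ φ : Set ℕ → ENNReal, IsLSCSubmeasure φ ∧
      (∀ n x, x ∈ V n → φ x ≤ (1 / 2 : NNReal) ^ n) ∧
      ∀ n x, φ x < (1 / 2 : NNReal) ^ (n + 1) → x ∈ V n := by
  have hV : Antitone V := antitone_nat_of_succ_le fun n x hx => by
    simpa using hadd n x ∅ ∅ hx (hempty _) (hempty _)
  obtain ⟨ψ, hψ0, hψm, hψa, hψle, hψge⟩ := exists_submeasure_equiv_gauge hher hV hempty hadd
  have hle : ∀ n x, x ∈ V n → ψ x ≤ (1 / 2) ^ n := fun n x hx => by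
    refine (hψle x).trans (le_of_lt (not_le.1 fun h => ?_))
    exact (pow_le_gauge_iff hV).1 h hx
  have hmono : ∀ x y : Set ℕ, x ⊆ y →
      (⨆ n, (ψ (x ∩ Iio n) : ENNReal)) ≤ ⨆ n, (ψ (y ∩ Iio n) : ENNReal) := fun x y hxy =>
    iSup_mono fun n => ENNReal.coe_le_coe.2 (hψm _ _ (inter_subset_inter_left _ hxy))
  refine ⟨fun x => ⨆ n, (ψ (x ∩ Iio n) : ENNReal), ⟨by simp [hψ0], fun n => ?_, fun x y =>
    hmono _ _ subset_union_left, fun x y => ?_, fun x => ?_⟩, fun n x hx => ?_, fun n x hx => ?_⟩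
  · refine lt_of_le_of_lt (iSup_le fun m => ?_) (ENNReal.coe_lt_top (r := ψ {n}))
    exact ENNReal.coe_le_coe.2 (hψm _ _ inter_subset_left)
  · refine iSup_le fun n => ?_
    rw [union_inter_distrib_right]
    refine (ENNReal.coe_le_coe.2 (hψa _ _)).trans ?_
    rw [ENNReal.coe_add]
    gcongr
    · exact le_iSup (fun n => (ψ (x ∩ Iio n) : ENNReal)) n
    · exact le_iSup (fun n => (ψ (y ∩ Iio n) : ENNReal)) n
  · refine le_antisymm (iSup_mono fun n => ?_) (iSup_le fun n => hmono _ _ inter_subset_left)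
    refine le_trans ?_ (le_iSup _ n)
    rw [inter_assoc, inter_self]
  · refine iSup_le fun m => ?_
    rw [← ENNReal.coe_pow]
    exact ENNReal.coe_le_coe.2 (hle n _ (hher n _ _ inter_subset_left hx))
  · refine hclosed n x fun N => ?_
    by_contra hN
    have h1 := ((pow_le_gauge_iff hV).2 hN).trans (hψge _)
    have h2 : ψ (x ∩ Iio N) < (1 / 2) ^ (n + 1) := by
      rw [← ENNReal.coe_lt_coe, ENNReal.coe_pow]
      exact (le_iSup (fun n => (ψ (x ∩ Iio n) : ENNReal)) N).trans_lt hx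
    have h3 : (1 / 2 : NNReal) ^ n = 2 * (1 / 2) ^ (n + 1) := by
      rw [pow_succ, mul_comm, mul_assoc]; norm_num
    rw [h3] at h1
    exact (le_of_mul_le_mul_left h1 (by norm_num)).not_gt h2

end Gauge

/-! ### Analytic P-ideals are exhaustive ideals -/

/-- `x` with everything below `n` removed. -/
def tailFrom (n : ℕ) (x : ℕ → Bool) : ℕ → Bool := fun m => decide (n ≤ m) && x m

@[simp] theorem tailFrom_eq_true {n m : ℕ} {x : ℕ → Bool} :
    tailFrom n x m = true ↔ n ≤ m ∧ x m = true := by simp [tailFrom]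

theorem cantor_le_iff {x y : ℕ → Bool} : x ≤ y ↔ ∀ m, x m = true → y m = true := by
  simp only [Pi.le_def, Bool.le_iff_imp]

theorem tailFrom_le (n : ℕ) (x : ℕ → Bool) : tailFrom n x ≤ x :=
  cantor_le_iff.2 fun _ h => (tailFrom_eq_true.1 h).2

theorem tailFrom_antitone (x : ℕ → Bool) : Antitone (tailFrom · x) := fun a b hab =>
  cantor_le_iff.2 fun m h => by
    rw [tailFrom_eq_true] at h ⊢
    exact ⟨hab.trans h.1, h.2⟩

theorem continuous_tailFrom (n : ℕ) : Continuous (tailFrom n) := by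
  unfold tailFrom
  fun_prop

/-- `A` almost-covers every member of `I`. -/
def AlmostCofinal (I A : Set (ℕ → Bool)) : Prop :=
  ∀ x ∈ I, ∃ y ∈ A, ∃ n, tailFrom n x ≤ y

theorem AlmostCofinal.mono {I A B : Set (ℕ → Bool)} (h : AlmostCofinal I A) (hAB : A ⊆ B) :
    AlmostCofinal I B := fun x hx => by
  obtain ⟨y, hy, hn⟩ := h x hx
  exact ⟨y, hAB hy, hn⟩

theorem PIdealProperty.exists_almostCofinal {I : Set (ℕ → Bool)} (hP : PIdealProperty I)
    (hne : I.Nonempty) {ι : Type*} [Countable ι] {A : ι → Set (ℕ → Bool)}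
    (hA : AlmostCofinal I (⋃ i, A i)) : ∃ i, AlmostCofinal I (A i) := by
  obtain ⟨x₀, hx₀⟩ := hne
  obtain ⟨y₀, hy₀, -⟩ := hA x₀ hx₀
  obtain ⟨i₀, -⟩ := mem_iUnion.1 hy₀
  have : Nonempty ι := ⟨i₀⟩
  obtain ⟨e, he⟩ := exists_surjective_nat ι
  by_contra! hcon
  simp only [AlmostCofinal, not_forall, exists_prop] at hcon
  choose g hgI hg using hcon
  obtain ⟨x, hx, hgx⟩ := hP (fun k => g (e k)) fun k => hgI _
  obtain ⟨y, hy, n, hn⟩ := hA x hx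
  obtain ⟨i, hi⟩ := mem_iUnion.1 hy
  obtain ⟨k, rfl⟩ := he i
  obtain ⟨N, hN⟩ := (hgx k).bddAbove
  refine hg (e k) ⟨y, hi, max n (N + 1), cantor_le_iff.2 fun m hm => ?_⟩
  rw [tailFrom_eq_true] at hm
  refine cantor_le_iff.1 hn m (tailFrom_eq_true.2 ⟨by omega, ?_⟩)
  by_contra hxm
  have : m ≤ N := hN (show m ∈ {m | _} from ⟨hm.2, by simpa using hxm⟩)
  omega

theorem exists_closed_almostCofinal {I : Set (ℕ → Bool)} (hP : PIdealProperty I)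
    (hne : I.Nonempty) {f : (ℕ → ℕ) → ℕ → Bool} (hf : range f = I) :
    ∃ W : Set (ℕ → ℕ), IsClosed W ∧ W.Nonempty ∧
      ∀ O : Set (ℕ → ℕ), IsOpen O → (O ∩ W).Nonempty → AlmostCofinal I (f '' (O ∩ W)) := by
  let B := TopologicalSpace.countableBasis (ℕ → ℕ)
  have hB : TopologicalSpace.IsTopologicalBasis B := TopologicalSpace.isBasis_countableBasis _
  let B' : Set (Set (ℕ → ℕ)) := {b | b ∈ B ∧ ¬ AlmostCofinal I (f '' b)}
  have hB' : B'.Countable := (TopologicalSpace.countable_countableBasis _).mono fun b hb => hb.1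
  let W : Set (ℕ → ℕ) := (⋃₀ B')ᶜ
  have key : ∀ O : Set (ℕ → ℕ), AlmostCofinal I (f '' O) → AlmostCofinal I (f '' (O ∩ W)) := by
    intro O hO
    have : Countable B' := hB'.to_subtype
    let A : Option B' → Set (ℕ → Bool) := fun o => o.elim (f '' (O ∩ W)) fun b => f '' b.1
    have hA : AlmostCofinal I (⋃ o, A o) := by
      refine hO.mono ?_
      rintro _ ⟨y, hy, rfl⟩
      by_cases hyW : y ∈ W
      · exact mem_iUnion.2 ⟨none, y, ⟨hy, hyW⟩, rfl⟩
      · obtain ⟨b, hb, hyb⟩ := not_not.1 hyW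
        exact mem_iUnion.2 ⟨some ⟨b, hb⟩, y, hyb, rfl⟩
    obtain ⟨o, ho⟩ := hP.exists_almostCofinal hne hA
    cases o with
    | none => exact ho
    | some b => exact (b.2.2 ho).elim
  refine ⟨W, ?_, ?_, fun O hO ⟨w, hwO, hwW⟩ => key O ?_⟩
  · exact (isOpen_sUnion fun b hb => hB.isOpen hb.1).isClosed_compl
  · have huniv : AlmostCofinal I (f '' univ) := by
      rw [image_univ, hf]
      exact fun x hx => ⟨x, hx, 0, tailFrom_le _ _⟩
    obtain ⟨x₀, hx₀⟩ := hne
    obtain ⟨_, ⟨w, hw, -⟩, -⟩ := key _ huniv x₀ hx₀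
    exact ⟨w, hw.2⟩
  · obtain ⟨b, hb, hwb, hbO⟩ := hB.exists_subset_of_mem_open hwO hO
    refine AlmostCofinal.mono ?_ (image_mono hbO)
    by_contra hcon
    exact hwW ⟨b, ⟨hb, hcon⟩, hwb⟩

/-- The points all of whose finite initial segments are covered by some `f y` with `y ∈ O`. -/
def finitelyCovered {Y : Type*} (f : Y → ℕ → Bool) (O : Set Y) : Set (ℕ → Bool) :=
  {a | ∀ n, ∃ y ∈ O, ∀ m < n, a m = true → f y m = true}

/-- A closed hereditary family containing a tail of every member of `I`. -/
structure IsLargeFor (I K : Set (ℕ → Bool)) : Prop where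
  isClosed : IsClosed K
  mem_of_le : ∀ {a b}, a ≤ b → b ∈ K → a ∈ K
  exists_tailFrom_mem : ∀ x ∈ I, ∃ n, tailFrom n x ∈ K

theorem IsLargeFor.univ (I : Set (ℕ → Bool)) : IsLargeFor I univ :=
  ⟨isClosed_univ, fun _ _ => trivial, fun _ _ => ⟨0, trivial⟩⟩

theorem IsLargeFor.inter {I K L : Set (ℕ → Bool)} (hK : IsLargeFor I K) (hL : IsLargeFor I L) :
    IsLargeFor I (K ∩ L) where
  isClosed := hK.isClosed.inter hL.isClosed
  mem_of_le h hb := ⟨hK.mem_of_le h hb.1, hL.mem_of_le h hb.2⟩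
  exists_tailFrom_mem x hx := by
    obtain ⟨n, hn⟩ := hK.exists_tailFrom_mem x hx
    obtain ⟨m, hm⟩ := hL.exists_tailFrom_mem x hx
    exact ⟨max n m, hK.mem_of_le (tailFrom_antitone x (le_max_left _ _)) hn,
      hL.mem_of_le (tailFrom_antitone x (le_max_right _ _)) hm⟩

theorem IsLargeFor.zero_mem {I K : Set (ℕ → Bool)} (hK : IsLargeFor I K) (hne : I.Nonempty) :
    (⊥ : ℕ → Bool) ∈ K := by
  obtain ⟨x, hx⟩ := hne
  obtain ⟨n, hn⟩ := hK.exists_tailFrom_mem x hx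
  exact hK.mem_of_le bot_le hn

theorem isLargeFor_vanishing (I : Set (ℕ → Bool)) (p : ℕ) :
    IsLargeFor I {a | ∀ m < p, a m = false} where
  isClosed := isClosed_setOf_of_locally (n := p) fun x y h hy m hm => (h hm).trans (hy m hm)
  mem_of_le {a b} h hb m hm := by
    have := cantor_le_iff.1 h m
    have hbm : b m = false := hb m hm
    simpa [hbm] using this
  exists_tailFrom_mem x hx := ⟨p, fun m hm => by
    rw [← Bool.not_eq_true, tailFrom_eq_true]
    omega⟩

/-- A closed set contains every point all of whose finite modifications below lie in it. -/
theorem IsClosed.mem_of_forall_eqOn {K : Set (ℕ → Bool)} (hK : IsClosed K) {x : ℕ → Bool}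
    (h : ∀ n, ∃ y ∈ K, EqOn y x (Iio n)) : x ∈ K := by
  by_contra hx
  obtain ⟨n, hn⟩ := exists_eqOn_Iio_subset hK.isOpen_compl hx
  obtain ⟨y, hy, hyx⟩ := h n
  exact hn y hyx hy

section Parametrized

variable {I : Set (ℕ → Bool)} {Y : Type*} {f : Y → ℕ → Bool}

theorem isLargeFor_finitelyCovered {O : Set Y} (hO : AlmostCofinal I (f '' O)) :
    IsLargeFor I (finitelyCovered f O) where
  isClosed := by
    have : finitelyCovered f O =
        ⋂ n, {a | ∃ y ∈ O, ∀ m < n, a m = true → f y m = true} := by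
      ext a
      simp only [finitelyCovered, mem_ofPred_eq, mem_iInter]
    rw [this]
    refine isClosed_iInter fun n => isClosed_setOf_of_locally (n := n) fun a b hab => ?_
    rintro ⟨y, hy, h⟩
    exact ⟨y, hy, fun m hm ham => h m hm ((hab hm).symm.trans ham)⟩
  mem_of_le {a b} h hb n := by
    obtain ⟨y, hy, hn⟩ := hb n
    exact ⟨y, hy, fun m hm ham => hn m hm (cantor_le_iff.1 h m ham)⟩
  exists_tailFrom_mem x hx := by
    obtain ⟨_, ⟨y, hy, rfl⟩, n, hn⟩ := hO x hx
    exact ⟨n, fun k => ⟨y, hy, fun m _ hm => cantor_le_iff.1 hn m hm⟩⟩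

theorem finitelyCovered_mono {O P : Set Y} (h : O ⊆ P) :
    finitelyCovered f O ⊆ finitelyCovered f P := fun a ha n => by
  obtain ⟨y, hy, hn⟩ := ha n
  exact ⟨y, h hy, hn⟩

theorem tailFrom_mem_finitelyCovered_of_le {x : ℕ → Bool} {O : Set Y} {m n : ℕ}
    (h : m ≤ n)
    (hm : tailFrom m x ∈ finitelyCovered f O) :
    tailFrom n x ∈ finitelyCovered f O := fun k => by
  obtain ⟨y, hy, hk⟩ := hm k
  exact ⟨y, hy, fun i hi hn => hk i hi (cantor_le_iff.1 (tailFrom_antitone x h) i hn)⟩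

theorem IsLargeFor.exists_sup_mem [TopologicalSpace Y] [PolishSpace Y] [Nonempty Y]
    {K : Set (ℕ → Bool)}
    (hK : IsLargeFor I K) (hI : IsIdeal I) (hf : Continuous f) (hfI : ∀ y, f y ∈ I)
    (hcof : ∀ O : Set Y, IsOpen O → O.Nonempty → AlmostCofinal I (f '' O)) :
    ∃ L, IsLargeFor I L ∧ ∀ a ∈ L, ∀ b ∈ L, a ⊔ b ∈ K := by
  let V : ℕ → Set (Y × Y) := fun k => {p | tailFrom k (f p.1 ⊔ f p.2) ∉ K}
  have hsup : Continuous fun p : Y × Y => f p.1 ⊔ f p.2 :=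
    continuous_pi fun m =>
      (continuous_of_discreteTopology (f := fun b : Bool × Bool => b.1 ⊔ b.2))
        |>.comp (((continuous_apply m).comp (hf.comp continuous_fst)).prodMk
        ((continuous_apply m).comp (hf.comp continuous_snd)))
  have hVo : ∀ k, IsOpen (V k) := fun k =>
    hK.isClosed.isOpen_compl.preimage ((continuous_tailFrom k).comp hsup)
  have : ∃ k, ¬ Dense (V k) := by
    by_contra! hd
    let _ := TopologicalSpace.upgradeIsCompletelyMetrizable (Y × Y)
    obtain ⟨p, hp⟩ := (dense_iInter_of_isOpen_nat hVo hd).nonempty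
    obtain ⟨n, hn⟩ := hK.exists_tailFrom_mem _ (hI.sup (hfI p.1) (hfI p.2))
    exact mem_iInter.1 hp n hn
  obtain ⟨k, hk⟩ := this
  simp only [dense_iff_inter_open, not_forall] at hk
  obtain ⟨U, hU, ⟨⟨y₀, z₀⟩, h₀⟩, hUV⟩ := hk
  obtain ⟨O, P, hO, hP, hyO, hzP, hOP⟩ := isOpen_prod_iff.1 hU y₀ z₀ h₀
  have hmem : ∀ y ∈ O, ∀ z ∈ P, tailFrom k (f y ⊔ f z) ∈ K := by
    intro y hy z hz
    by_contra hcon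
    exact hUV ⟨(y, z), hOP ⟨hy, hz⟩, hcon⟩
  refine ⟨{a | ∀ m < k, a m = false} ∩ (finitelyCovered f O ∩ finitelyCovered f P),
    (isLargeFor_vanishing I k).inter ((isLargeFor_finitelyCovered (hcof O hO ⟨_, hyO⟩)).inter
      (isLargeFor_finitelyCovered (hcof P hP ⟨_, hzP⟩))), ?_⟩
  rintro a ⟨ha, haO, -⟩ b ⟨hb, -, hbP⟩
  refine hK.isClosed.mem_of_forall_eqOn fun n => ?_
  obtain ⟨y, hy, hay⟩ := haO n
  obtain ⟨z, hz, hbz⟩ := hbP n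
  refine ⟨fun m => decide (m < n) && (a ⊔ b) m, hK.mem_of_le ?_ (hmem y hy z hz), fun m hm => ?_⟩
  · refine cantor_le_iff.2 fun m hm => ?_
    simp only [Pi.sup_apply, Bool.and_eq_true, decide_eq_true_eq, Bool.sup_eq_bor,
      Bool.or_eq_true] at hm
    have hkm : k ≤ m := by
      by_contra! hmk
      have h1 := ha m hmk
      have h2 := hb m hmk
      simp [h1, h2] at hm
    simp only [tailFrom_eq_true, Pi.sup_apply, Bool.sup_eq_bor, Bool.or_eq_true]
    exact ⟨hkm, hm.2.imp (hay m hm.1) (hbz m hm.1)⟩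
  · simp [show m < n from hm]

end Parametrized

theorem exists_mem_closedBall_of_nested {Y : Type*} [MetricSpace Y] [CompleteSpace Y]
    {y : ℕ → Y} {r : ℕ → ℝ} (hr : ∀ i, 0 < r i) (hhalf : ∀ i, r (i + 1) ≤ r i / 2)
    (hsub : ∀ i, Metric.closedBall (y (i + 1)) (r (i + 1)) ⊆ Metric.closedBall (y i) (r i)) :
    ∃ w, ∀ i, w ∈ Metric.closedBall (y i) (r i) := by
  have hanti : Antitone fun i => Metric.closedBall (y i) (r i) := antitone_nat_of_succ_le hsub
  have hgeom : ∀ i, r i ≤ r 0 * (1 / 2) ^ i := by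
    intro i
    induction i with
    | zero => simp
    | succ i ih =>
      rw [pow_succ]
      linarith [hhalf i]
  have hlim : Tendsto (fun i => 2 * (r 0 * (1 / 2 : ℝ) ^ i)) atTop (𝓝 0) := by
    have := (tendsto_pow_atTop_nhds_zero_of_lt_one (r := (1 / 2 : ℝ)) (by norm_num)
      (by norm_num)).const_mul (2 * r 0)
    simpa [mul_assoc] using this
  obtain ⟨w, hw⟩ := Metric.nonempty_iInter_of_nonempty_biInter
    (s := fun i => Metric.closedBall (y i) (r i)) (fun i => Metric.isClosed_closedBall)
    (fun i => Metric.isBounded_closedBall)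
    (fun N => ⟨y N, mem_iInter₂.2 fun i hi => hanti hi (Metric.mem_closedBall_self (hr N).le)⟩)
    (squeeze_zero (fun i => Metric.diam_nonneg) (fun i =>
      (Metric.diam_closedBall (hr i).le).trans (by gcongr; exact hgeom i)) hlim)
  exact ⟨w, mem_iInter.1 hw⟩

/-- A ball in `Y`, together with a bound from which on `x` is finitely covered over that ball. -/
structure CoveringState {Y : Type*} [MetricSpace Y] (f : Y → ℕ → Bool) (x : ℕ → Bool) where
  center : Y
  radius : ℝ
  start : ℕ
  radius_pos : 0 < radius
  mem_finitelyCovered : tailFrom start x ∈ finitelyCovered f (Metric.ball center radius)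

namespace CoveringState

variable {Y : Type*} [MetricSpace Y] {f : Y → ℕ → Bool} {x : ℕ → Bool}

theorem exists_refine (hf : Continuous f)
    (hx : ∀ O : Set Y, IsOpen O → O.Nonempty → ∃ n, tailFrom n x ∈ finitelyCovered f O)
    (s : CoveringState f x) (b : ℕ) :
    ∃ t : CoveringState f x, b < t.start ∧ t.radius ≤ s.radius / 2 ∧
      Metric.closedBall t.center t.radius ⊆ Metric.closedBall s.center s.radius ∧
      ∀ w ∈ Metric.closedBall t.center t.radius, ∀ m, s.start ≤ m → m < b → x m = true →
        f w m = true := by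
  obtain ⟨y, hy, hyb⟩ := s.mem_finitelyCovered b
  have hopen : IsOpen (Metric.ball s.center s.radius ∩ f ⁻¹' {z | EqOn z (f y) (Iio b)}) :=
    Metric.isOpen_ball.inter ((isOpen_eqOn_Iio (f y) b).preimage hf)
  obtain ⟨ε, hε, hball⟩ := Metric.nhds_basis_closedBall.mem_iff.1
    (hopen.mem_nhds ⟨hy, fun _ _ => rfl⟩)
  have hr : 0 < min ε (s.radius / 2) := lt_min hε (half_pos s.radius_pos)
  obtain ⟨n, hn⟩ := hx (Metric.ball y (min ε (s.radius / 2))) Metric.isOpen_ball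
    ⟨y, Metric.mem_ball_self hr⟩
  have hsub : Metric.closedBall y (min ε (s.radius / 2)) ⊆ _ :=
    (Metric.closedBall_subset_closedBall (min_le_left _ _)).trans hball
  refine ⟨⟨y, _, max n (b + 1), hr, tailFrom_mem_finitelyCovered_of_le (le_max_left _ _) hn⟩, ?_,
    min_le_right _ _, fun w hw => Metric.ball_subset_closedBall (hsub hw).1, ?_⟩
  · exact lt_of_lt_of_le (Nat.lt_succ_self b) (le_max_right _ _)
  · intro w hw m hsm hmb hxm
    have : EqOn (f w) (f y) (Iio b) := (hsub hw).2
    rw [this hmb]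
    exact hyb m hmb (tailFrom_eq_true.2 ⟨hsm, hxm⟩)

end CoveringState

theorem mem_of_forall_finitelyCovered {I : Set (ℕ → Bool)} (hI : NontrivialIdeal I) {Y : Type*}
    [TopologicalSpace Y] [PolishSpace Y] [Nonempty Y] {f : Y → ℕ → Bool} (hf : Continuous f)
    (hfI : ∀ y, f y ∈ I) {x : ℕ → Bool}
    (hx : ∀ O : Set Y, IsOpen O → O.Nonempty → ∃ n, tailFrom n x ∈ finitelyCovered f O) :
    x ∈ I := by
  let _ := TopologicalSpace.upgradeIsCompletelyMetrizable Y
  choose next hstart hradius hball hcover using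
    fun s : CoveringState f x => CoveringState.exists_refine hf hx s
  have s₀ : CoveringState f x := by
    have y₀ : Y := Classical.arbitrary Y
    have h := hx (Metric.ball y₀ 1) Metric.isOpen_ball ⟨y₀, Metric.mem_ball_self one_pos⟩
    exact ⟨y₀, 1, h.choose, one_pos, h.choose_spec⟩
  let G : ℕ → CoveringState f x × CoveringState f x := fun i =>
    Nat.rec (s₀, s₀) (fun _ p => (p.2, next p.1 p.2.start)) i
  let s : ℕ → CoveringState f x := fun i => (G i).1
  have hs : ∀ i, s (i + 2) = next (s i) (s (i + 1)).start := fun i => rfl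
  have hlim : ∀ e, ∃ w, ∀ i, w ∈ Metric.closedBall (s (e + 2 * i)).center (s (e + 2 * i)).radius :=
    fun e => by
      refine exists_mem_closedBall_of_nested (y := fun i => (s (e + 2 * i)).center)
        (r := fun i => (s (e + 2 * i)).radius) (fun i => (s _).radius_pos) (fun i => ?_) fun i => ?_
      · change (s (e + 2 * i + 2)).radius ≤ _
        rw [hs]
        exact hradius _ _
      · change Metric.closedBall (s (e + 2 * i + 2)).center (s (e + 2 * i + 2)).radius ⊆ _
        rw [hs]
        exact hball _ _
  choose w hw using hlim
  have hmono : ∀ i, i ≤ (s (i + 1)).start := by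
    intro i
    induction i with
    | zero => exact Nat.zero_le _
    | succ i ih =>
      change i + 1 ≤ (s (i + 2)).start
      rw [hs]
      exact ih.trans_lt (hstart _ _)
  have hle : tailFrom (s 0).start x ≤ f (w 0) ⊔ f (w 1) := by
    refine cantor_le_iff.2 fun m hm => ?_
    rw [tailFrom_eq_true] at hm
    have hex : ∃ i, m < (s (i + 1)).start := ⟨m + 1, (Nat.lt_succ_self m).trans_le (hmono _)⟩
    let i := Nat.find hex
    have hi : m < (s (i + 1)).start := Nat.find_spec hex
    have hi' : (s i).start ≤ m := by
      rcases Nat.eq_zero_or_pos i with h0 | hpos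
      · rw [h0]; exact hm.1
      · have := Nat.find_min hex (Nat.sub_lt hpos one_pos)
        rw [show Nat.find hex - 1 + 1 = i from Nat.sub_add_cancel hpos] at this
        exact not_lt.1 this
    have hcov : ∀ v ∈ Metric.closedBall (s (i + 2)).center (s (i + 2)).radius, f v m = true := by
      intro v hv
      rw [hs] at hv
      exact hcover _ _ v hv m hi' hi hm.2
    simp only [Pi.sup_apply, Bool.sup_eq_bor, Bool.or_eq_true]
    rcases Nat.even_or_odd' i with ⟨j, hj | hj⟩
    · left
      have := hw 0 (j + 1)
      rw [show 0 + 2 * (j + 1) = i + 2 by omega] at this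
      exact hcov _ this
    · right
      have := hw 1 (j + 1)
      rw [show 1 + 2 * (j + 1) = i + 2 by omega] at this
      exact hcov _ this
  have hfin : (fun m => decide (m < (s 0).start) && x m) ∈ I := by
    refine hI.mem_of_finite ((finite_Iio (s 0).start).subset fun m hm => ?_)
    simp only [mem_trueSet, Bool.and_eq_true, decide_eq_true_eq] at hm
    exact hm.1
  refine hI.1.mono (hI.1.sup hfin (hI.1.sup (hfI (w 0)) (hfI (w 1)))) fun m hm => ?_
  rcases lt_or_ge m (s 0).start with h | h
  · simp [h, hm]
  · have := cantor_le_iff.1 hle m (tailFrom_eq_true.2 ⟨h, hm⟩)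
    simp only [Pi.sup_apply, Bool.sup_eq_bor, Bool.or_eq_true] at this ⊢
    exact Or.inr this

theorem exists_families_of_parametrization {I : Set (ℕ → Bool)} (hI : NontrivialIdeal I)
    {Y : Type*} [TopologicalSpace Y] [PolishSpace Y] [Nonempty Y] {f : Y → ℕ → Bool}
    (hf : Continuous f) (hfI : ∀ y, f y ∈ I)
    (hcof : ∀ O : Set Y, IsOpen O → O.Nonempty → AlmostCofinal I (f '' O)) :
    ∃ U : ℕ → Set (ℕ → Bool), (∀ n, IsLargeFor I (U n)) ∧
      (∀ n, ∀ a ∈ U (n + 1), ∀ b ∈ U (n + 1), ∀ c ∈ U (n + 1), a ⊔ b ⊔ c ∈ U n) ∧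
      ∀ x, (∀ n, ∃ m, tailFrom m x ∈ U n) → x ∈ I := by
  have hne : I.Nonempty := ⟨_, hI.1.1⟩
  obtain ⟨B, hBc, hBe, hB⟩ := TopologicalSpace.exists_countable_basis Y
  have hBne : B.Nonempty := by
    obtain ⟨b, hb, -⟩ := hB.exists_subset_of_mem_open (mem_univ (Classical.arbitrary Y)) isOpen_univ
    exact ⟨b, hb⟩
  obtain ⟨O, rfl⟩ := hBc.exists_eq_range hBne
  have hstep : ∀ (n : ℕ) (K : {K : Set (ℕ → Bool) // IsLargeFor I K}),
      ∃ L : {K : Set (ℕ → Bool) // IsLargeFor I K},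
        L.1 ⊆ finitelyCovered f (O n) ∧ ∀ a ∈ L.1, ∀ b ∈ L.1, ∀ c ∈ L.1, a ⊔ b ⊔ c ∈ K.1 := by
    rintro n ⟨K, hK⟩
    obtain ⟨L₁, hL₁, hLK⟩ := hK.exists_sup_mem hI.1 hf hfI hcof
    obtain ⟨L₂, hL₂, hLL⟩ := hL₁.exists_sup_mem hI.1 hf hfI hcof
    have hOn : (O n).Nonempty := nonempty_iff_ne_empty.2 fun h => hBe ⟨n, h⟩
    refine ⟨⟨L₂ ∩ finitelyCovered f (O n), hL₂.inter (isLargeFor_finitelyCovered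
      (hcof _ (hB.isOpen ⟨n, rfl⟩) hOn))⟩, inter_subset_right, fun a ha b hb c hc => ?_⟩
    refine hLK _ (hLL a ha.1 b hb.1) _ ?_
    simpa using hLL c hc.1 ⊥ (hL₂.zero_mem hne)
  choose next hcov hsup using hstep
  let U : ℕ → {K : Set (ℕ → Bool) // IsLargeFor I K} := fun n =>
    Nat.rec ⟨univ, IsLargeFor.univ I⟩ next n
  refine ⟨fun n => (U n).1, fun n => (U n).2, fun n => hsup n (U n), fun x hx => ?_⟩
  refine mem_of_forall_finitelyCovered hI hf hfI fun P hP ⟨y, hy⟩ => ?_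
  obtain ⟨_, ⟨n, rfl⟩, -, hOP⟩ := hB.exists_subset_of_mem_open hy hP
  obtain ⟨m, hm⟩ := hx (n + 1)
  exact ⟨m, finitelyCovered_mono hOP (hcov n (U n) hm)⟩

theorem exists_isExh_of_pIdealProperty {I : Set (ℕ → Bool)} (hI : NontrivialIdeal I)
    (hA : AnalyticSet I) (hP : PIdealProperty I) :
    ∃ φ : Set ℕ → ENNReal, IsLSCSubmeasure φ ∧ IsExh φ I := by
  classical
  have hne : I.Nonempty := ⟨_, hI.1.1⟩
  rw [AnalyticSet] at hA
  obtain ⟨f, hf, hfI⟩ := hA.resolve_left hne.ne_empty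
  obtain ⟨W, hWc, hWne, hW⟩ := exists_closed_almostCofinal hP hne hfI
  have : PolishSpace W := hWc.polishSpace
  have : Nonempty W := hWne.to_subtype
  have hcof : ∀ O : Set W, IsOpen O → O.Nonempty →
      AlmostCofinal I ((fun w : W => f w) '' O) := by
    intro O hO ⟨w, hw⟩
    obtain ⟨P, hP, rfl⟩ := isOpen_induced_iff.1 hO
    refine (hW P hP ⟨w, hw, w.2⟩).mono ?_
    rintro _ ⟨y, ⟨hyP, hyW⟩, rfl⟩
    exact ⟨⟨y, hyW⟩, hyP, rfl⟩
  obtain ⟨U, hU, hsup, hmem⟩ := exists_families_of_parametrization hI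
    (hf.comp continuous_subtype_val) (fun w => hfI ▸ mem_range_self _) hcof
  let χ : Set ℕ → ℕ → Bool := fun s m => decide (m ∈ s)
  have hχ : ∀ {s m}, χ s m = true ↔ m ∈ s := decide_eq_true_iff
  obtain ⟨φ, hφ, hφle, hφlt⟩ := exists_isLSCSubmeasure_of_families (V := fun n => {s | χ s ∈ U n})
    (fun n x y hxy hy => (hU n).mem_of_le (cantor_le_iff.2 fun m hm => hχ.2 (hxy (hχ.1 hm))) hy)
    (fun n => (hU n).mem_of_le (b := ⊥) (cantor_le_iff.2 fun m hm => (hχ.1 hm).elim)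
      ((hU n).zero_mem hne))
    (fun n x y z hx hy hz => (hU n).mem_of_le (cantor_le_iff.2 fun m hm => by
      rw [hχ] at hm
      simpa only [Pi.sup_apply, Bool.sup_eq_bor, Bool.or_eq_true, hχ, mem_union] using hm)
      (hsup n _ hx _ hy _ hz))
    (fun n x hx => (hU n).isClosed.mem_of_forall_eqOn fun N => ⟨_, hx N, fun m hm => by
      have hm' : m < N := hm
      simp [χ, hm']⟩)
  have hχt : ∀ x m, χ (trueSet x ∩ Ici m) = tailFrom m x := fun x m => by
    ext k
    rw [Bool.eq_iff_iff, hχ, tailFrom_eq_true, and_comm]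
    rfl
  refine ⟨φ, hφ, (isExh_iff hφ).2 fun x => ⟨fun hx ε hε => ?_, fun h => hmem x fun n => ?_⟩⟩
  · have hlim : Tendsto (fun n => ((1 / 2 : NNReal) : ENNReal) ^ n) atTop (𝓝 0) :=
      ENNReal.tendsto_pow_atTop_nhds_zero_of_lt_one
        (by exact_mod_cast NNReal.half_lt_self one_ne_zero)
    obtain ⟨n, hn⟩ := (hlim.eventually (gt_mem_nhds hε)).exists
    obtain ⟨m, hm⟩ := (hU n).exists_tailFrom_mem x hx
    refine ⟨m, (hφle n _ ?_).trans hn.le⟩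
    rwa [mem_ofPred_eq, hχt]
  · have hpos : (0 : ENNReal) < ((1 / 2 : NNReal) : ENNReal) ^ (n + 2) :=
      ENNReal.pow_pos (by simp) _
    obtain ⟨m, hm⟩ := h _ hpos
    refine ⟨m, ?_⟩
    rw [← hχt]
    refine hφlt n _ (hm.trans_lt ?_)
    exact_mod_cast pow_lt_pow_right_of_lt_one₀ (by norm_num : (0 : NNReal) < 1 / 2)
      (NNReal.half_lt_self one_ne_zero) (Nat.lt_succ_self (n + 1))

end AnalyticPIdeals

/-- Solecki; Kechris–Louveau: for a nontrivial ideal `I` on `ℕ`, the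
following are equivalent: (1) `I = Exh_φ` for some lsc submeasure `φ`;
(2) `I` is an analytic P-ideal; (3) `I` is analytic and `E₁` is not Borel
reducible to `E_I`. -/
theorem solecki_characterization (I : Set (ℕ → Bool)) (hI : NontrivialIdeal I) :
    ((∃ φ : Set ℕ → ENNReal, IsLSCSubmeasure φ ∧ IsExh φ I) ↔
      (AnalyticSet I ∧ PIdealProperty I)) ∧
    ((AnalyticSet I ∧ PIdealProperty I) ↔
      (AnalyticSet I ∧ ¬ BorelReducible E1 (EI I))) := by
  have h₁₂ : (∃ φ : Set ℕ → ENNReal, IsLSCSubmeasure φ ∧ IsExh φ I) ↔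
      (AnalyticSet I ∧ PIdealProperty I) :=
    ⟨fun ⟨_, hφ, h⟩ => ⟨analyticSet_of_isExh hφ h, pIdealProperty_of_isExh hφ h⟩,
      fun ⟨hA, hP⟩ => exists_isExh_of_pIdealProperty hI hA hP⟩
  refine ⟨h₁₂, fun h => ⟨h.1, ?_⟩, fun ⟨hA, h⟩ => ⟨hA, ?_⟩⟩
  · obtain ⟨φ, hφ, hE⟩ := h₁₂.2 h
    exact not_borelReducible_E1_of_isExh hφ hE
  · by_contra hP
    exact h (borelReducible_E1_of_not_pIdeal hI hA hP)
end

section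
/- For all real numbers p, q with 1 ≤ p < q: the equivalence relation ℓp is Borel reducible to ℓq, but ℓq is not Borel reducible to ℓp. -/
/-- The `ℓp` equivalence relation on `ℝ^ℕ`: `x ∼ y` iff `∑ₙ |x n − y n| ^ p < ∞`. -/
def lpRel (p : ℝ) (x y : ℕ → ℝ) : Prop :=
  Summable (fun n : ℕ => |x n - y n| ^ p)

open Filter Topology Set
open scoped ENNReal

/-- The extended-real sum `∑ₙ |v n| ^ p`. -/
noncomputable def lpSum {ι : Type*} (p : ℝ) (v : ι → ℝ) : ℝ≥0∞ :=
  ∑' n, ‖v n‖ₑ ^ p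

lemma enorm_rpow_eq_ofReal {p : ℝ} (hp : 0 ≤ p) (a : ℝ) :
    ‖a‖ₑ ^ p = ENNReal.ofReal (|a| ^ p) := by
  rw [Real.enorm_eq_ofReal_abs, ENNReal.ofReal_rpow_of_nonneg (abs_nonneg a) hp]

lemma summable_abs_rpow_iff {ι : Type*} {p : ℝ} (hp : 0 ≤ p) (v : ι → ℝ) :
    Summable (fun n => |v n| ^ p) ↔ lpSum p v ≠ ∞ := by
  simp only [lpSum, enorm_rpow_eq_ofReal hp]
  refine ⟨fun h => h.tsum_ofReal_ne_top, fun h => ?_⟩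
  refine (ENNReal.summable_toReal h).congr fun n => ?_
  exact ENNReal.toReal_ofReal (by positivity)

lemma lpRel_iff {p : ℝ} (hp : 0 ≤ p) (x y : ℕ → ℝ) :
    lpRel p x y ↔ lpSum p (x - y) ≠ ∞ :=
  summable_abs_rpow_iff hp (x - y)

lemma lpSum_neg {ι : Type*} (p : ℝ) (v : ι → ℝ) : lpSum p (-v) = lpSum p v := by
  simp [lpSum]

/-- The coordinates of an embedding of `ℝ`, with the snowflake metric `|s - t| ^ (p / q)`, into
the space of families indexed by `ℤ × Bool` with the `ℓq` metric. -/
noncomputable def snowflake (p q : ℝ) (i : ℤ × Bool) (t : ℝ) : ℝ :=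
  2 ^ (-((i.1 : ℝ) * p / q)) *
    cond i.2 (Real.cos (2 ^ (i.1 : ℝ) * t)) (Real.sin (2 ^ (i.1 : ℝ) * t))

lemma continuous_snowflake (p q : ℝ) (i : ℤ × Bool) : Continuous (snowflake p q i) := by
  obtain ⟨j, b⟩ := i
  unfold snowflake
  cases b <;> dsimp only [cond] <;> fun_prop

lemma abs_snowflake_sub_rpow {p q : ℝ} (hq : 0 < q) (j : ℤ) (b : Bool) (s t : ℝ) :
    |snowflake p q (j, b) s - snowflake p q (j, b) t| ^ q = 2 ^ (-((j : ℝ) * p)) *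
      |cond b (Real.cos (2 ^ (j : ℝ) * s)) (Real.sin (2 ^ (j : ℝ) * s)) -
        cond b (Real.cos (2 ^ (j : ℝ) * t)) (Real.sin (2 ^ (j : ℝ) * t))| ^ q := by
  rw [snowflake, snowflake, ← mul_sub, abs_mul, Real.mul_rpow (abs_nonneg _) (abs_nonneg _),
    abs_of_pos (by positivity), ← Real.rpow_mul (by norm_num)]
  congr 2
  field_simp

lemma abs_cond_cos_sin_sub_le (b : Bool) (s t : ℝ) :
    |cond b (Real.cos s) (Real.sin s) - cond b (Real.cos t) (Real.sin t)| ≤ min 2 |s - t| := by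
  refine le_min ?_ ?_
  · cases b
    · have h1 := Real.abs_sin_le_one s
      have h2 := Real.abs_sin_le_one t
      exact (abs_sub _ _).trans (by simp only [cond_false]; linarith)
    · have h1 := Real.abs_cos_le_one s
      have h2 := Real.abs_cos_le_one t
      exact (abs_sub _ _).trans (by simp only [cond_true]; linarith)
  · cases b
    · simpa [Real.dist_eq] using Real.lipschitzWith_sin.dist_le_mul s t
    · simpa [Real.dist_eq] using Real.lipschitzWith_cos.dist_le_mul s t

lemma exists_half_le_abs_cond_cos_sin_sub {s t : ℝ} (h1 : 1 ≤ |s - t|) (h2 : |s - t| < 2) :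
    ∃ b : Bool, 1 / 2 ≤
      |cond b (Real.cos s) (Real.sin s) - cond b (Real.cos t) (Real.sin t)| := by
  by_contra! h
  have hs := h false
  have hc := h true
  simp only [cond_true, cond_false] at hs hc
  have hs2 := sq_lt_sq' (by linarith [abs_nonneg (Real.sin s - Real.sin t)]) hs
  have hc2 := sq_lt_sq' (by linarith [abs_nonneg (Real.cos s - Real.cos t)]) hc
  rw [sq_abs] at hs2 hc2
  have key : (Real.cos s - Real.cos t) ^ 2 + (Real.sin s - Real.sin t) ^ 2
      = 4 * Real.sin (|s - t| / 2) ^ 2 := by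
    have e : Real.cos (s - t) = 1 - 2 * Real.sin (|s - t| / 2) ^ 2 := by
      rw [← Real.cos_abs]
      have := Real.cos_two_mul (|s - t| / 2)
      have h3 := Real.cos_sq_add_sin_sq (|s - t| / 2)
      rw [show 2 * (|s - t| / 2) = |s - t| by ring] at this
      linarith
    rw [Real.cos_sub] at e
    nlinarith [Real.cos_sq_add_sin_sq s, Real.cos_sq_add_sin_sq t]
  have hsin : 3 / 8 ≤ Real.sin (|s - t| / 2) := by
    have h3 := Real.sin_gt_sub_cube (x := |s - t| / 2) (by linarith)
    nlinarith [mul_nonneg (sub_nonneg.2 h1) (sub_nonneg.2 h2.le), sq_nonneg (|s - t|)]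
  nlinarith

lemma summable_two_rpow_mul_min {p q : ℝ} (hp : 0 < p) (hpq : p < q) :
    Summable fun i : ℤ => (2 : ℝ) ^ (-((i : ℝ) * p)) * min 1 ((2 : ℝ) ^ (i : ℝ)) ^ q := by
  have geom : ∀ r : ℝ, 0 < r → Summable fun n : ℕ => ((2 : ℝ) ^ (-r)) ^ n := fun r hr =>
    summable_geometric_of_lt_one (by positivity)
      (Real.rpow_lt_one_of_one_lt_of_neg (by norm_num) (by linarith))
  rw [summable_int_iff_summable_nat_and_neg]
  constructor
  · refine (geom p hp).congr fun n => ?_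
    have : (1 : ℝ) ≤ 2 ^ (n : ℝ) := Real.one_le_rpow (by norm_num) (by positivity)
    rw [← Real.rpow_natCast, ← Real.rpow_mul (by norm_num)]
    simp only [Int.cast_natCast]
    rw [min_eq_left this, Real.one_rpow, mul_one]
    congr 1
    ring
  · refine (geom (q - p) (by linarith)).congr fun n => ?_
    have : (2 : ℝ) ^ (-(n : ℝ)) ≤ 1 :=
      Real.rpow_le_one_of_one_le_of_nonpos (by norm_num) (by simp)
    rw [← Real.rpow_natCast, ← Real.rpow_mul (by norm_num)]
    simp only [Int.cast_neg, Int.cast_natCast]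
    rw [min_eq_right this, ← Real.rpow_mul (by norm_num), ← Real.rpow_add (by norm_num)]
    congr 1
    ring

lemma exists_two_rpow_le_lt {d : ℝ} (hd : 0 < d) :
    ∃ k : ℤ, (2 : ℝ) ^ (k : ℝ) ≤ d ∧ d < 2 * 2 ^ (k : ℝ) := by
  obtain ⟨k, hk1, hk2⟩ := exists_mem_Ico_zpow hd (one_lt_two : (1 : ℝ) < 2)
  refine ⟨k, by rwa [Real.rpow_intCast], ?_⟩
  rwa [Real.rpow_intCast, mul_comm, ← zpow_add_one₀ (by norm_num)]

lemma exists_lpSum_snowflake_le {p q : ℝ} (hp : 0 < p) (hpq : p < q) :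
    ∃ C : ℝ≥0∞, C ≠ ∞ ∧ ∀ s t : ℝ,
      lpSum q (fun i => snowflake p q i s - snowflake p q i t) ≤ C * ‖s - t‖ₑ ^ p := by
  have hq : 0 < q := hp.trans hpq
  set K : ℤ → ℝ := fun i => (2 : ℝ) ^ (-((i : ℝ) * p)) * min 1 ((2 : ℝ) ^ (i : ℝ)) ^ q with hK
  have hK0 : ∀ i, 0 ≤ K i := fun i => by positivity
  have hKs := (summable_two_rpow_mul_min hp hpq).tsum_ofReal_ne_top
  refine ⟨ENNReal.ofReal (2 ^ q) * (2 * ∑' i, ENNReal.ofReal (K i)),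
    ENNReal.mul_ne_top ENNReal.ofReal_ne_top (ENNReal.mul_ne_top (by norm_num) hKs),
    fun s t => ?_⟩
  rcases eq_or_ne s t with rfl | hst
  · simp [lpSum, hq, hp]
  obtain ⟨k, hk1, hk2⟩ := exists_two_rpow_le_lt (abs_pos.2 (sub_ne_zero.2 hst))
  have bound : ∀ (j : ℤ) (b : Bool), ‖snowflake p q (j, b) s - snowflake p q (j, b) t‖ₑ ^ q ≤
      ENNReal.ofReal (2 ^ q) * ‖s - t‖ₑ ^ p * ENNReal.ofReal (K (j + k)) := by
    intro j b
    rw [enorm_rpow_eq_ofReal hq.le, enorm_rpow_eq_ofReal hp.le,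
      ← ENNReal.ofReal_mul (by positivity), ← ENNReal.ofReal_mul (by positivity)]
    refine ENNReal.ofReal_le_ofReal ?_
    rw [abs_snowflake_sub_rpow hq]
    have h1 : |cond b (Real.cos (2 ^ (j : ℝ) * s)) (Real.sin (2 ^ (j : ℝ) * s)) -
        cond b (Real.cos (2 ^ (j : ℝ) * t)) (Real.sin (2 ^ (j : ℝ) * t))|
        ≤ 2 * min 1 (2 ^ ((j + k : ℤ) : ℝ)) := by
      refine (abs_cond_cos_sin_sub_le b _ _).trans ?_
      rw [← mul_sub, abs_mul, abs_of_pos (by positivity : (0 : ℝ) < 2 ^ (j : ℝ)),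
        mul_min_of_nonneg _ _ (by norm_num)]
      refine min_le_min (by norm_num) ?_
      push_cast
      rw [Real.rpow_add (by norm_num)]
      nlinarith [Real.rpow_pos_of_pos (zero_lt_two' ℝ) (j : ℝ)]
    have h2 : (2 : ℝ) ^ (-((j : ℝ) * p)) = ((2 : ℝ) ^ (k : ℝ)) ^ p *
        2 ^ (-(((j + k : ℤ) : ℝ) * p)) := by
      rw [← Real.rpow_mul (by norm_num), ← Real.rpow_add (by norm_num)]
      congr 1
      push_cast
      ring
    calc _ ≤ (2 : ℝ) ^ (-((j : ℝ) * p)) * (2 * min 1 (2 ^ ((j + k : ℤ) : ℝ))) ^ q := by gcongr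
      _ = 2 ^ q * ((2 : ℝ) ^ (k : ℝ)) ^ p * K (j + k) := by
        rw [h2, Real.mul_rpow (by norm_num) (by positivity), hK]
        ring
      _ ≤ 2 ^ q * |s - t| ^ p * K (j + k) := by
        have := hK0 (j + k)
        gcongr
  calc lpSum q (fun i => snowflake p q i s - snowflake p q i t)
      = ∑' (j : ℤ) (b : Bool), ‖snowflake p q (j, b) s - snowflake p q (j, b) t‖ₑ ^ q :=
        ENNReal.tsum_prod (f := fun (j : ℤ) (b : Bool) =>
          ‖snowflake p q (j, b) s - snowflake p q (j, b) t‖ₑ ^ q)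
    _ ≤ ∑' (j : ℤ) (_ : Bool),
        ENNReal.ofReal (2 ^ q) * ‖s - t‖ₑ ^ p * ENNReal.ofReal (K (j + k)) := by
        gcongr with j b
        exact bound j b
    _ = ENNReal.ofReal (2 ^ q) * (2 * ∑' i, ENNReal.ofReal (K i)) * ‖s - t‖ₑ ^ p := by
        simp only [tsum_bool, ← two_mul, ENNReal.tsum_mul_left]
        have shift := (Equiv.addRight k).tsum_eq (fun i => ENNReal.ofReal (K i))
        simp only [Equiv.coe_addRight] at shift
        rw [shift]
        ring

lemma exists_le_lpSum_snowflake {p q : ℝ} (hp : 0 < p) (hpq : p < q) :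
    ∃ c : ℝ≥0∞, c ≠ 0 ∧ ∀ s t : ℝ,
      c * ‖s - t‖ₑ ^ p ≤ lpSum q (fun i => snowflake p q i s - snowflake p q i t) := by
  have hq : 0 < q := hp.trans hpq
  refine ⟨ENNReal.ofReal ((1 / 2) ^ p * (1 / 2) ^ q), ?_, fun s t => ?_⟩
  · rw [Ne, ENNReal.ofReal_eq_zero, not_le]
    positivity
  rcases eq_or_ne s t with rfl | hst
  · simp [hp]
  obtain ⟨k, hk1, hk2⟩ := exists_two_rpow_le_lt (abs_pos.2 (sub_ne_zero.2 hst))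
  have hkpos : (0 : ℝ) < 2 ^ (k : ℝ) := by positivity
  have hd : |2 ^ ((-k : ℤ) : ℝ) * s - 2 ^ ((-k : ℤ) : ℝ) * t| = |s - t| / 2 ^ (k : ℝ) := by
    rw [← mul_sub, abs_mul, abs_of_pos (by positivity)]
    push_cast
    rw [Real.rpow_neg (by norm_num)]
    field_simp
  obtain ⟨b, hb⟩ := exists_half_le_abs_cond_cos_sin_sub
    (s := 2 ^ ((-k : ℤ) : ℝ) * s) (t := 2 ^ ((-k : ℤ) : ℝ) * t)
    (by rwa [hd, one_le_div hkpos]) (by rwa [hd, div_lt_iff₀ hkpos])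
  refine le_trans ?_ (ENNReal.le_tsum (-k, b))
  rw [enorm_rpow_eq_ofReal hq.le, enorm_rpow_eq_ofReal hp.le, ← ENNReal.ofReal_mul (by positivity)]
  refine ENNReal.ofReal_le_ofReal ?_
  rw [abs_snowflake_sub_rpow hq]
  have h2 : (2 : ℝ) ^ (-(((-k : ℤ) : ℝ) * p)) = ((2 : ℝ) ^ (k : ℝ)) ^ p := by
    rw [← Real.rpow_mul (by norm_num)]
    push_cast
    congr 1
    ring
  rw [h2]
  calc (1 / 2 : ℝ) ^ p * (1 / 2) ^ q * |s - t| ^ p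
      = (1 / 2 * |s - t|) ^ p * (1 / 2) ^ q := by
        rw [Real.mul_rpow (by norm_num) (abs_nonneg _)]
        ring
    _ ≤ _ := by
        gcongr
        linarith

theorem borelReducible_lpRel_of_lt {p q : ℝ} (hp : 0 < p) (hpq : p < q) :
    BorelReducible (lpRel p) (lpRel q) := by
  have hq : 0 < q := hp.trans hpq
  obtain ⟨e⟩ : Nonempty (ℕ ≃ ℕ × ℤ × Bool) := nonempty_equiv_of_countable
  obtain ⟨C, hC, hle⟩ := exists_lpSum_snowflake_le hp hpq
  obtain ⟨c, hc, hge⟩ := exists_le_lpSum_snowflake hp hpq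
  let θ : (ℕ → ℝ) → ℕ → ℝ := fun x k => snowflake p q (e k).2 (x (e k).1)
  have hθ : Continuous θ :=
    continuous_pi fun k => (continuous_snowflake p q (e k).2).comp (continuous_apply _)
  refine ⟨θ, ?_, fun x y => ?_⟩
  · borelize (ℕ → ℝ)
    exact hθ.measurable
  have hsum : lpSum q (θ x - θ y) =
      ∑' n, lpSum q (fun i => snowflake p q i (x n) - snowflake p q i (y n)) := by
    refine (e.tsum_eq (fun k : ℕ × ℤ × Bool =>
      ‖snowflake p q k.2 (x k.1) - snowflake p q k.2 (y k.1)‖ₑ ^ q)).trans ?_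
    exact ENNReal.tsum_prod (f := fun (n : ℕ) (i : ℤ × Bool) =>
      ‖snowflake p q i (x n) - snowflake p q i (y n)‖ₑ ^ q)
  rw [lpRel_iff hp.le, lpRel_iff hq.le, hsum]
  constructor
  · intro h
    refine ne_top_of_le_ne_top (ENNReal.mul_ne_top hC h) ?_
    rw [lpSum, ← ENNReal.tsum_mul_left]
    exact ENNReal.tsum_le_tsum fun n => hle _ _
  · intro h h'
    refine ne_top_of_le_ne_top h (ENNReal.tsum_le_tsum fun n => hge (x n) (y n)) ?_
    rw [ENNReal.tsum_mul_left]
    exact ENNReal.mul_eq_top.2 (Or.inl ⟨hc, h'⟩)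

/-- The extended `ℓp` norm of a real sequence. -/
noncomputable def lpENorm (p : ℝ) (v : ℕ → ℝ) : ℝ≥0∞ :=
  lpSum p v ^ (1 / p)

lemma lpENorm_rpow {p : ℝ} (hp : 0 < p) (v : ℕ → ℝ) : lpENorm p v ^ p = lpSum p v := by
  rw [lpENorm, ← ENNReal.rpow_mul, one_div_mul_cancel hp.ne', ENNReal.rpow_one]

lemma lpENorm_neg (p : ℝ) (v : ℕ → ℝ) : lpENorm p (-v) = lpENorm p v := by
  rw [lpENorm, lpSum_neg, lpENorm]

lemma lpENorm_add_le {p : ℝ} (hp : 1 ≤ p) (u v : ℕ → ℝ) :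
    lpENorm p (u + v) ≤ lpENorm p u + lpENorm p v := by
  have h := ENNReal.lintegral_Lp_add_le (μ := MeasureTheory.Measure.count)
    (f := fun n : ℕ => ‖u n‖ₑ) (g := fun n : ℕ => ‖v n‖ₑ) (measurable_of_countable _).aemeasurable
    (measurable_of_countable _).aemeasurable hp
  simp only [MeasureTheory.lintegral_count] at h
  refine le_trans ?_ h
  refine ENNReal.rpow_le_rpow (ENNReal.tsum_le_tsum fun n => ?_) (by positivity)
  exact ENNReal.rpow_le_rpow (enorm_add_le _ _) (by linarith)

lemma lpENorm_sub_le {p : ℝ} (hp : 1 ≤ p) (u v : ℕ → ℝ) :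
    lpENorm p (u - v) ≤ lpENorm p u + lpENorm p v := by
  rw [sub_eq_add_neg, ← lpENorm_neg p v]
  exact lpENorm_add_le hp _ _

lemma lpENorm_sub_le_sum {p : ℝ} (hp : 1 ≤ p) (f : ℕ → ℕ → ℝ) (m : ℕ) :
    lpENorm p (f m - f 0) ≤ ∑ i ∈ Finset.range m, lpENorm p (f (i + 1) - f i) := by
  induction m with
  | zero => simp [lpENorm, lpSum, (by linarith : 0 < p)]
  | succ m ih =>
    rw [Finset.sum_range_succ, ← sub_add_sub_cancel' (f m)]
    exact (lpENorm_add_le hp _ _).trans (add_le_add_left ih _)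

lemma lowerSemicontinuous_lpSum {p : ℝ} (hp : 0 ≤ p) :
    LowerSemicontinuous (lpSum p : (ℕ → ℝ) → ℝ≥0∞) := by
  refine lowerSemicontinuous_tsum fun n => Continuous.lowerSemicontinuous ?_
  simp only [enorm_rpow_eq_ofReal hp]
  exact ENNReal.continuous_ofReal.comp
    ((continuous_apply n).abs.rpow_const fun _ => Or.inr hp)

lemma lpSum_le_of_tendsto {α : Type*} {l : Filter α} [l.NeBot] {p : ℝ} (hp : 0 ≤ p)
    {u : α → ℕ → ℝ} {v : ℕ → ℝ} (hu : Tendsto u l (𝓝 v)) {B : ℝ≥0∞}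
    (hB : ∀ᶠ a in l, lpSum p (u a) ≤ B) : lpSum p v ≤ B :=
  ((lowerSemicontinuous_lpSum hp).isClosed_preimage B).mem_of_tendsto hu hB

lemma lpSum_eq_sum_add {p : ℝ} (v : ℕ → ℝ) (L : ℕ) :
    lpSum p v = ∑ i ∈ Finset.range L, ‖v i‖ₑ ^ p + lpSum p (fun n => v (n + L)) :=
  (Summable.sum_add_tsum_nat_add' ENNReal.summable).symm

lemma lpENorm_le_rpow_add {p : ℝ} (hp : 1 ≤ p) (v : ℕ → ℝ) (L : ℕ) :
    lpENorm p v ≤ (∑ i ∈ Finset.range L, ‖v i‖ₑ ^ p) ^ (1 / p) +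
      lpENorm p (fun n => v (n + L)) := by
  rw [lpENorm, lpSum_eq_sum_add v L]
  exact ENNReal.rpow_add_le_add_rpow _ _ (by positivity) (by rw [div_le_one] <;> linarith)

lemma lpENorm_shift_le {p : ℝ} (hp : 0 ≤ p) (v : ℕ → ℝ) (L : ℕ) :
    lpENorm p (fun n => v (n + L)) ≤ lpENorm p v :=
  ENNReal.rpow_le_rpow (by rw [lpSum_eq_sum_add v L]; exact le_add_self) (by positivity)

lemma enorm_le_lpENorm {p : ℝ} (hp : 0 < p) (v : ℕ → ℝ) (n : ℕ) : ‖v n‖ₑ ≤ lpENorm p v := by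
  rw [← ENNReal.rpow_le_rpow_iff hp, lpENorm_rpow hp]
  exact ENNReal.le_tsum n

lemma tendsto_lpENorm_shift {p : ℝ} (hp : 0 < p) {v : ℕ → ℝ} (hv : lpSum p v ≠ ∞) :
    Tendsto (fun L => lpENorm p (fun n => v (n + L))) atTop (𝓝 0) := by
  have h := (ENNReal.tendsto_sum_nat_add _ hv).ennrpow_const (1 / p)
  rwa [ENNReal.zero_rpow_of_pos (by positivity)] at h

lemma tendsto_sum_enorm_rpow {α : Type*} {l : Filter α} {p : ℝ} {u : α → ℕ → ℝ} {v : ℕ → ℝ}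
    (hu : Tendsto u l (𝓝 v)) (L : ℕ) :
    Tendsto (fun a => ∑ i ∈ Finset.range L, ‖u a i‖ₑ ^ p) l
      (𝓝 (∑ i ∈ Finset.range L, ‖v i‖ₑ ^ p)) :=
  tendsto_finsetSum _ fun i _ => ((tendsto_pi_nhds.1 hu i).enorm).ennrpow_const p

lemma tendsto_sum_enorm_rpow_zero {α : Type*} {l : Filter α} {p : ℝ} (hp : 0 < p)
    {u : α → ℕ → ℝ} (hu : Tendsto u l (𝓝 0)) (L : ℕ) :
    Tendsto (fun a => (∑ i ∈ Finset.range L, ‖u a i‖ₑ ^ p) ^ (1 / p)) l (𝓝 0) := by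
  have h := (tendsto_sum_enorm_rpow (p := p) hu L).ennrpow_const (1 / p)
  simpa [hp] using h

lemma tendsto_zero_of_tendsto_lpENorm {α : Type*} {l : Filter α} {p : ℝ} (hp : 0 < p)
    {u : α → ℕ → ℝ} (hu : Tendsto (fun a => lpENorm p (u a)) l (𝓝 0)) : Tendsto u l (𝓝 0) := by
  refine tendsto_pi_nhds.2 fun n => ?_
  rw [tendsto_iff_edist_tendsto_0]
  refine tendsto_of_tendsto_of_tendsto_of_le_of_le tendsto_const_nhds hu (fun _ => zero_le)
    fun a => ?_
  simpa using enorm_le_lpENorm hp (u a) n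

/-- A coordinatewise convergent family with uniformly small tails converges in `ℓp`. -/
lemma tendsto_lpENorm_sub {α : Type*} {l : Filter α} {p : ℝ} (hp : 1 ≤ p) {u : α → ℕ → ℝ}
    {v : ℕ → ℝ} (hu : Tendsto u l (𝓝 v)) (hv : lpSum p v ≠ ∞)
    (htail : ∀ (L : ℕ) (k : ℕ), lpENorm p (fun n => v (n + L)) < (k : ℝ≥0∞)⁻¹ →
      ∀ᶠ a in l, lpENorm p (fun n => u a (n + L)) < (k : ℝ≥0∞)⁻¹) :
    Tendsto (fun a => lpENorm p (u a - v)) l (𝓝 0) := by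
  have hp0 : 0 < p := by linarith
  refine ENNReal.tendsto_nhds_zero.2 fun ε hε => ?_
  have hε3 : 0 < ε / 3 := ENNReal.div_pos hε.ne' (by norm_num)
  obtain ⟨k, hk⟩ := ENNReal.exists_inv_nat_lt hε3.ne'
  obtain ⟨L, hL⟩ := ((tendsto_lpENorm_shift hp0 hv).eventually_lt_const
    (ENNReal.inv_pos.2 (ENNReal.natCast_ne_top k))).exists
  have hz : Tendsto (fun a => u a - v) l (𝓝 0) := by
    simpa using hu.sub_const v
  filter_upwards [htail L k hL,
    (tendsto_sum_enorm_rpow_zero hp0 hz L).eventually_lt_const hε3] with a ha hfin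
  have htri := lpENorm_sub_le hp (fun n => u a (n + L)) (fun n => v (n + L))
  calc lpENorm p (u a - v) ≤ _ := lpENorm_le_rpow_add hp _ L
    _ ≤ ε / 3 + (ε / 3 + ε / 3) :=
      add_le_add hfin.le (htri.trans (add_le_add (ha.trans hk).le (hL.trans hk).le))
    _ = ε := by rw [← add_assoc, ENNReal.add_thirds]

/-- Adding to `v ∈ ℓp` perturbations that vanish in norm and jumps of norm at least `δ` that vanish
coordinatewise eventually increases the sum of `p`-th powers almost additively. -/
lemma eventually_lt_lpSum_add {α : Type*} {l : Filter α} {p : ℝ} (hp : 1 ≤ p) {v : ℕ → ℝ}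
    (hv : lpSum p v ≠ ∞) {o J : α → ℕ → ℝ} (ho : Tendsto (fun a => lpENorm p (o a)) l (𝓝 0))
    (hJ : Tendsto J l (𝓝 0)) {δ : ℝ≥0∞} (hδ0 : δ ≠ 0) (hδ : δ ≠ ∞)
    (hJδ : ∀ᶠ a in l, δ ≤ lpENorm p (J a)) {M : ℝ≥0∞} (hM : M < lpSum p v + 1) :
    ∀ᶠ a in l, M + (δ / 2) ^ p < lpSum p (v + o a + J a) + 1 := by
  have hp0 : 0 < p := by linarith
  have hδ6 : 0 < δ / 2 / 3 := by simp [hδ0]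
  have hlim : Tendsto (fun a => v + o a + J a) l (𝓝 v) := by
    simpa using ((tendsto_zero_of_tendsto_lpENorm hp0 ho).const_add v).add hJ
  have hA : ∀ᶠ L in atTop, M < ∑ i ∈ Finset.range L, ‖v i‖ₑ ^ p + 1 :=
    ((ENNReal.tendsto_nat_tsum _).add_const 1).eventually_const_lt hM
  obtain ⟨L, hL, hLv⟩ :=
    (hA.and ((tendsto_lpENorm_shift hp0 hv).eventually_lt_const hδ6)).exists
  filter_upwards [hJδ, ho.eventually_lt_const hδ6,
    (tendsto_sum_enorm_rpow_zero hp0 hJ L).eventually_lt_const hδ6,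
    ((tendsto_sum_enorm_rpow (p := p) hlim L).add_const 1).eventually_const_lt hL]
    with a hJa hoa hJL hMa
  set w := v + o a + J a with hw
  have hJw : lpENorm p (fun n => J a (n + L)) ≤
      lpENorm p (fun n => w (n + L)) + lpENorm p (fun n => v (n + L)) + lpENorm p (o a) := by
    have e : (fun n => J a (n + L)) =
        (fun n => w (n + L)) - (fun n => v (n + L)) - (fun n => o a (n + L)) := by
      ext n
      simp only [hw, Pi.add_apply, Pi.sub_apply]
      ring
    rw [e]
    refine (lpENorm_sub_le hp _ _).trans ?_
    exact add_le_add (lpENorm_sub_le hp _ _) (lpENorm_shift_le hp0.le _ L)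
  have hδw : δ / 2 ≤ lpENorm p (fun n => w (n + L)) := by
    have hfin : δ / 2 ≠ ∞ := ENNReal.div_ne_top hδ (by norm_num)
    refine (ENNReal.add_le_add_iff_left hfin).1 ?_
    calc δ / 2 + δ / 2 = δ := ENNReal.add_halves δ
      _ ≤ lpENorm p (J a) := hJa
      _ ≤ _ := lpENorm_le_rpow_add hp _ L
      _ ≤ δ / 2 / 3 + (lpENorm p (fun n => w (n + L)) + δ / 2 / 3 + δ / 2 / 3) :=
        add_le_add hJL.le (hJw.trans (add_le_add (add_le_add_right hLv.le _) hoa.le))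
      _ = (δ / 2 / 3 + δ / 2 / 3 + δ / 2 / 3) + lpENorm p (fun n => w (n + L)) := by ring
      _ = δ / 2 + lpENorm p (fun n => w (n + L)) := by rw [ENNReal.add_thirds]
  calc M + (δ / 2) ^ p < ∑ i ∈ Finset.range L, ‖w i‖ₑ ^ p + 1 + lpSum p (fun n => w (n + L)) := by
        rw [← lpENorm_rpow hp0 (fun n => w (n + L))]
        exact ENNReal.add_lt_add_of_lt_of_le
          (ENNReal.rpow_ne_top_of_nonneg hp0.le (ENNReal.div_ne_top hδ (by norm_num))) hMa
          (ENNReal.rpow_le_rpow hδw hp0.le)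
    _ = lpSum p w + 1 := by
        rw [lpSum_eq_sum_add w L]
        ring

lemma exists_forall_lt_eq_imp_mem {Y : Type*} [TopologicalSpace Y] {w : ℕ → Y} {S : Set (ℕ → Y)}
    (hS : S ∈ 𝓝 w) : ∃ N, ∀ z : ℕ → Y, (∀ i < N, z i = w i) → z ∈ S := by
  rw [nhds_pi, Filter.mem_pi] at hS
  obtain ⟨I, hI, t, ht, hsub⟩ := hS
  obtain ⟨N, hN⟩ := hI.bddAbove
  refine ⟨N + 1, fun z hz => hsub fun i hi => ?_⟩
  rw [hz i (Nat.lt_succ_of_le (hN hi))]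
  exact mem_of_mem_nhds (ht i)

/-- Fusion: approximations extending one another on longer and longer initial segments converge to
a point satisfying all the open requirements met along the way. -/
lemma exists_tendsto_of_extension {Y : Type*} [TopologicalSpace Y] {P : ℕ → (ℕ → Y) → Prop}
    {O : ℕ → Set (ℕ → Y)} (hO : ∀ k w, P k w → O k ∈ 𝓝 w)
    (step : ∀ k w N, P k w → ∃ w', P (k + 1) w' ∧ ∀ i < N, w' i = w i)
    {w₀ : ℕ → Y} (h₀ : P 0 w₀) :
    ∃ (w : ℕ → ℕ → Y) (z : ℕ → Y), (∀ k, P k (w k)) ∧ Tendsto w atTop (𝓝 z) ∧ ∀ k, z ∈ O k := by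
  have hcyl : ∀ k w, P k w → ∀ N, ∃ N', N < N' ∧ ∀ z : ℕ → Y, (∀ i < N', z i = w i) → z ∈ O k := by
    intro k w hw N
    obtain ⟨N₁, hN₁⟩ := exists_forall_lt_eq_imp_mem (hO k w hw)
    exact ⟨max (N + 1) N₁, by simp, fun z hz => hN₁ z fun i hi => hz i (lt_max_of_lt_right hi)⟩
  let T : ℕ → Type _ := fun k => {s : (ℕ → Y) × ℕ //
    P k s.1 ∧ ∀ z : ℕ → Y, (∀ i < s.2, z i = s.1 i) → z ∈ O k}
  have next : ∀ k (s : T k), ∃ s' : T (k + 1),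
      (∀ i < s.1.2, s'.1.1 i = s.1.1 i) ∧ s.1.2 < s'.1.2 := by
    rintro k ⟨⟨w, N⟩, hw, hz⟩
    obtain ⟨w', hw', hag⟩ := step k w N hw
    obtain ⟨N', hN', hz'⟩ := hcyl (k + 1) w' hw' N
    exact ⟨⟨⟨w', N'⟩, hw', hz'⟩, hag, hN'⟩
  choose nxt hag hlt using next
  obtain ⟨N₀, -, hN₀⟩ := hcyl 0 w₀ h₀ 0
  let S : ∀ k, T k := fun k => Nat.rec ⟨⟨w₀, N₀⟩, h₀, hN₀⟩ (fun k s => nxt k s) k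
  have hmono : StrictMono fun k => (S k).1.2 := strictMono_nat_of_lt_succ fun k => hlt k (S k)
  have hagree : ∀ k j, k ≤ j → ∀ i < (S k).1.2, (S j).1.1 i = (S k).1.1 i := by
    intro k j hkj
    induction j, hkj using Nat.le_induction with
    | base => exact fun _ _ => rfl
    | succ j hkj ih =>
      exact fun i hi => (hag j (S j) i (hi.trans_le (hmono.monotone hkj))).trans (ih i hi)
  have hself : ∀ i, i < (S (i + 1)).1.2 := fun i => hmono.le_apply (x := i + 1)
  refine ⟨fun k => (S k).1.1, fun i => (S (i + 1)).1.1 i, fun k => (S k).2.1, ?_, fun k => ?_⟩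
  · refine tendsto_pi_nhds.2 fun i => tendsto_atTop_of_eventually_const (i₀ := i + 1) fun j hj => ?_
    exact hagree _ _ hj i (hself i)
  · refine (S k).2.2 _ fun i hi => ?_
    rcases le_total k (i + 1) with h | h
    · exact hagree _ _ h i hi
    · exact (hagree _ _ h i (hself i)).symm

/-- Fusion inside a `Gδ` set. -/
lemma IsGδ.exists_tendsto_of_extension {Y : Type*} [TopologicalSpace Y] {G : Set (ℕ → Y)}
    (hG : IsGδ G) {P Q : ℕ → (ℕ → Y) → Prop} (hPG : ∀ k w, P k w → w ∈ G)
    (hQ : ∀ k w, P k w → ∀ᶠ z in 𝓝[G] w, Q k z)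
    (step : ∀ k w N, P k w → ∃ w', P (k + 1) w' ∧ ∀ i < N, w' i = w i)
    {w₀ : ℕ → Y} (h₀ : P 0 w₀) :
    ∃ (w : ℕ → ℕ → Y) (z : ℕ → Y), (∀ k, P k (w k)) ∧ Tendsto w atTop (𝓝[G] z) ∧ z ∈ G ∧
      ∀ k, Q k z := by
  obtain ⟨D, hD, rfl⟩ := hG.eq_iInter_nat
  obtain ⟨w, z, hw, hlim, hz⟩ := _root_.exists_tendsto_of_extension (P := P)
    (O := fun k => D k ∩ {z | z ∈ ⋂ n, D n → Q k z})
    (fun k w hw => inter_mem ((hD k).mem_nhds (mem_iInter.1 (hPG k w hw) k))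
      (eventually_nhdsWithin_iff.1 (hQ k w hw))) step h₀
  have hzG : z ∈ ⋂ n, D n := mem_iInter.2 fun k => (hz k).1
  exact ⟨w, z, hw, tendsto_nhdsWithin_iff.2 ⟨hlim, Eventually.of_forall fun k => hPG k _ (hw k)⟩,
    hzG, fun k => (hz k).2 hzG⟩

/-- A finitely supported rational sequence, viewed as a real sequence. -/
def ratVec (h : ℕ →₀ ℚ) : ℕ → ℝ := fun n => (h n : ℝ)

lemma ratVec_zero : ratVec 0 = 0 := by
  ext n
  simp [ratVec]

lemma ratVec_add (h h' : ℕ →₀ ℚ) : ratVec (h + h') = ratVec h + ratVec h' := by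
  ext n
  simp [ratVec]

lemma lpSum_ratVec_ne_top {q : ℝ} (hq : 0 < q) (h : ℕ →₀ ℚ) : lpSum q (ratVec h) ≠ ∞ := by
  rw [lpSum, tsum_eq_sum (s := h.support)]
  · exact ENNReal.sum_ne_top.2 fun n _ => ENNReal.rpow_ne_top_of_nonneg hq.le enorm_ne_top
  · intro n hn
    simp [ratVec, Finsupp.notMem_support_iff.1 hn, hq]

lemma lpSum_ratVec_add_single_le {q : ℝ} {h : ℕ →₀ ℚ} {n : ℕ} (hn : h n = 0) (a : ℚ) :
    lpSum q (ratVec (h + Finsupp.single n a)) ≤ lpSum q (ratVec h) + ‖(a : ℝ)‖ₑ ^ q := by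
  calc lpSum q (ratVec (h + Finsupp.single n a))
      ≤ ∑' i, (‖ratVec h i‖ₑ ^ q + if i = n then ‖(a : ℝ)‖ₑ ^ q else 0) := by
        refine ENNReal.tsum_le_tsum fun i => ?_
        rcases eq_or_ne i n with rfl | hi
        · simp [ratVec, hn]
        · simp [ratVec, hi]
    _ = _ := by rw [ENNReal.tsum_add, tsum_ite_eq, lpSum]

lemma eventually_finsupp_eq_zero (h : ℕ →₀ ℚ) : ∀ᶠ n in atTop, h n = 0 := by
  rw [← Nat.cofinite_eq_atTop]
  refine h.hasFiniteSupport.subset fun n hn => ?_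
  simpa using hn

lemma tendsto_ratVec_single (a : ℕ → ℚ) :
    Tendsto (fun n => ratVec (Finsupp.single n (a n))) atTop (𝓝 0) := by
  refine tendsto_pi_nhds.2 fun i => tendsto_atTop_of_eventually_const (i₀ := i + 1) fun n hn => ?_
  have hin : n ≠ i := by omega
  simp [ratVec, hin]

/-- Countably many Borel sets are relatively open in a common translation invariant nonempty `Gδ`
set. -/
lemma exists_isGδ_forall_mem_nhdsWithin {ι : Type*} [Countable ι] {B : ι → Set (ℕ → ℝ)}
    (hB : ∀ i, MeasurableSet (B i)) :
    ∃ G : Set (ℕ → ℝ), IsGδ G ∧ G.Nonempty ∧ (∀ x ∈ G, ∀ h, x + ratVec h ∈ G) ∧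
      ∀ i, ∀ x ∈ G, x ∈ B i → B i ∈ 𝓝[G] x := by
  choose U hU hBU using fun i => (hB i).residualEq_isOpen
  have hres : {x | ∀ i, x ∈ B i ↔ x ∈ U i} ∈ residual (ℕ → ℝ) :=
    eventually_countable_forall.2 fun i => (hBU i).mem_iff
  obtain ⟨G₀, hsub, hG₀, hdense⟩ := mem_residual.1 hres
  have hcont : ∀ h, Continuous fun x : ℕ → ℝ => x + ratVec h := fun h => by fun_prop
  have hGδ : ∀ h, IsGδ ((fun x : ℕ → ℝ => x + ratVec h) ⁻¹' G₀) := fun h => hG₀.preimage (hcont h)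
  have hG : ⋂ h, (fun x : ℕ → ℝ => x + ratVec h) ⁻¹' G₀ ∈ residual (ℕ → ℝ) :=
    countable_iInter_mem.2 fun h => residual_of_dense_Gδ (hGδ h)
      (hdense.preimage (Homeomorph.addRight (ratVec h)).isOpenMap)
  refine ⟨⋂ h, (fun x : ℕ → ℝ => x + ratVec h) ⁻¹' G₀, IsGδ.iInter hGδ,
    (dense_of_mem_residual hG).nonempty, fun x hx h => ?_, fun i x hx hxB => ?_⟩
  · refine mem_iInter.2 fun h' => ?_
    simpa [ratVec_add, add_assoc] using mem_iInter.1 hx (h + h')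
  · have hmem : ∀ y ∈ ⋂ h, (fun x : ℕ → ℝ => x + ratVec h) ⁻¹' G₀, (y ∈ B i ↔ y ∈ U i) := by
      intro y hy
      refine hsub ?_ i
      simpa [ratVec_zero] using mem_iInter.1 hy 0
    filter_upwards [self_mem_nhdsWithin,
      mem_nhdsWithin_of_mem_nhds ((hU i).mem_nhds ((hmem x hx).1 hxB))] with y hyG hyU
    exact (hmem y hyG).2 hyU

/-- A nonempty `Gδ` set, invariant under finitely supported rational translations, on which `θ` is
continuous and its increments along such translations are continuous in the `ℓp` norm. -/
structure IsContinuitySet (p : ℝ) (θ : (ℕ → ℝ) → ℕ → ℝ) (G : Set (ℕ → ℝ)) : Prop where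
  isGδ : IsGδ G
  nonempty : G.Nonempty
  add_ratVec_mem : ∀ x ∈ G, ∀ h, x + ratVec h ∈ G
  continuousOn : ContinuousOn θ G
  tendsto_increment : ∀ x ∈ G, ∀ h, Tendsto
    (fun y => lpENorm p (θ (y + ratVec h) - θ y - (θ (x + ratVec h) - θ x))) (𝓝[G] x) (𝓝 0)

lemma exists_isContinuitySet {p : ℝ} (hp : 1 ≤ p) {θ : (ℕ → ℝ) → ℕ → ℝ} (hθ : Measurable θ)
    (hfin : ∀ x h, lpSum p (θ (x + ratVec h) - θ x) ≠ ∞) : ∃ G, IsContinuitySet p θ G := by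
  have hp0 : 0 ≤ p := by linarith
  let 𝓑 := TopologicalSpace.countableBasis (ℕ → ℝ)
  have : Countable 𝓑 := TopologicalSpace.countable_countableBasis _
  let B : 𝓑 ⊕ (ℕ →₀ ℚ) × ℕ × ℕ → Set (ℕ → ℝ) := Sum.elim (fun V => θ ⁻¹' V)
    fun i => {x | lpENorm p (fun n => (θ (x + ratVec i.1) - θ x) (n + i.2.1)) < (i.2.2 : ℝ≥0∞)⁻¹}
  have hB : ∀ i, MeasurableSet (B i) := by
    rintro (⟨V, hV⟩ | ⟨h, L, k⟩)
    · exact hθ (TopologicalSpace.isOpen_of_mem_countableBasis hV).measurableSet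
    · have hnorm : Measurable (lpENorm p) :=
        (lowerSemicontinuous_lpSum hp0).measurable.pow_const _
      have hinc : Measurable fun x => θ (x + ratVec h) - θ x :=
        (hθ.comp (measurable_add_const _)).sub hθ
      have hshift : Measurable fun x (n : ℕ) => (θ (x + ratVec h) - θ x) (n + L) :=
        measurable_pi_lambda _ fun n => (measurable_pi_apply _).comp hinc
      exact measurableSet_lt (hnorm.comp hshift) measurable_const
  obtain ⟨G, hG, hne, hinv, hopen⟩ := exists_isGδ_forall_mem_nhdsWithin hB
  have hcont : ContinuousOn θ G := by
    intro x hx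
    refine ((TopologicalSpace.isBasis_countableBasis (ℕ → ℝ)).nhds_hasBasis).tendsto_right_iff.2 ?_
    rintro V ⟨hV, hxV⟩
    exact hopen (Sum.inl ⟨V, hV⟩) x hx hxV
  refine ⟨G, hG, hne, hinv, hcont, fun x hx h => ?_⟩
  refine tendsto_lpENorm_sub hp ?_ (hfin x h) fun L k hLk => hopen (Sum.inr (h, L, k)) x hx hLk
  refine Tendsto.sub ?_ (hcont x hx)
  refine (hcont _ (hinv x hx h)).tendsto.comp (tendsto_nhdsWithin_iff.2 ⟨?_, ?_⟩)
  · exact ((continuous_id.add continuous_const).tendsto x).mono_left nhdsWithin_le_nhds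
  · filter_upwards [self_mem_nhdsWithin] with y hy using hinv y hy h

/-- Some step of length `1 / m` in one coordinate moves `θ` by at least `c / m`. -/
lemma exists_div_le_lpENorm_step {p : ℝ} (hp : 1 ≤ p) {θ : (ℕ → ℝ) → ℕ → ℝ} {x : ℕ → ℝ}
    {c : ℝ≥0∞} {n : ℕ} (hc : c ≤ lpENorm p (θ (x + ratVec (Finsupp.single n 1)) - θ x))
    {m : ℕ} (hm : 0 < m) :
    ∃ i : ℕ, c / m ≤ lpENorm p (θ (x + ratVec (Finsupp.single n ((i + 1 : ℕ) / m : ℚ))) -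
      θ (x + ratVec (Finsupp.single n ((i : ℕ) / m : ℚ)))) := by
  let f : ℕ → ℕ → ℝ := fun i => θ (x + ratVec (Finsupp.single n ((i : ℕ) / m : ℚ)))
  obtain ⟨i, -, hi⟩ := Finset.exists_max_image (Finset.range m)
    (fun i => lpENorm p (f (i + 1) - f i)) ⟨0, Finset.mem_range.2 hm⟩
  refine ⟨i, ENNReal.div_le_of_le_mul ?_⟩
  have hm0 : (m : ℚ) ≠ 0 := by positivity
  calc c ≤ lpENorm p (f m - f 0) := by simpa [f, hm0, ratVec_zero] using hc
    _ ≤ _ := lpENorm_sub_le_sum hp f m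
    _ ≤ _ := Finset.sum_le_card_nsmul _ _ _ hi
    _ = _ := by rw [Finset.card_range, nsmul_eq_mul, mul_comm]

namespace IsContinuitySet

variable {p : ℝ} {θ : (ℕ → ℝ) → ℕ → ℝ} {G : Set (ℕ → ℝ)} {x : ℕ → ℝ}

lemma tendsto_add_single (hG : IsContinuitySet p θ G) (hx : x ∈ G) (a : ℕ → ℚ) :
    Tendsto (fun n => x + ratVec (Finsupp.single n (a n))) atTop (𝓝[G] x) := by
  refine tendsto_nhdsWithin_iff.2 ⟨?_, Eventually.of_forall fun n => hG.add_ratVec_mem x hx _⟩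
  simpa using (tendsto_ratVec_single a).const_add x

lemma tendsto_increment_single (hG : IsContinuitySet p θ G) (hx : x ∈ G) (h : ℕ →₀ ℚ) (a : ℕ → ℚ) :
    Tendsto (fun n => lpENorm p (θ (x + ratVec (h + Finsupp.single n (a n))) -
      θ (x + ratVec (Finsupp.single n (a n))) - (θ (x + ratVec h) - θ x))) atTop (𝓝 0) := by
  refine ((hG.tendsto_increment x hx h).comp (hG.tendsto_add_single hx a)).congr fun n => ?_
  simp only [Function.comp_apply, add_comm h, ratVec_add, add_assoc]

lemma tendsto_jump (hG : IsContinuitySet p θ G) (hx : x ∈ G) (a b : ℕ → ℚ) :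
    Tendsto (fun n => θ (x + ratVec (Finsupp.single n (b n))) -
      θ (x + ratVec (Finsupp.single n (a n)))) atTop (𝓝 0) := by
  have hlim : ∀ a : ℕ → ℚ,
      Tendsto (fun n => θ (x + ratVec (Finsupp.single n (a n)))) atTop (𝓝 (θ x)) :=
    fun a => (hG.continuousOn x hx).tendsto.comp (hG.tendsto_add_single hx a)
  simpa using (hlim b).sub (hlim a)

/-- Unit changes of one coordinate move `θ x` by a norm bounded away from zero. -/
lemma exists_eventually_le_lpENorm (hG : IsContinuitySet p θ G) (hx : x ∈ G) (hp : 1 ≤ p) {q : ℝ}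
    (hq : 0 < q) (hθ : ∀ y, lpSum p (θ y - θ x) ≠ ∞ → lpSum q (y - x) ≠ ∞) :
    ∃ c : ℝ≥0∞, c ≠ 0 ∧
      ∀ᶠ n in atTop, c ≤ lpENorm p (θ (x + ratVec (Finsupp.single n 1)) - θ x) := by
  have hp0 : 0 < p := by linarith
  by_contra! hsmall
  let P : ℕ → (ℕ → ℝ) → Prop := fun k y => ∃ h : ℕ →₀ ℚ, y = x + ratVec h ∧
    lpENorm p (θ y - θ x) < 1 ∧ ∃ F : Finset ℕ, F.card = k ∧ ∀ n ∈ F, h n = 1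
  let Q : ℕ → (ℕ → ℝ) → Prop := fun k y => ∃ F : Finset ℕ, F.card = k ∧
    ∀ n ∈ F, 1 / 2 < (y - x) n
  have hPG : ∀ k y, P k y → y ∈ G := by
    rintro k y ⟨h, rfl, -⟩
    exact hG.add_ratVec_mem x hx h
  have hQ : ∀ k y, P k y → ∀ᶠ z in 𝓝[G] y, Q k z := by
    rintro k y ⟨h, rfl, -, F, hF, hFh⟩
    refine Eventually.filter_mono nhdsWithin_le_nhds ?_
    have hev : ∀ᶠ z in 𝓝 (x + ratVec h), ∀ n ∈ F, 1 / 2 < (z - x) n := by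
      refine (Finset.eventually_all F).2 fun n hn => ?_
      have hc : Continuous fun z : ℕ → ℝ => (z - x) n := by fun_prop
      refine hc.continuousAt.eventually (lt_mem_nhds ?_)
      simp only [add_sub_cancel_left, ratVec, hFh n hn]
      norm_num
    exact hev.mono fun z hz => ⟨F, hF, hz⟩
  have step : ∀ k y N, P k y → ∃ y', P (k + 1) y' ∧ ∀ i < N, y' i = y i := by
    rintro k y N ⟨h, rfl, hlt, F, hF, hFh⟩
    obtain ⟨r, hr, hr1⟩ := ENNReal.lt_iff_exists_add_pos_lt.1 hlt
    have hr2 : (0 : ℝ≥0∞) < r / 2 := by simp [hr.ne']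
    have hfreq : ∃ᶠ n in atTop,
        lpENorm p (θ (x + ratVec (Finsupp.single n 1)) - θ x) < (r : ℝ≥0∞) / 2 :=
      hsmall _ hr2.ne'
    obtain ⟨n, hn1, hn2, hn0, hnN⟩ := (hfreq.and_eventually
      (((hG.tendsto_increment_single hx h fun _ => 1).eventually_lt_const hr2).and
        ((eventually_finsupp_eq_zero h).and (eventually_ge_atTop N)))).exists
    refine ⟨_, ⟨h + Finsupp.single n 1, rfl, ?_, insert n F, ?_, ?_⟩, fun i hi => ?_⟩
    · refine lt_of_le_of_lt ?_ hr1
      set A := θ (x + ratVec (h + Finsupp.single n 1))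
      set C := θ (x + ratVec (Finsupp.single n 1))
      set D := θ (x + ratVec h)
      have e : A - θ x = (D - θ x) + ((A - C - (D - θ x)) + (C - θ x)) := by abel
      rw [e, ← ENNReal.add_halves (r : ℝ≥0∞)]
      refine (lpENorm_add_le hp _ _).trans (add_le_add_right ?_ _)
      exact (lpENorm_add_le hp _ _).trans (add_le_add hn2.le hn1.le)
    · rw [Finset.card_insert_of_notMem, hF]
      intro hnF
      simpa [hn0] using hFh n hnF
    · intro i hi
      rcases eq_or_ne i n with rfl | hin
      · simp [hn0]
      · simpa [hin] using hFh i (Finset.mem_of_mem_insert_of_ne hi hin)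
    · have hin : i ≠ n := by omega
      simp [ratVec, hin]
  have h₀ : P 0 x :=
    ⟨0, by simp [ratVec_zero], by simp [lpENorm, lpSum, hp0], ∅, rfl, by simp⟩
  obtain ⟨w, z, hw, hlim, hzG, hz⟩ := hG.isGδ.exists_tendsto_of_extension hPG hQ step h₀
  have hθz : lpSum p (θ z - θ x) ≤ 1 := by
    refine lpSum_le_of_tendsto hp0.le
      (((hG.continuousOn z hzG).tendsto.comp hlim).sub_const (θ x))
        (Eventually.of_forall fun k => ?_)
    obtain ⟨h, -, hlt, -⟩ := hw k
    rw [← lpENorm_rpow hp0]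
    exact ENNReal.rpow_le_one hlt.le hp0.le
  have hsum := (summable_abs_rpow_iff hq.le _).2 (hθ z (ne_top_of_le_ne_top ENNReal.one_ne_top hθz))
  have hfinite : {n | 1 / 2 < (z - x) n}.Finite := by
    have hev := hsum.tendsto_cofinite_zero.eventually_lt_const
      (by positivity : (0 : ℝ) < (1 / 2) ^ q)
    refine Set.Finite.subset hev fun n (hn : 1 / 2 < (z - x) n) => ?_
    simp only [mem_compl_iff, mem_ofPred_eq, not_lt]
    exact Real.rpow_le_rpow (by norm_num) (hn.le.trans (le_abs_self _)) hq.le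
  obtain ⟨F, hF, hFz⟩ := hz (hfinite.toFinset.card + 1)
  have hcard := Finset.card_le_card (s := F) (t := hfinite.toFinset)
    fun n hn => hfinite.mem_toFinset.2 (hFz n hn)
  omega

end IsContinuitySet

lemma exists_lpSum_inv_natCast {p q : ℝ} (hp : 0 < p) (hpq : p < q) :
    ∃ m : ℕ → ℕ, (∀ j, 0 < m j) ∧ lpSum q (fun j => ((m j : ℝ))⁻¹) ≠ ∞ ∧
      lpSum p (fun j => ((m j : ℝ))⁻¹) = ∞ := by
  have hq : 0 < q := hp.trans hpq
  have hpos : ∀ j : ℕ, (0 : ℝ) < ((j + 1 : ℕ) : ℝ) ^ (1 / p) := fun j => by positivity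
  have hm0 : ∀ j : ℕ, 0 < ⌈((j + 1 : ℕ) : ℝ) ^ (1 / p)⌉₊ := fun j => Nat.ceil_pos.2 (hpos j)
  have hlow : ∀ j : ℕ, ((j + 1 : ℕ) : ℝ) ^ (1 / p) ≤ ⌈((j + 1 : ℕ) : ℝ) ^ (1 / p)⌉₊ :=
    fun j => Nat.le_ceil _
  have hhigh : ∀ j : ℕ, (⌈((j + 1 : ℕ) : ℝ) ^ (1 / p)⌉₊ : ℝ) ≤ 2 * ((j + 1 : ℕ) : ℝ) ^ (1 / p) := by
    intro j
    have h1 : (1 : ℝ) ≤ ((j + 1 : ℕ) : ℝ) ^ (1 / p) :=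
      Real.one_le_rpow (by norm_cast; omega) (by positivity)
    have h2 := Nat.ceil_lt_add_one (hpos j).le
    linarith
  refine ⟨fun j => ⌈((j + 1 : ℕ) : ℝ) ^ (1 / p)⌉₊, hm0, ?_, ?_⟩
  · rw [← summable_abs_rpow_iff hq.le]
    have hs : Summable fun j : ℕ => (((j + 1 : ℕ) : ℝ) ^ (q / p))⁻¹ :=
      (summable_nat_add_iff 1).2 (Real.summable_nat_rpow_inv.2 ((one_lt_div hp).2 hpq))
    refine Summable.of_nonneg_of_le (fun j => by positivity) (fun j => ?_) hs
    rw [abs_of_nonneg (by positivity), Real.inv_rpow (by positivity)]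
    have : ((j + 1 : ℕ) : ℝ) ^ (q / p) = (((j + 1 : ℕ) : ℝ) ^ (1 / p)) ^ q := by
      rw [← Real.rpow_mul (by positivity)]
      congr 1
      ring
    rw [this]
    have := hpos j
    gcongr
    exact hlow j
  · by_contra htop
    have hs := (summable_abs_rpow_iff hp.le _).2 htop
    have hharm : Summable fun j : ℕ => (2 ^ p)⁻¹ * ((j + 1 : ℕ) : ℝ)⁻¹ := by
      refine Summable.of_nonneg_of_le (fun j => by positivity) (fun j => ?_) hs
      rw [abs_of_nonneg (by positivity), Real.inv_rpow (by positivity), ← mul_inv]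
      have : (2 ^ p * ((j + 1 : ℕ) : ℝ)) = (2 * ((j + 1 : ℕ) : ℝ) ^ (1 / p)) ^ p := by
        rw [Real.mul_rpow (by norm_num) (by positivity), ← Real.rpow_mul (by positivity),
          one_div_mul_cancel hp.ne', Real.rpow_one]
      rw [this]
      have : (0 : ℝ) < ⌈((j + 1 : ℕ) : ℝ) ^ (1 / p)⌉₊ := by exact_mod_cast hm0 j
      gcongr
      exact hhigh j
    rw [summable_mul_left_iff (by positivity)] at hharm
    exact Real.not_summable_natCast_inv ((summable_nat_add_iff 1).1 hharm)

lemma tsum_div_div_rpow_eq_top {p : ℝ} (hp : 0 < p) {m : ℕ → ℕ} (hm : ∀ j, 0 < m j)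
    (hsum : lpSum p (fun j => ((m j : ℝ))⁻¹) = ∞) {c : ℝ≥0∞} (hc : c ≠ 0) :
    ∑' j, (c / m j / 2) ^ p = ∞ := by
  have e : ∀ j, (c / m j / 2) ^ p = (c / 2) ^ p * ‖((m j : ℝ))⁻¹‖ₑ ^ p := by
    intro j
    have hmj : (m j : ℝ) ≠ 0 := by exact_mod_cast (hm j).ne'
    rw [enorm_inv hmj, ← ENNReal.mul_rpow_of_nonneg _ _ hp.le]
    congr 1
    simp only [div_eq_mul_inv, Real.enorm_natCast]
    ring
  simp only [e, ENNReal.tsum_mul_left]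
  rw [lpSum] at hsum
  rw [hsum]
  refine ENNReal.mul_top ?_
  simp [hp, hp.le, hc]

namespace IsContinuitySet

variable {p : ℝ} {θ : (ℕ → ℝ) → ℕ → ℝ} {G : Set (ℕ → ℝ)} {x : ℕ → ℝ}

/-- Given two finite modifications of `x`, a further change by `1 / m` in a far coordinate
increases the `ℓp` distance of the images by almost `c / m`. -/
lemma exists_step (hG : IsContinuitySet p θ G) (hx : x ∈ G) (hp : 1 ≤ p)
    (hfin : ∀ h, lpSum p (θ (x + ratVec h) - θ x) ≠ ∞) {c : ℝ≥0∞} (hc : c ≠ 0) (hc' : c ≠ ∞)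
    (hjump : ∀ᶠ n in atTop, c ≤ lpENorm p (θ (x + ratVec (Finsupp.single n 1)) - θ x))
    {m : ℕ} (hm : 0 < m) (h₁ h₂ : ℕ →₀ ℚ) {M : ℝ≥0∞}
    (hM : M < lpSum p (θ (x + ratVec h₂) - θ (x + ratVec h₁)) + 1) :
    ∀ᶠ n in atTop, ∃ a b : ℚ, b - a = (m : ℚ)⁻¹ ∧ M + (c / m / 2) ^ p <
      lpSum p (θ (x + ratVec (h₂ + Finsupp.single n b)) -
        θ (x + ratVec (h₁ + Finsupp.single n a))) + 1 := by
  have hp0 : 0 < p := by linarith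
  have hm0 : (m : ℚ) ≠ 0 := by positivity
  have hexists : ∀ n, ∃ i : ℕ, c ≤ lpENorm p (θ (x + ratVec (Finsupp.single n 1)) - θ x) →
      c / m ≤ lpENorm p (θ (x + ratVec (Finsupp.single n ((i + 1 : ℕ) / m : ℚ))) -
        θ (x + ratVec (Finsupp.single n ((i : ℕ) / m : ℚ)))) := by
    intro n
    by_cases h : c ≤ lpENorm p (θ (x + ratVec (Finsupp.single n 1)) - θ x)
    · obtain ⟨i, hi⟩ := exists_div_le_lpENorm_step hp h hm
      exact ⟨i, fun _ => hi⟩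
    · exact ⟨0, fun h' => absurd h' h⟩
  choose i hi using hexists
  let a : ℕ → ℚ := fun n => (i n : ℕ) / m
  let b : ℕ → ℚ := fun n => (i n + 1 : ℕ) / m
  let v := θ (x + ratVec h₂) - θ x - (θ (x + ratVec h₁) - θ x)
  have hveq : θ (x + ratVec h₂) - θ (x + ratVec h₁) = v := by simp [v]
  have hv : lpSum p v ≠ ∞ := by
    rw [← lpENorm_rpow hp0]
    refine ENNReal.rpow_ne_top_of_nonneg hp0.le (ne_top_of_le_ne_top ?_ (lpENorm_sub_le hp _ _))
    exact ENNReal.add_ne_top.2 ⟨ENNReal.rpow_ne_top_of_nonneg (by positivity) (hfin h₂),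
      ENNReal.rpow_ne_top_of_nonneg (by positivity) (hfin h₁)⟩
  rw [hveq] at hM
  have ho := tendsto_of_tendsto_of_tendsto_of_le_of_le tendsto_const_nhds
    (by simpa using
      (hG.tendsto_increment_single hx h₂ b).add (hG.tendsto_increment_single hx h₁ a))
    (fun _ => zero_le) (fun n => lpENorm_sub_le hp _ _)
  have hδ0 : c / m ≠ 0 := by simp [hc]
  have hδ : c / m ≠ ∞ := ENNReal.div_ne_top hc' (by exact_mod_cast hm.ne')
  filter_upwards [eventually_lt_lpSum_add hp hv ho (hG.tendsto_jump hx a b) hδ0 hδ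
    (hjump.mono fun n hn => hi n hn) hM] with n hn
  refine ⟨a n, b n, ?_, ?_⟩
  · simp only [a, b]
    push_cast
    field_simp
    ring
  · convert hn using 3
    simp only [v]
    abel

/-- There are `ℓq`-equivalent sequences whose images under `θ` are not `ℓp`-equivalent. -/
lemma exists_lpSum_eq_top (hG : IsContinuitySet p θ G) (hx : x ∈ G) (hp : 1 ≤ p) {q : ℝ}
    (hpq : p < q) (hfin : ∀ h, lpSum p (θ (x + ratVec h) - θ x) ≠ ∞) {c : ℝ≥0∞} (hc : c ≠ 0)
    (hjump : ∀ᶠ n in atTop, c ≤ lpENorm p (θ (x + ratVec (Finsupp.single n 1)) - θ x)) :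
    ∃ y z : ℕ → ℝ, lpSum q (z - y) ≠ ∞ ∧ lpSum p (θ z - θ y) = ∞ := by
  wlog hc' : c ≠ ∞ generalizing c
  · exact this one_ne_zero (hjump.mono fun n hn => le_trans (by simp_all) hn) ENNReal.one_ne_top
  have hp0 : 0 < p := by linarith
  have hq : 0 < q := hp0.trans hpq
  obtain ⟨m, hm, hmq, hmp⟩ := exists_lpSum_inv_natCast hp0 hpq
  let fst : (ℕ → ℝ × ℝ) → ℕ → ℝ := fun w n => (w n).1
  let snd : (ℕ → ℝ × ℝ) → ℕ → ℝ := fun w n => (w n).2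
  have hfst : Continuous fst := by fun_prop
  have hsnd : Continuous snd := by fun_prop
  let M : ℕ → ℝ≥0∞ := fun k => ∑ j ∈ Finset.range k, (c / m j / 2) ^ p
  let P : ℕ → (ℕ → ℝ × ℝ) → Prop := fun k w => ∃ h₁ h₂ : ℕ →₀ ℚ,
    fst w = x + ratVec h₁ ∧ snd w = x + ratVec h₂ ∧
    lpSum q (ratVec (h₂ - h₁)) ≤ ∑ j ∈ Finset.range k, ‖((m j : ℝ))⁻¹‖ₑ ^ q ∧
    M k < lpSum p (θ (snd w) - θ (fst w)) + 1
  let Q : ℕ → (ℕ → ℝ × ℝ) → Prop := fun k w => M k < lpSum p (θ (snd w) - θ (fst w)) + 1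
  let G₂ : Set (ℕ → ℝ × ℝ) := fst ⁻¹' G ∩ snd ⁻¹' G
  have hG₂ : IsGδ G₂ := (hG.isGδ.preimage hfst).inter (hG.isGδ.preimage hsnd)
  have hPG : ∀ k w, P k w → w ∈ G₂ := by
    rintro k w ⟨h₁, h₂, e₁, e₂, -⟩
    exact ⟨by simpa [e₁] using hG.add_ratVec_mem x hx h₁,
      by simpa [e₂] using hG.add_ratVec_mem x hx h₂⟩
  have hQ : ∀ k w, P k w → ∀ᶠ z in 𝓝[G₂] w, Q k z := by
    intro k w hw
    have hwG := hPG k w hw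
    obtain ⟨-, -, -, -, -, hlt⟩ := hw
    have hcont : ContinuousWithinAt (fun w => θ (snd w) - θ (fst w)) G₂ w :=
      ((hG.continuousOn _ hwG.2).comp hsnd.continuousWithinAt fun _ h => h.2).sub
        ((hG.continuousOn _ hwG.1).comp hfst.continuousWithinAt fun _ h => h.1)
    have hlsc : LowerSemicontinuous fun u : ℕ → ℝ => lpSum p u + 1 :=
      (lowerSemicontinuous_lpSum hp0.le).add lowerSemicontinuous_const
    exact hcont.eventually (hlsc _ _ hlt)
  have step : ∀ k w N, P k w → ∃ w', P (k + 1) w' ∧ ∀ i < N, w' i = w i := by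
    rintro k w N ⟨h₁, h₂, e₁, e₂, hle, hlt⟩
    rw [e₁, e₂] at hlt
    obtain ⟨n, ⟨a, b, hab, hn⟩, hn0, hnN⟩ := ((hG.exists_step hx hp hfin hc hc' hjump (hm k)
      h₁ h₂ hlt).and ((eventually_finsupp_eq_zero (h₂ - h₁)).and (eventually_ge_atTop N))).exists
    refine ⟨fun i => ((x + ratVec (h₁ + Finsupp.single n a)) i,
      (x + ratVec (h₂ + Finsupp.single n b)) i),
      ⟨h₁ + Finsupp.single n a, h₂ + Finsupp.single n b, rfl, rfl, ?_, ?_⟩, fun i hi => ?_⟩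
    · rw [add_sub_add_comm, ← Finsupp.single_sub, hab, Finset.sum_range_succ]
      refine (lpSum_ratVec_add_single_le hn0 _).trans ?_
      push_cast
      exact add_le_add_left hle _
    · rw [show M (k + 1) = M k + (c / m k / 2) ^ p from Finset.sum_range_succ _ _]
      exact hn
    · have hin : i ≠ n := by omega
      have e₁i := congrFun e₁ i
      have e₂i := congrFun e₂ i
      refine Prod.ext ?_ ?_
      · simpa [ratVec, hin] using e₁i.symm
      · simpa [ratVec, hin] using e₂i.symm
  have h₀ : P 0 (fun i => (x i, x i)) :=
    ⟨0, 0, by simp [ratVec_zero, fst], by simp [ratVec_zero, snd],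
      by simp [ratVec_zero, lpSum, hq], by simp [M]⟩
  obtain ⟨w, z, hw, hlim, -, hz⟩ := hG₂.exists_tendsto_of_extension hPG hQ step h₀
  have hlim' := hlim.mono_right nhdsWithin_le_nhds
  refine ⟨fst z, snd z, ?_, ?_⟩
  · refine ne_top_of_le_ne_top hmq (lpSum_le_of_tendsto hq.le
      (((hsnd.tendsto z).comp hlim').sub ((hfst.tendsto z).comp hlim'))
      (Eventually.of_forall fun k => ?_))
    obtain ⟨h₁, h₂, e₁, e₂, hle, -⟩ := hw k
    have e : snd (w k) - fst (w k) = ratVec (h₂ - h₁) := by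
      rw [e₁, e₂]
      ext n
      simp [ratVec]
    simp only [Function.comp_apply]
    rw [e]
    exact hle.trans (ENNReal.sum_le_tsum _)
  · have hle : ∑' j, (c / m j / 2) ^ p ≤ lpSum p (θ (snd z) - θ (fst z)) + 1 := by
      rw [ENNReal.tsum_eq_iSup_nat]
      exact iSup_le fun k => (hz k).le
    rw [tsum_div_div_rpow_eq_top hp0 hm hmp hc, top_le_iff] at hle
    simpa using hle

end IsContinuitySet

theorem not_borelReducible_lpRel_of_lt {p q : ℝ} (hp : 1 ≤ p) (hpq : p < q) :
    ¬ BorelReducible (lpRel q) (lpRel p) := by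
  rintro ⟨θ, hθ, hred⟩
  have hp0 : 0 < p := by linarith
  have hq : 0 < q := hp0.trans hpq
  rw [← BorelSpace.measurable_eq (α := ℕ → ℝ)] at hθ
  have hiff : ∀ y z, lpSum q (z - y) ≠ ∞ ↔ lpSum p (θ z - θ y) ≠ ∞ := fun y z => by
    rw [← lpRel_iff hp0.le, ← lpRel_iff hq.le]
    exact hred z y
  have hfin : ∀ x h, lpSum p (θ (x + ratVec h) - θ x) ≠ ∞ := fun x h =>
    (hiff _ _).1 (by simpa using lpSum_ratVec_ne_top hq h)
  obtain ⟨G, hG⟩ := exists_isContinuitySet hp hθ hfin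
  obtain ⟨x, hx⟩ := hG.nonempty
  obtain ⟨c, hc, hjump⟩ := hG.exists_eventually_le_lpENorm hx hp hq fun y => (hiff x y).2
  obtain ⟨y, z, hyz, hθyz⟩ := hG.exists_lpSum_eq_top hx hp hpq (hfin x) hc hjump
  exact (hiff y z).1 hyz hθyz

/-- Dougherty–Hjorth: for reals `1 ≤ p < q`, `ℓp` is Borel reducible
to `ℓq` but `ℓq` is not Borel reducible to `ℓp`. -/
theorem dougherty_hjorth (p q : ℝ) (hp : 1 ≤ p) (hpq : p < q) :
    BorelReducible (lpRel p) (lpRel q) ∧ ¬ BorelReducible (lpRel q) (lpRel p) :=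
  ⟨borelReducible_lpRel_of_lt (by linarith) hpq, not_borelReducible_lpRel_of_lt hp hpq⟩
end

section
/- (i) E₁ is not essentially countable: there is no Borel equivalence relation F on a Polish space all of whose equivalence classes are countable such that E₁ is Borel reducible to F. (ii) E₀ <B E₁ strictly: E₀ is Borel reducible to E₁, but E₁ is not Borel reducible to E₀. -/
open MeasureTheory

/-- `E₀`: eventual equality on Cantor space `2^ℕ`. -/
def E0 (x y : ℕ → Bool) : Prop := {n : ℕ | x n ≠ y n}.Finite

/-- `E` is essentially countable: `E` is Borel reducible to some Borel equivalence
relation on a Polish space all of whose classes are countable. -/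
def EssentiallyCountable {X : Type*} [TopologicalSpace X] (E : X → X → Prop) : Prop :=
  ∃ (Y : Type) (_ : TopologicalSpace Y) (F : Y → Y → Prop),
    PolishSpace Y ∧ Equivalence F ∧
    MeasurableSet[borel (Y × Y)] {p : Y × Y | F p.1 p.2} ∧
    (∀ y : Y, {z : Y | F y z}.Countable) ∧
    BorelReducible E F

open Filter Topology

section ProductMeasure

variable {C : Type*} [MeasurableSpace C] (ν : Measure C) [IsProbabilityMeasure ν]

/-- Resampling one coordinate of an infinite product probability measure preserves it. -/
theorem measurePreserving_update_infinitePi (n : ℕ) :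
    MeasurePreserving (fun p : (ℕ → C) × C => Function.update p.1 n p.2)
      ((Measure.infinitePi fun _ : ℕ => ν).prod ν) (Measure.infinitePi fun _ : ℕ => ν) := by
  have hm : Measurable fun p : (ℕ → C) × C => Function.update p.1 n p.2 := by
    refine measurable_pi_lambda _ fun k => ?_
    by_cases h : k = n
    · subst h
      simpa using measurable_snd
    · simpa [h, Function.comp_def] using (measurable_pi_apply k).comp (measurable_fst (β := C))
  refine ⟨hm, Measure.eq_infinitePi _ fun s t ht => ?_⟩
  rw [Measure.map_apply hm (.pi s.countable_toSet fun i _ => ht i)]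
  by_cases hn : n ∈ s
  · have h : (fun p : (ℕ → C) × C => Function.update p.1 n p.2) ⁻¹' Set.pi s t =
        Set.pi (s.erase n : Finset ℕ) t ×ˢ t n := by
      ext ⟨x, a⟩
      simp only [Set.mem_preimage, Set.mem_pi, Set.mem_prod, Finset.mem_coe, Finset.mem_erase]
      refine ⟨fun h => ⟨fun i hi => by simpa [hi.1] using h i hi.2, by simpa using h n hn⟩, ?_⟩
      rintro ⟨h₁, h₂⟩ i hi
      by_cases h : i = n
      · subst h
        simpa using h₂
      · simpa [h] using h₁ i ⟨h, hi⟩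
    rw [h, Measure.prod_prod, Measure.infinitePi_pi _ fun i _ => ht i, mul_comm,
      Finset.mul_prod_erase s (fun i => ν (t i)) hn]
  · have h : (fun p : (ℕ → C) × C => Function.update p.1 n p.2) ⁻¹' Set.pi s t =
        Set.pi s t ×ˢ Set.univ := by
      ext ⟨x, a⟩
      simp only [Set.mem_preimage, Set.mem_pi, Set.mem_prod, Finset.mem_coe, Set.mem_univ,
        and_true]
      refine forall₂_congr fun i hi => ?_
      rw [Function.update_of_ne (ne_of_mem_of_not_mem hi hn)]
    rw [h, Measure.prod_prod, Measure.infinitePi_pi _ fun i _ => ht i, measure_univ, mul_one]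

/-- Every almost sure property contains an almost sure property which is stable under almost
every change of a single coordinate. -/
theorem exists_ae_stable_update {P : (ℕ → C) → Prop}
    (hP : ∀ᵐ x ∂(Measure.infinitePi fun _ : ℕ => ν), P x) :
    ∃ Q : (ℕ → C) → Prop, (∀ᵐ x ∂(Measure.infinitePi fun _ : ℕ => ν), Q x) ∧
      (∀ x, Q x → P x) ∧ ∀ x, Q x → ∀ n, ∀ᵐ a ∂ν, Q (Function.update x n a) := by
  let R : ℕ → (ℕ → C) → Prop := fun k =>
    Nat.rec P (fun _ S x => ∀ n, ∀ᵐ a ∂ν, S (Function.update x n a)) k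
  refine ⟨fun x => ∀ k, R k x, ae_all_iff.2 fun k => ?_, fun x hx => hx 0,
    fun x hx n => ae_all_iff.2 fun k => hx (k + 1) n⟩
  induction k with
  | zero => exact hP
  | succ k ih =>
    exact ae_all_iff.2 fun n => Measure.ae_ae_of_ae_prod
      ((measurePreserving_update_infinitePi ν n).quasiMeasurePreserving.ae ih)

/-- If `θ` takes only countably many values when a coordinate varies, then almost every point of
a measurable set `K` can be changed at that coordinate in a non-negligible set of ways,
keeping it in `K` and keeping the value of `θ`. -/
theorem ae_frequently_update_eq {Y : Type*} [MeasurableSpace Y] [MeasurableEq Y]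
    {θ : (ℕ → C) → Y} (hθ : Measurable θ) {K : Set (ℕ → C)} (hK : MeasurableSet K) (n : ℕ)
    (hc : ∀ x, (Set.range fun a => θ (Function.update x n a)).Countable) :
    ∀ᵐ x ∂(Measure.infinitePi fun _ : ℕ => ν),
      x ∈ K → ∃ᵐ a ∂ν, Function.update x n a ∈ K ∧ θ (Function.update x n a) = θ x := by
  have hmp := measurePreserving_update_infinitePi ν n
  have hA : MeasurableSet {p : (ℕ → C) × C |
      Function.update p.1 n p.2 ∈ K ∧ θ (Function.update p.1 n p.2) = θ p.1} :=
    (hmp.measurable hK).inter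
      (measurableSet_eq_fun (hθ.comp hmp.measurable) (hθ.comp measurable_fst))
  have hB : MeasurableSet {x : ℕ → C |
      x ∈ K → ∃ᵐ a ∂ν, Function.update x n a ∈ K ∧ θ (Function.update x n a) = θ x} := by
    have h : MeasurableSet {x : ℕ → C |
        ∃ᵐ a ∂ν, Function.update x n a ∈ K ∧ θ (Function.update x n a) = θ x} := by
      simp only [frequently_ae_iff]
      exact (measurable_measure_prodMk_left hA) (measurableSet_singleton 0).compl
    convert hK.compl.union h using 1
    ext x
    simp [imp_iff_not_or]
  rw [← hmp.map_eq, ae_map_iff hmp.measurable.aemeasurable hB]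
  refine (Measure.ae_prod_iff_ae_ae (hmp.measurable hB)).2 ?_
  refine .of_forall fun x => ?_
  have hv : ∀ y ∈ Set.range fun a => θ (Function.update x n a), ∀ᵐ a ∂ν,
      θ (Function.update x n a) = y → Function.update x n a ∈ K →
        ∃ᵐ b ∂ν, Function.update x n b ∈ K ∧ θ (Function.update x n b) = y := by
    intro y _
    by_cases h : ∃ᵐ b ∂ν, Function.update x n b ∈ K ∧ θ (Function.update x n b) = y
    · exact .of_forall fun _ _ _ => h
    · filter_upwards [not_frequently.1 h] with a ha h₁ h₂ using absurd ⟨h₂, h₁⟩ ha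
  filter_upwards [(ae_ball_iff (hc x)).2 hv] with a ha hak
  simpa only [Function.update_idem] using ha _ ⟨a, rfl⟩ rfl hak

end ProductMeasure

/-- A weak form of Lusin's theorem: a measurable map has closed fibres on some closed set of
positive measure. -/
theorem exists_isClosed_fiber_closed {X Y : Type*} [TopologicalSpace X]
    [TopologicalSpace.PseudoMetrizableSpace X] [MeasurableSpace X] [BorelSpace X]
    [MeasurableSpace Y] [MeasurableSpace.CountablySeparated Y]
    (μ : Measure X) [IsProbabilityMeasure μ] {θ : X → Y} (hθ : Measurable θ) :
    ∃ K : Set X, IsClosed K ∧ μ K ≠ 0 ∧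
      ∀ (u : ℕ → X) (x : X) (y : Y), (∀ n, u n ∈ K) → (∀ n, θ (u n) = y) →
        Tendsto u atTop (𝓝 x) → θ x = y := by
  obtain ⟨S, hS, hsep⟩ := exists_seq_separating Y (p := MeasurableSet) .empty Set.univ
  obtain ⟨ε, hε, hsum⟩ := ENNReal.exists_pos_sum_of_countable' (ε := 1) one_ne_zero (ℕ × Bool)
  have hT : ∀ i : ℕ × Bool, MeasurableSet (θ ⁻¹' (bif i.2 then S i.1 else (S i.1)ᶜ)) := by
    rintro ⟨n, _ | _⟩
    · exact hθ (hS n).compl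
    · exact hθ (hS n)
  choose D hDs hDc hD using fun i =>
    (hT i).exists_isClosed_sdiff_lt (measure_ne_top μ _) (hε i).ne'
  have hK : IsClosed (⋂ n, D (n, true) ∪ D (n, false)) :=
    isClosed_iInter fun n => (hDc _).union (hDc _)
  refine ⟨⋂ n, D (n, true) ∪ D (n, false), hK, fun h0 => ?_, ?_⟩
  · have hsub : (⋂ n, D (n, true) ∪ D (n, false))ᶜ ⊆
        ⋃ i : ℕ × Bool, θ ⁻¹' (bif i.2 then S i.1 else (S i.1)ᶜ) \ D i := by
      intro x hx
      simp only [Set.mem_compl_iff, Set.mem_iInter, not_forall, Set.mem_union, not_or] at hx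
      obtain ⟨n, h₁, h₂⟩ := hx
      by_cases h : θ x ∈ S n
      · exact Set.mem_iUnion.2 ⟨(n, true), h, h₁⟩
      · exact Set.mem_iUnion.2 ⟨(n, false), h, h₂⟩
    have h1 : μ (⋂ n, D (n, true) ∪ D (n, false))ᶜ = 1 :=
      (prob_compl_eq_one_iff hK.measurableSet).2 h0
    refine lt_irrefl (1 : ENNReal) ?_
    calc (1 : ENNReal) = μ (⋂ n, D (n, true) ∪ D (n, false))ᶜ := h1.symm
      _ ≤ μ (⋃ i : ℕ × Bool, θ ⁻¹' (bif i.2 then S i.1 else (S i.1)ᶜ) \ D i) :=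
        measure_mono hsub
      _ ≤ ∑' i, μ (θ ⁻¹' (bif i.2 then S i.1 else (S i.1)ᶜ) \ D i) := measure_iUnion_le _
      _ ≤ ∑' i, ε i := ENNReal.tsum_le_tsum fun i => (hD i).le
      _ < 1 := hsum
  · intro u x y hu huy hux
    refine hsep _ trivial _ trivial fun n => ?_
    have hmem : ∀ k, u k ∈ D (n, true) ∪ D (n, false) := fun k => Set.mem_iInter.1 (hu k) n
    have htrue : ∀ k, u k ∈ D (n, true) → y ∈ S n := fun k hk => huy k ▸ hDs _ hk
    have hfalse : ∀ k, u k ∈ D (n, false) → y ∉ S n := fun k hk => huy k ▸ hDs _ hk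
    by_cases hy : y ∈ S n
    · have hx : x ∈ D (n, true) := (hDc _).mem_of_tendsto hux <|
        .of_forall fun k => (hmem k).resolve_right fun h => hfalse k h hy
      exact iff_of_true (hDs _ hx) hy
    · have hx : x ∈ D (n, false) := (hDc _).mem_of_tendsto hux <|
        .of_forall fun k => (hmem k).resolve_left fun h => hy (htrue k h)
      exact iff_of_false (hDs _ hx) hy

/-- If a Borel map on a countable power takes countably many values whenever a single coordinate
varies, then there are two points which differ at every coordinate and have the same image. -/
theorem exists_forall_ne_and_eq_of_countable_range {C Y : Type*} [TopologicalSpace C]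
    [TopologicalSpace.PseudoMetrizableSpace C] [SecondCountableTopology C]
    [MeasurableSpace C] [BorelSpace C]
    [MeasurableSpace Y] [MeasurableSpace.CountablySeparated Y] [MeasurableEq Y]
    (ν : Measure C) [IsProbabilityMeasure ν] [NullSingletonClass ν]
    {θ : (ℕ → C) → Y} (hθ : Measurable θ)
    (hc : ∀ n x, (Set.range fun a => θ (Function.update x n a)).Countable) :
    ∃ x x' : ℕ → C, (∀ n, x n ≠ x' n) ∧ θ x = θ x' := by
  obtain ⟨K, hKc, hK0, hK⟩ :=
    exists_isClosed_fiber_closed (Measure.infinitePi fun _ : ℕ => ν) hθ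
  obtain ⟨Q, hQae, hQ, hQs⟩ := exists_ae_stable_update ν
    (ae_all_iff.2 fun n => ae_frequently_update_eq ν hθ hKc.measurableSet n (hc n))
  obtain ⟨x₀, hx₀K, hx₀Q⟩ : ∃ x, x ∈ K ∧ Q x :=
    ((frequently_ae_mem_iff.2 hK0).and_eventually hQae).exists
  have step : ∀ (n : ℕ) (x : {x // x ∈ K ∧ Q x}), ∃ a, a ≠ x.1 n ∧
      (Function.update x.1 n a ∈ K ∧ Q (Function.update x.1 n a)) ∧
      θ (Function.update x.1 n a) = θ x.1 := by
    rintro n ⟨x, hxK, hxQ⟩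
    obtain ⟨a, ⟨⟨haK, haθ⟩, haQ⟩, hax⟩ := (((hQ x hxQ n hxK).and_eventually
      (hQs x hxQ n)).and_eventually (measure_eq_zero_iff_ae_notMem.1
        (measure_singleton (μ := ν) (x n)))).exists
    exact ⟨a, hax, ⟨haK, haQ⟩, haθ⟩
  choose a ha hmem hθa using step
  let u : ℕ → {x // x ∈ K ∧ Q x} := fun n =>
    Nat.rec ⟨x₀, hx₀K, hx₀Q⟩ (fun n x => ⟨Function.update x.1 n (a n x), hmem n x⟩) n
  have hu : ∀ n, (u (n + 1)).1 = Function.update (u n).1 n (a n (u n)) := fun _ => rfl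
  have hθu : ∀ n, θ (u n).1 = θ x₀ := by
    intro n
    induction n with
    | zero => rfl
    | succ n ih => rw [hu, hθa, ih]
  have hlow : ∀ n k, n ≤ k → (u n).1 k = x₀ k := by
    intro n
    induction n with
    | zero => exact fun _ _ => rfl
    | succ n ih =>
      intro k hk
      rw [hu, Function.update_of_ne (by omega), ih k (by omega)]
  have hhigh : ∀ k n, k + 1 ≤ n → (u n).1 k = a k (u k) := by
    intro k n hn
    induction n, hn using Nat.le_induction with
    | base => rw [hu, Function.update_self]
    | succ n hn ih => rw [hu, Function.update_of_ne (by omega), ih]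
  refine ⟨fun k => a k (u k), x₀, fun k => hlow k k le_rfl ▸ ha k (u k), ?_⟩
  refine hK (fun n => (u n).1) _ _ (fun n => (u n).2.1) hθu (tendsto_pi_nhds.2 fun k => ?_)
  exact tendsto_const_nhds.congr'
    ((eventually_ge_atTop (k + 1)).mono fun n hn => (hhigh k n hn).symm)

theorem exists_isProbabilityMeasure_nullSingletonClass (C : Type*) [MeasurableSpace C]
    [StandardBorelSpace C] [Uncountable C] :
    ∃ ν : Measure C, IsProbabilityMeasure ν ∧ NullSingletonClass ν := by
  let e : unitInterval ≃ᵐ C := PolishSpace.measurableEquivOfNotCountable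
    (fun h => zero_lt_one.not_ge (Cardinal.Real.Icc_countable_iff.1 (Set.countable_coe_iff.1 h)))
    (not_countable_iff.2 ‹_›)
  refine ⟨Measure.map e volume, Measure.isProbabilityMeasure_map e.measurable.aemeasurable,
    ⟨fun c => ?_⟩⟩
  rw [e.map_apply, ← e.image_symm, Set.image_singleton, measure_singleton]

/-- `E₁` is not Borel reducible to a relation with countable classes on a second countable
Hausdorff space. -/
theorem not_borelReducible_E1_of_countable {Y : Type*} [TopologicalSpace Y] [T2Space Y]
    [SecondCountableTopology Y] {F : Y → Y → Prop} (hF : ∀ y, {z | F y z}.Countable) :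
    ¬ BorelReducible E1 F := by
  rintro ⟨θ, hθ, hred⟩
  borelize Y
  rw [← BorelSpace.measurable_eq (α := ℕ → ℕ → Bool)] at hθ
  have : Uncountable (ℕ → Bool) := not_countable_iff.1 <| Cardinal.mk_le_aleph0_iff.not.1 <| by
    simp [Cardinal.aleph0_lt_continuum]
  obtain ⟨ν, _, _⟩ := exists_isProbabilityMeasure_nullSingletonClass (ℕ → Bool)
  obtain ⟨x, x', hne, heq⟩ := exists_forall_ne_and_eq_of_countable_range ν hθ fun n x => by
    refine (hF (θ x)).mono ?_
    rintro _ ⟨a, rfl⟩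
    refine (hred _ _).1 ((Set.finite_singleton n).subset fun k hk => ?_)
    by_contra h
    exact hk (Function.update_of_ne h a x).symm
  have hfin : E1 x x' := (hred x x').2 (heq ▸ (hred x x).1 (by simp [E1]))
  have huniv : {k | x k ≠ x' k} = Set.univ := Set.eq_univ_of_forall hne
  rw [E1, huniv] at hfin
  exact Set.infinite_univ hfin

theorem countable_setOf_E0 (y : ℕ → Bool) : {z | E0 y z}.Countable := by
  refine Set.MapsTo.countable_of_injOn (f := fun z => {n | y n ≠ z n})
    (t := {s : Set ℕ | s.Finite}) (fun z hz => hz) ?_ Set.Countable.ofPred_finite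
  intro z _ w _ h
  funext n
  have hn : (y n ≠ z n) ↔ (y n ≠ w n) := Set.ext_iff.1 h n
  revert hn
  cases y n <;> cases z n <;> cases w n <;> simp

theorem borelReducible_E0_E1 : BorelReducible E0 E1 := by
  refine ⟨fun x k _ => x k, ?_, fun x x' => ?_⟩
  · borelize (ℕ → Bool) (ℕ → ℕ → Bool)
    exact Continuous.measurable (by fun_prop)
  · have h : ∀ k, ((fun _ : ℕ => x k) ≠ fun _ => x' k) ↔ x k ≠ x' k := fun k =>
      (Function.const_injective (α := ℕ)).ne_iff
    simp only [E0, E1, h]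

/-- (i) `E₁` is not essentially countable; (ii) `E₀ <B E₁` strictly:
`E₀` is Borel reducible to `E₁` but `E₁` is not Borel reducible to `E₀`. -/
theorem E1_not_essentially_countable_and_above_E0 :
    ¬ EssentiallyCountable E1 ∧
    BorelReducible E0 E1 ∧ ¬ BorelReducible E1 E0 := by
  refine ⟨?_, borelReducible_E0_E1, not_borelReducible_E1_of_countable countable_setOf_E0⟩
  rintro ⟨Y, _, F, _, -, -, hF, hred⟩
  exact not_borelReducible_E1_of_countable hF hred
end
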